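/- arXiv:1408.1877 — 2 statements merged into one kernel-verified Lean document; each statement's English description precedes it below -/
import Mathlib

section
/- Let d ≥ 3, let 0 < p ≤ 1 and let p < q ≤ ∞ (with the convention 1/∞ = 0). Then there exist constants c, C > 0 such that for every integer n ≥ 1: (a) every spherical harmonic Y_n of degree n on S^{d-1} satisfies ‖Y_n‖_q ≤ C · n^{λ(1/p − 1/q)} · ‖Y_n‖_p; and (b) there exists a nonzero spherical harmonic Y_n of degree n on S^{d-1} with ‖Y_n‖_q ≥ c · n^{λ(1/p − 1/q)} · ‖Y_n‖_p. -/
open MeasureTheory Metric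
open scoped ENNReal

noncomputable section

/-- The unit sphere `S^{d-1}` in `ℝ^d`. -/
abbrev Sph (d : ℕ) := Metric.sphere (0 : EuclideanSpace ℝ (Fin d)) 1

/-- The surface measure `σ` on the unit sphere in `ℝ^d`. -/
def sphMeasure (d : ℕ) : Measure (Sph d) :=
  (volume : Measure (EuclideanSpace ℝ (Fin d))).toSphere

/-- `Y : S^{d-1} → ℝ` is a spherical harmonic of degree `n` if it is the restriction to
`S^{d-1}` of a polynomial in `d` real variables that is homogeneous of degree `n` and
harmonic (the sum of its second partial derivatives vanishes identically). -/
def IsSphericalHarmonic (d n : ℕ) (Y : Sph d → ℝ) : Prop :=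
  ∃ P : MvPolynomial (Fin d) ℝ, P.IsHomogeneous n ∧
    (∑ i : Fin d, MvPolynomial.pderiv i (MvPolynomial.pderiv i P)) = 0 ∧
    ∀ x : Sph d, Y x = MvPolynomial.eval (fun i => (x : EuclideanSpace ℝ (Fin d)) i) P

open MvPolynomial in
/-- The polynomial function on `ℝ^d` attached to a multivariate polynomial. -/
def polyFun {d : ℕ} (P : MvPolynomial (Fin d) ℝ) (x : EuclideanSpace ℝ (Fin d)) : ℝ :=
  MvPolynomial.eval (fun i => x i) P

section Gaussian

variable {d : ℕ}

local notation "𝔼" => EuclideanSpace ℝ (Fin d)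

lemma polyFun_add (P Q : MvPolynomial (Fin d) ℝ) (x : 𝔼) :
    polyFun (P + Q) x = polyFun P x + polyFun Q x := by simp [polyFun]

lemma polyFun_mul (P Q : MvPolynomial (Fin d) ℝ) (x : 𝔼) :
    polyFun (P * Q) x = polyFun P x * polyFun Q x := by simp [polyFun]

lemma polyFun_pow (P : MvPolynomial (Fin d) ℝ) (k : ℕ) (x : 𝔼) :
    polyFun (P ^ k) x = polyFun P x ^ k := by simp [polyFun]

lemma polyFun_C (a : ℝ) (x : 𝔼) : polyFun (MvPolynomial.C a) x = a := by simp [polyFun]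

lemma polyFun_X (i : Fin d) (x : 𝔼) : polyFun (MvPolynomial.X i) x = x i := by simp [polyFun]

lemma continuous_polyFun (P : MvPolynomial (Fin d) ℝ) : Continuous (polyFun P) :=
  (MvPolynomial.continuous_eval P).comp (by fun_prop)

lemma polyFun_smul {P : MvPolynomial (Fin d) ℝ} {n : ℕ} (hP : P.IsHomogeneous n) (r : ℝ) (x : 𝔼) :
    polyFun P (r • x) = r ^ n * polyFun P x := by
  unfold polyFun
  rw [MvPolynomial.eval_eq, MvPolynomial.eval_eq, Finset.mul_sum]
  refine Finset.sum_congr rfl fun m hm => ?_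
  have hdeg : m.sum (fun _ e => e) = n := by
    have := hP (MvPolynomial.mem_support_iff.1 hm)
    simpa [Finsupp.weight_apply] using this
  have h2 : ∏ i ∈ m.support, (r • x) i ^ m i = r ^ n * ∏ i ∈ m.support, x i ^ m i := by
    rw [← hdeg, Finsupp.sum, ← Finset.prod_pow_eq_pow_sum, ← Finset.prod_mul_distrib]
    exact Finset.prod_congr rfl fun i _ => by simp [mul_pow]
  rw [h2]; ring

lemma polyFun_growth (P : MvPolynomial (Fin d) ℝ) :
    ∃ (C : ℝ) (N : ℕ), 0 ≤ C ∧ ∀ x : 𝔼, |polyFun P x| ≤ C * (1 + ‖x‖) ^ N := by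
  induction P using MvPolynomial.induction_on with
  | C a => exact ⟨|a|, 0, abs_nonneg a, fun x => by simp [polyFun_C]⟩
  | add P Q hP hQ =>
    obtain ⟨C, N, hC, h⟩ := hP
    obtain ⟨C', N', hC', h'⟩ := hQ
    refine ⟨C + C', N + N', by positivity, fun x => ?_⟩
    rw [polyFun_add]
    have h1 : (1 : ℝ) ≤ 1 + ‖x‖ := by linarith [norm_nonneg x]
    calc |polyFun P x + polyFun Q x| ≤ C * (1 + ‖x‖) ^ N + C' * (1 + ‖x‖) ^ N' :=
          (abs_add_le _ _).trans (add_le_add (h x) (h' x))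
      _ ≤ C * (1 + ‖x‖) ^ (N + N') + C' * (1 + ‖x‖) ^ (N + N') := by
          gcongr <;> first | exact h1 | omega
      _ = _ := by ring
  | mul_X P i hP =>
    obtain ⟨C, N, hC, h⟩ := hP
    refine ⟨C, N + 1, hC, fun x => ?_⟩
    rw [polyFun_mul, polyFun_X, abs_mul, pow_succ, ← mul_assoc]
    have : |x i| ≤ 1 + ‖x‖ := by
      have := PiLp.norm_apply_le x i
      rw [Real.norm_eq_abs] at this
      linarith
    exact mul_le_mul (h x) this (abs_nonneg _) (by positivity)

lemma integrable_exp_neg_half_norm_sq :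
    Integrable (fun x : 𝔼 => Real.exp (-(‖x‖ ^ 2 / 2))) := by
  have h := GaussianFourier.integrable_cexp_neg_mul_sq_norm_add (V := 𝔼) (b := (1 / 2 : ℂ))
    (by norm_num) 0 0
  refine h.norm.congr (Filter.Eventually.of_forall fun x => ?_)
  simp only [Complex.norm_exp]
  congr 1
  simp [← Complex.ofReal_pow]
  ring

lemma integrable_polyFun_mul_gaussian (P : MvPolynomial (Fin d) ℝ) :
    Integrable (fun x : 𝔼 => polyFun P x * Real.exp (-‖x‖ ^ 2)) := by
  obtain ⟨C, N, hC, h⟩ := polyFun_growth P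
  refine (integrable_exp_neg_half_norm_sq.const_mul (C * (N.factorial * Real.exp (3 / 2)))).mono'
    ((continuous_polyFun P).mul (by fun_prop)).aestronglyMeasurable
    (Filter.Eventually.of_forall fun x => ?_)
  rw [norm_mul, Real.norm_eq_abs, Real.norm_eq_abs, Real.abs_exp]
  have h1 : (1 + ‖x‖) ^ N ≤ N.factorial * Real.exp (1 + ‖x‖) := by
    have := Real.pow_div_factorial_le_exp (1 + ‖x‖) (by positivity) N
    rwa [div_le_iff₀ (by positivity), mul_comm] at this
  calc |polyFun P x| * Real.exp (-‖x‖ ^ 2)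
      ≤ C * (N.factorial * Real.exp (1 + ‖x‖)) * Real.exp (-‖x‖ ^ 2) := by
        gcongr; exact (h x).trans (by gcongr)
    _ = C * N.factorial * Real.exp (1 + ‖x‖ + -‖x‖ ^ 2) := by rw [Real.exp_add _ (-‖x‖ ^ 2)]; ring
    _ ≤ C * N.factorial * Real.exp (3 / 2 + -(‖x‖ ^ 2 / 2)) := by
        gcongr C * N.factorial * Real.exp ?_
        nlinarith [sq_nonneg (‖x‖ - 1)]
    _ = _ := by rw [Real.exp_add]; ring

lemma hasFDerivAt_polyFun (P : MvPolynomial (Fin d) ℝ) (x : 𝔼) :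
    HasFDerivAt (polyFun P)
      (∑ i, polyFun (MvPolynomial.pderiv i P) x • (EuclideanSpace.proj i : 𝔼 →L[ℝ] ℝ)) x := by
  induction P using MvPolynomial.induction_on with
  | C a =>
    have : polyFun (MvPolynomial.C a : MvPolynomial (Fin d) ℝ) = fun _ => a :=
      funext fun x => polyFun_C a x
    rw [this]
    simpa [polyFun] using hasFDerivAt_const a x
  | add P Q hP hQ =>
    have : polyFun (P + Q) = fun x => polyFun P x + polyFun Q x := funext fun x => polyFun_add P Q x
    rw [this]
    convert! hP.add hQ using 1
    simp [polyFun_add, add_smul, Finset.sum_add_distrib]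
  | mul_X P i hP =>
    have : polyFun (P * MvPolynomial.X i) = fun x => polyFun P x * x i :=
      funext fun x => by rw [polyFun_mul, polyFun_X]
    rw [this]
    convert! hP.mul (EuclideanSpace.proj i : 𝔼 →L[ℝ] ℝ).hasFDerivAt using 1
    ext v
    simp only [Derivation.leibniz, MvPolynomial.pderiv_X, smul_eq_mul, polyFun_add, polyFun_mul,
      polyFun_X, sum_apply, add_apply,
      smul_apply, PiLp.proj_apply, add_mul, Finset.sum_add_distrib,
      Finset.mul_sum, mul_assoc]
    congr 1
    simp [Pi.single_apply, polyFun]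


/-- The integral of a polynomial against the Gaussian weight `exp (-‖x‖²)`. -/
def gaussInt (P : MvPolynomial (Fin d) ℝ) : ℝ :=
  ∫ x : 𝔼, polyFun P x * Real.exp (-‖x‖ ^ 2)

lemma gaussInt_add (P Q : MvPolynomial (Fin d) ℝ) :
    gaussInt (P + Q) = gaussInt P + gaussInt Q := by
  unfold gaussInt
  rw [← integral_add (integrable_polyFun_mul_gaussian P) (integrable_polyFun_mul_gaussian Q)]
  simp [polyFun_add, add_mul]

lemma gaussInt_C_mul (a : ℝ) (P : MvPolynomial (Fin d) ℝ) :
    gaussInt (MvPolynomial.C a * P) = a * gaussInt P := by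
  unfold gaussInt
  rw [← integral_const_mul]
  simp [polyFun_mul, polyFun_C, mul_assoc]

lemma gaussInt_zero : gaussInt (0 : MvPolynomial (Fin d) ℝ) = 0 := by simp [gaussInt, polyFun]

lemma gaussInt_sum {ι : Type*} (s : Finset ι) (P : ι → MvPolynomial (Fin d) ℝ) :
    gaussInt (∑ i ∈ s, P i) = ∑ i ∈ s, gaussInt (P i) := by
  classical
  induction s using Finset.induction_on with
  | empty => simp [gaussInt_zero]
  | insert a s ha ih => rw [Finset.sum_insert ha, Finset.sum_insert ha, gaussInt_add, ih]

lemma gaussInt_one_pos : 0 < gaussInt (1 : MvPolynomial (Fin d) ℝ) := by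
  have h := integrable_polyFun_mul_gaussian (1 : MvPolynomial (Fin d) ℝ)
  have h1 : ∀ x : 𝔼, polyFun (1 : MvPolynomial (Fin d) ℝ) x = 1 := fun x => by simp [polyFun]
  unfold gaussInt
  simp only [h1, one_mul] at h ⊢
  exact integral_exp_pos h

/-- Integration by parts for the Gaussian weight. -/
lemma gaussInt_X_mul (i : Fin d) (P : MvPolynomial (Fin d) ℝ) :
    2 * gaussInt (MvPolynomial.X i * P) = gaussInt (MvPolynomial.pderiv i P) := by
  have hg : ∀ x : 𝔼, HasFDerivAt (fun x : 𝔼 => Real.exp (-‖x‖ ^ 2))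
      (Real.exp (-‖x‖ ^ 2) • (-(2 • (innerSL ℝ x : 𝔼 →L[ℝ] ℝ)) : 𝔼 →L[ℝ] ℝ)) x := fun x =>
    ((hasStrictFDerivAt_norm_sq x).hasFDerivAt.neg).exp
  have hf := hasFDerivAt_polyFun P
  have e1 : ∀ x : 𝔼, (∑ j, polyFun (MvPolynomial.pderiv j P) x •
      (EuclideanSpace.proj j : 𝔼 →L[ℝ] ℝ)) (EuclideanSpace.single i 1)
      = polyFun (MvPolynomial.pderiv i P) x := fun x => by
    simp
  have e2 : ∀ x : 𝔼, (Real.exp (-‖x‖ ^ 2) • (-(2 • (innerSL ℝ x : 𝔼 →L[ℝ] ℝ)) : 𝔼 →L[ℝ] ℝ))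
      (EuclideanSpace.single i 1)
      = -2 * (x i * Real.exp (-‖x‖ ^ 2)) := fun x => by
    simp [EuclideanSpace.inner_single_right]; ring
  have key := integral_bilinear_hasFDerivAt_right_eq_neg_left_of_integrable
    (μ := (volume : Measure 𝔼)) (f := polyFun P) (g := fun x : 𝔼 => Real.exp (-‖x‖ ^ 2))
    (f' := fun x => ∑ j, polyFun (MvPolynomial.pderiv j P) x •
      (EuclideanSpace.proj j : 𝔼 →L[ℝ] ℝ))
    (g' := fun x => Real.exp (-‖x‖ ^ 2) • (-(2 • (innerSL ℝ x : 𝔼 →L[ℝ] ℝ)) : 𝔼 →L[ℝ] ℝ))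
    (v := EuclideanSpace.single i 1) (B := ContinuousLinearMap.mul ℝ ℝ)
    (by simpa only [e1, ContinuousLinearMap.mul_apply'] using
          integrable_polyFun_mul_gaussian (MvPolynomial.pderiv i P))
    (by
      simp only [e2, ContinuousLinearMap.mul_apply']
      refine ((integrable_polyFun_mul_gaussian (MvPolynomial.X i * P)).const_mul (-2)).congr
        (Filter.Eventually.of_forall fun x => ?_)
      simp only [polyFun_mul, polyFun_X]; ring)
    (by simpa only [ContinuousLinearMap.mul_apply'] using integrable_polyFun_mul_gaussian P)
    (fun x _ => hf x) (fun x _ => hg x)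
  simp only [e1, e2, ContinuousLinearMap.mul_apply'] at key
  have e3 : ∫ x : 𝔼, polyFun P x * (-2 * (x i * Real.exp (-‖x‖ ^ 2)))
      = -(2 * gaussInt (MvPolynomial.X i * P)) := by
    rw [gaussInt, ← neg_mul, ← integral_const_mul]
    exact integral_congr_ae (Filter.Eventually.of_forall fun x => by
      simp only [polyFun_mul, polyFun_X]; ring)
  rw [e3] at key
  exact neg_injective key

end Gaussian

section HarmonicMoments

open MvPolynomial

variable {d : ℕ}

/-- The polynomial `⟪e, x⟫`. -/
def linPoly (e : EuclideanSpace ℝ (Fin d)) : MvPolynomial (Fin d) ℝ := ∑ i, C (e i) * X i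

/-- The directional derivative of polynomials along `e`. -/
def dirDeriv (e : EuclideanSpace ℝ (Fin d)) :
    Derivation ℝ (MvPolynomial (Fin d) ℝ) (MvPolynomial (Fin d) ℝ) :=
  ∑ i, e i • pderiv i

lemma dirDeriv_apply (e : EuclideanSpace ℝ (Fin d)) (P : MvPolynomial (Fin d) ℝ) :
    dirDeriv e P = ∑ i, C (e i) * pderiv i P := by
  have : ∀ s : Finset (Fin d), (∑ i ∈ s, e i • pderiv (R := ℝ) i :
      Derivation ℝ (MvPolynomial (Fin d) ℝ) (MvPolynomial (Fin d) ℝ)) P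
      = ∑ i ∈ s, C (e i) * pderiv i P := by
    classical
    intro s
    induction s using Finset.induction_on with
    | empty => simp
    | insert a s ha ih =>
      rw [Finset.sum_insert ha, Finset.sum_insert ha, Derivation.add_apply, ih,
        Derivation.smul_apply, smul_eq_C_mul]
  exact this _

lemma polyFun_linPoly (e x : EuclideanSpace ℝ (Fin d)) :
    polyFun (linPoly e) x = inner ℝ e x := by
  simp [polyFun, linPoly, PiLp.inner_apply, mul_comm]

lemma dirDeriv_linPoly {e : EuclideanSpace ℝ (Fin d)} (he : ‖e‖ = 1) :
    dirDeriv e (linPoly e) = 1 := by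
  have h : ∑ i, e i * e i = 1 := by
    have := EuclideanSpace.real_norm_sq_eq e
    rw [he] at this
    simp only [← sq]; linarith
  rw [dirDeriv_apply, linPoly]
  have : ∀ i, pderiv i (∑ j, C (e j) * X j : MvPolynomial (Fin d) ℝ) = C (e i) := by
    intro i
    simp [map_sum, pderiv_X, Pi.single_apply, Derivation.leibniz]
  simp only [this, ← C_mul, ← map_sum, h, C_1]

lemma gaussInt_linPoly_mul (e : EuclideanSpace ℝ (Fin d)) (P : MvPolynomial (Fin d) ℝ) :
    2 * gaussInt (linPoly e * P) = gaussInt (dirDeriv e P) := by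
  rw [linPoly, dirDeriv_apply, Finset.sum_mul, gaussInt_sum, gaussInt_sum, Finset.mul_sum]
  refine Finset.sum_congr rfl fun i _ => ?_
  rw [mul_assoc, gaussInt_C_mul, gaussInt_C_mul, ← gaussInt_X_mul]; ring

lemma gaussInt_linPoly_pow_succ_mul {e : EuclideanSpace ℝ (Fin d)} (he : ‖e‖ = 1) (k : ℕ)
    (P : MvPolynomial (Fin d) ℝ) :
    2 * gaussInt (linPoly e ^ (k + 1) * P) =
      k * gaussInt (linPoly e ^ (k - 1) * P) + gaussInt (linPoly e ^ k * dirDeriv e P) := by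
  rw [pow_succ', mul_assoc, gaussInt_linPoly_mul, Derivation.leibniz, Derivation.leibniz_pow,
    dirDeriv_linPoly he, gaussInt_add, smul_eq_mul, smul_eq_mul, add_comm, ← gaussInt_C_mul]
  congr 2
  simp only [smul_eq_mul, mul_one, nsmul_eq_mul, map_natCast]; ring

/-- Harmonicity of a polynomial. -/
def IsHarmonicPoly (P : MvPolynomial (Fin d) ℝ) : Prop := ∑ i, pderiv i (pderiv i P) = 0

lemma pderiv_comm_apply (i j : Fin d) (P : MvPolynomial (Fin d) ℝ) :
    pderiv i (pderiv j P) = pderiv j (pderiv i P) := by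
  have h : ⁅pderiv (R := ℝ) i, pderiv (R := ℝ) j⁆ = 0 := by
    refine MvPolynomial.derivation_ext fun k => ?_
    classical
    rw [Derivation.commutator_apply, pderiv_X, pderiv_X]
    simp [Pi.single_apply, apply_ite]
  have := congrArg (fun D => D P) h
  simp only [Derivation.commutator_apply, Derivation.zero_apply] at this
  exact sub_eq_zero.1 this

lemma IsHarmonicPoly.dirDeriv {P : MvPolynomial (Fin d) ℝ} (hP : IsHarmonicPoly P)
    (e : EuclideanSpace ℝ (Fin d)) : IsHarmonicPoly (dirDeriv e P) := by
  unfold IsHarmonicPoly at *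
  have h : ∀ i, pderiv i (pderiv i (_root_.dirDeriv e P))
      = _root_.dirDeriv e (pderiv i (pderiv i P)) := by
    intro i
    simp only [dirDeriv_apply, map_sum, Derivation.leibniz, pderiv_C, smul_eq_mul,
      mul_zero, add_zero]
    refine Finset.sum_congr rfl fun j _ => ?_
    rw [pderiv_comm_apply i j P, pderiv_comm_apply i j]
  simp only [h, ← map_sum, hP, map_zero]

lemma isHomogeneous_dirDeriv {P : MvPolynomial (Fin d) ℝ} {n : ℕ} (hP : P.IsHomogeneous n)
    (e : EuclideanSpace ℝ (Fin d)) : (dirDeriv e P).IsHomogeneous (n - 1) := by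
  rw [dirDeriv_apply]
  refine IsHomogeneous.sum _ _ _ fun i _ => ?_
  simpa using (isHomogeneous_C (Fin d) (e i)).mul (hP.pderiv (i := i))

lemma polyFun_dirDeriv_self {P : MvPolynomial (Fin d) ℝ} {n : ℕ} (hP : P.IsHomogeneous n)
    (e : EuclideanSpace ℝ (Fin d)) : polyFun (dirDeriv e P) e = n * polyFun P e := by
  have h := congrArg (fun Q => polyFun Q e) hP.sum_X_mul_pderiv
  simp only [polyFun, map_sum, map_mul, eval_X, nsmul_eq_mul, map_natCast] at h
  rw [dirDeriv_apply]
  simp only [polyFun, map_sum, map_mul, eval_C, h]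

lemma gaussInt_eq_zero_of_harmonic {P : MvPolynomial (Fin d) ℝ} {n : ℕ} (hP : P.IsHomogeneous n)
    (hn : n ≠ 0) (hh : IsHarmonicPoly P) : gaussInt P = 0 := by
  have h : gaussInt (∑ i, X i * pderiv i P) = n * gaussInt P := by
    rw [hP.sum_X_mul_pderiv, nsmul_eq_mul, ← map_natCast (C : ℝ →+* MvPolynomial (Fin d) ℝ),
      gaussInt_C_mul]
  have h2 : 2 * gaussInt (∑ i, X i * pderiv i P) = 0 := by
    rw [gaussInt_sum, Finset.mul_sum]
    simp only [gaussInt_X_mul]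
    rw [← gaussInt_sum, show ∑ i, pderiv i (pderiv i P) = 0 from hh, gaussInt_zero]
  have hn' : (n : ℝ) ≠ 0 := by exact_mod_cast hn
  rw [h] at h2
  simpa [hn'] using h2

/-- The coefficients of the Gaussian moments of harmonic polynomials. -/
def harmMoment (n k : ℕ) : ℝ :=
  if n ≤ k ∧ Even (k - n) then (k.factorial : ℝ) / (2 ^ k * ((k - n) / 2).factorial) else 0

lemma harmMoment_add (n j : ℕ) :
    harmMoment n (n + 2 * j) = ((n + 2 * j).factorial : ℝ) / (2 ^ (n + 2 * j) * j.factorial) := by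
  have h1 : n + 2 * j - n = 2 * j := by omega
  simp [harmMoment, h1]

lemma harmMoment_of_not {n k : ℕ} (h : ¬ ∃ j, k = n + 2 * j) : harmMoment n k = 0 := by
  refine if_neg fun ⟨h1, h2⟩ => h ?_
  obtain ⟨j, hj⟩ := h2
  exact ⟨j, by omega⟩

lemma harmMoment_succ (n k : ℕ) :
    2 * harmMoment n (k + 1) = k * harmMoment n (k - 1) + n * harmMoment (n - 1) k := by
  by_cases h : ∃ j, k + 1 = n + 2 * j
  · obtain ⟨j, hj⟩ := h
    rw [hj, harmMoment_add]
    rcases n with _ | n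
    · obtain ⟨i, rfl⟩ : ∃ i, j = i + 1 := ⟨j - 1, by omega⟩
      obtain rfl : k = 2 * i + 1 := by omega
      have e : 2 * i + 1 - 1 = 0 + 2 * i := by omega
      rw [e, harmMoment_add]
      simp only [zero_add, mul_add, mul_one, Nat.factorial_succ, pow_succ]
      push_cast
      have := Nat.factorial_ne_zero i
      field_simp
      simp
      ring
    · obtain rfl : k = n + 2 * j := by omega
      rw [show n + 1 - 1 = n from rfl, harmMoment_add]
      rcases j with _ | j
      · have : (((n + 2 * 0 : ℕ) : ℝ)) * harmMoment (n + 1) (n + 2 * 0 - 1) = 0 := by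
          rw [harmMoment_of_not (by rintro ⟨j, hj⟩; omega), mul_zero]
        rw [this]
        simp only [mul_zero, add_zero, Nat.factorial_succ, pow_succ]
        push_cast
        field_simp
        simp
      · have e : n + 2 * (j + 1) - 1 = (n + 1) + 2 * j := by omega
        rw [e, harmMoment_add]
        have e1 : n + 1 + 2 * (j + 1) = (n + 2 * j) + 1 + 1 + 1 := by ring
        have e2 : n + 2 * (j + 1) = (n + 2 * j) + 1 + 1 := by ring
        have e3 : n + 1 + 2 * j = (n + 2 * j) + 1 := by ring
        rw [e1, e2, e3]
        simp only [Nat.factorial_succ, pow_succ]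
        push_cast
        have := Nat.factorial_ne_zero j
        field_simp
        ring
  · rw [harmMoment_of_not h]
    have h1 : (k : ℝ) * harmMoment n (k - 1) = 0 := by
      rcases k with _ | k
      · simp
      · rw [harmMoment_of_not, mul_zero]
        rintro ⟨j, hj⟩
        exact h ⟨j + 1, by omega⟩
    have h2 : (n : ℝ) * harmMoment (n - 1) k = 0 := by
      rcases n with _ | n
      · simp
      · rw [harmMoment_of_not, mul_zero]
        rintro ⟨j, hj⟩
        exact h ⟨j, by omega⟩
    rw [h1, h2]; simp

/-- Gaussian moments of a homogeneous harmonic polynomial against powers of a linear form. -/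
lemma gaussInt_linPoly_pow_mul {e : EuclideanSpace ℝ (Fin d)} (he : ‖e‖ = 1) (k : ℕ) :
    ∀ {n : ℕ} {P : MvPolynomial (Fin d) ℝ}, P.IsHomogeneous n → IsHarmonicPoly P →
      gaussInt (linPoly e ^ k * P) =
        gaussInt (1 : MvPolynomial (Fin d) ℝ) * harmMoment n k * polyFun P e := by
  induction k using Nat.strong_induction_on with
  | _ k ih =>
    intro n P hP hh
    rcases k with _ | k
    · rw [pow_zero, one_mul]
      rcases n with _ | n
      · have hC : P = C (polyFun P e) := by
          obtain ⟨a, ha⟩ : ∃ a, P = C a :=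
            ⟨_, totalDegree_eq_zero_iff_eq_C.1 (Nat.le_zero.1 hP.totalDegree_le)⟩
          rw [ha, polyFun_C]
        have h0 : harmMoment 0 0 = 1 := by simp [harmMoment]
        rw [h0, mul_one]
        conv_lhs => rw [hC, ← mul_one (C _), gaussInt_C_mul]
        ring
      · rw [gaussInt_eq_zero_of_harmonic hP (by omega) hh,
          harmMoment_of_not (by rintro ⟨j, hj⟩; omega)]
        ring
    · have h2 : 2 * gaussInt (linPoly e ^ (k + 1) * P) =
          2 * (gaussInt (1 : MvPolynomial (Fin d) ℝ) * harmMoment n (k + 1) * polyFun P e) := by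
        rw [gaussInt_linPoly_pow_succ_mul he, ih (k - 1) (by omega) hP hh,
          ih k (by omega) (isHomogeneous_dirDeriv hP e) (hh.dirDeriv e), polyFun_dirDeriv_self hP]
        linear_combination
          (-gaussInt (1 : MvPolynomial (Fin d) ℝ) * polyFun P e) * harmMoment_succ n k
      linarith

end HarmonicMoments

section PolarCoordinates

variable {d : ℕ}

instance isFiniteMeasure_sphMeasure : IsFiniteMeasure (sphMeasure d) := by
  unfold sphMeasure; infer_instance

/-- Gaussian integrals of homogeneous polynomials in terms of integrals over the sphere. -/
lemma gaussInt_eq_sphere (hd : 0 < d) {P : MvPolynomial (Fin d) ℝ} {N : ℕ}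
    (hP : P.IsHomogeneous N) :
    gaussInt P = Real.Gamma ((N + d) / 2) / 2 * ∫ x : Sph d, polyFun P x ∂(sphMeasure d) := by
  have : Nonempty (Fin d) := ⟨⟨0, hd⟩⟩
  have hdim : Module.finrank ℝ (EuclideanSpace ℝ (Fin d)) = d := by simp
  have radial : ∫ r : Set.Ioi (0 : ℝ), (r : ℝ) ^ N * Real.exp (-(r : ℝ) ^ 2)
      ∂(Measure.volumeIoiPow (d - 1)) = Real.Gamma ((N + d) / 2) / 2 := by
    simp only [Measure.volumeIoiPow, ENNReal.ofReal]
    rw [integral_withDensity_eq_integral_smul,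
      integral_subtype_comap measurableSet_Ioi
        fun a : ℝ => Real.toNNReal (a ^ (d - 1)) • (a ^ N * Real.exp (-a ^ 2)),
      setIntegral_congr_fun (g := fun x : ℝ => x ^ ((N + d - 1 : ℕ) : ℝ) * Real.exp (-x ^ (2 : ℝ)))
        measurableSet_Ioi fun x hx => ?_]
    · rw [integral_rpow_mul_exp_neg_rpow (by norm_num)
        (by have : (0 : ℝ) ≤ ((N + d - 1 : ℕ) : ℝ) := Nat.cast_nonneg _
            linarith)]
      have : ((N + d - 1 : ℕ) : ℝ) + 1 = N + d := by
        rw [← Nat.cast_succ, ← Nat.cast_add]; congr 1; omega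
      rw [this]; ring
    · have hx' : (0 : ℝ) < x := hx
      simp only [NNReal.smul_def, Real.coe_toNNReal _ (pow_nonneg hx'.le _), smul_eq_mul]
      rw [Real.rpow_natCast, show N + d - 1 = (d - 1) + N by omega, pow_add, mul_assoc]
      norm_cast
    · exact (measurable_subtype_coe.pow_const _).real_toNNReal
  calc gaussInt P
      = ∫ x : ({(0)}ᶜ : Set (EuclideanSpace ℝ (Fin d))),
          polyFun P (x : EuclideanSpace ℝ (Fin d)) * Real.exp (-‖(x : EuclideanSpace ℝ (Fin d))‖ ^ 2)
            ∂(Measure.comap Subtype.val volume) := by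
        rw [integral_subtype_comap (measurableSet_singleton _).compl
          fun x : EuclideanSpace ℝ (Fin d) => polyFun P x * Real.exp (-‖x‖ ^ 2),
          restrict_compl_singleton]
        rfl
    _ = ∫ x : Sph d × Set.Ioi (0 : ℝ), polyFun P x.1 * ((x.2 : ℝ) ^ N * Real.exp (-(x.2 : ℝ) ^ 2))
          ∂((sphMeasure d).prod (Measure.volumeIoiPow (d - 1))) := by
        have hmp := (volume : Measure (EuclideanSpace ℝ (Fin d))
          ).measurePreserving_homeomorphUnitSphereProd
        rw [hdim] at hmp
        have := hmp.integral_comp (Homeomorph.measurableEmbedding _)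
          (fun x : Sph d × Set.Ioi (0 : ℝ) =>
            polyFun P x.1 * ((x.2 : ℝ) ^ N * Real.exp (-(x.2 : ℝ) ^ 2)))
        rw [sphMeasure, ← this]
        refine integral_congr_ae (Filter.Eventually.of_forall fun x => ?_)
        have hx : (x.1 : EuclideanSpace ℝ (Fin d)) ≠ 0 := x.2
        have hx' : ‖(x.1 : EuclideanSpace ℝ (Fin d))‖ ≠ 0 := norm_ne_zero_iff.2 hx
        simp only [homeomorphUnitSphereProd_apply_fst_coe,
          homeomorphUnitSphereProd_apply_snd_coe, polyFun_smul hP, inv_pow]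
        field_simp
    _ = _ := by
        rw [integral_prod_mul (fun x : Sph d => polyFun P x)
          (fun r : Set.Ioi (0 : ℝ) => (r : ℝ) ^ N * Real.exp (-(r : ℝ) ^ 2)), radial, mul_comm]

end PolarCoordinates

section SphereMoments

variable {d : ℕ}

lemma continuous_polyFun_sphere (P : MvPolynomial (Fin d) ℝ) :
    Continuous fun x : Sph d => polyFun P x :=
  (continuous_polyFun P).comp continuous_subtype_val

/-- Integrals over the sphere of spherical harmonics against powers of a linear form. -/
lemma sphere_integral_inner_pow (hd : 0 < d) {P : MvPolynomial (Fin d) ℝ} {n : ℕ}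
    (hP : P.IsHomogeneous n) (hh : IsHarmonicPoly P) (e : Sph d) (k : ℕ) :
    Real.Gamma ((n + k + d) / 2) *
        ∫ x : Sph d, polyFun P x * (inner ℝ (e : EuclideanSpace ℝ (Fin d)) x) ^ k ∂(sphMeasure d) =
      2 * gaussInt (1 : MvPolynomial (Fin d) ℝ) * harmMoment n k * polyFun P e := by
  have he : ‖(e : EuclideanSpace ℝ (Fin d))‖ = 1 := by simp
  have hlin : (linPoly (e : EuclideanSpace ℝ (Fin d))).IsHomogeneous 1 := by
    refine MvPolynomial.IsHomogeneous.sum _ _ _ fun i _ => ?_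
    simpa using (MvPolynomial.isHomogeneous_C (Fin d) _).mul (MvPolynomial.isHomogeneous_X ℝ i)
  have hhom : (linPoly (e : EuclideanSpace ℝ (Fin d)) ^ k * P).IsHomogeneous (k + n) := by
    simpa using (hlin.pow k).mul hP
  have h1 := gaussInt_eq_sphere hd hhom
  rw [gaussInt_linPoly_pow_mul he k hP hh] at h1
  simp only [polyFun_mul, polyFun_pow, polyFun_linPoly] at h1
  simp only [mul_comm (polyFun P _) (_ ^ k)]
  rw [show ((n : ℝ) + k + d) / 2 = ((k + n : ℕ) + d) / 2 by push_cast; ring]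
  linear_combination (-2) * h1

end SphereMoments

section BinomialSeries

/-- Coefficients of the binomial series of `(1 - x) ^ (-a)`. -/
def negBinom (a : ℝ) (j : ℕ) : ℝ := Real.Gamma (a + j) / (Real.Gamma a * j.factorial)

lemma negBinom_nonneg {a : ℝ} (ha : 0 < a) (j : ℕ) : 0 ≤ negBinom a j :=
  div_nonneg (Real.Gamma_pos_of_pos (by positivity)).le
    (mul_nonneg (Real.Gamma_pos_of_pos ha).le (by positivity))

lemma gamma_add_natCast {a : ℝ} (ha : 0 < a) (m : ℕ) :
    Real.Gamma (a + m) = (ascPochhammer ℝ m).eval a * Real.Gamma a := by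
  induction m with
  | zero => simp
  | succ m ih =>
    rw [ascPochhammer_succ_eval, Nat.cast_succ, ← add_assoc,
      Real.Gamma_add_one (by positivity), ih]
    ring

lemma negBinom_eq_choose {a : ℝ} (ha : 0 < a) (j : ℕ) :
    negBinom a j = Ring.choose (a + j - 1) j := by
  have h := Ring.factorial_nsmul_multichoose_eq_ascPochhammer a j
  have h2 : Ring.choose (a + j - 1) j = Ring.multichoose a j := by
    rw [Ring.choose]; congr 1; ring
  have h3 : (Polynomial.smeval (ascPochhammer ℕ j) a : ℝ) = (ascPochhammer ℝ j).eval a := by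
    rw [Polynomial.ascPochhammer_smeval_eq_eval]
  rw [h2, negBinom, gamma_add_natCast ha, ← h3, ← h, nsmul_eq_mul]
  have := (Real.Gamma_pos_of_pos ha).ne'
  field_simp

lemma hasSum_negBinom {a x : ℝ} (ha : 0 < a) (hx : |x| < 1) :
    HasSum (fun j => negBinom a j * x ^ j) (1 / (1 - x) ^ a) := by
  have h := (Real.one_div_one_sub_rpow_hasFPowerSeriesOnBall_zero a).hasSum (y := x)
    (by simpa [← ofReal_norm] using hx)
  simpa [FormalMultilinearSeries.ofScalars_apply_eq, negBinom_eq_choose ha, mul_comm] using h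

lemma sigma_antidiagonal_hasSum {f : ℕ × ℕ → ℝ} {g : ℕ → ℝ} {s : ℝ}
    (hf : Summable f) (hg : HasSum g s)
    (hfg : ∀ m, ∑ ki ∈ Finset.HasAntidiagonal.antidiagonal m, f ki = g m) : HasSum f s := by
  have h1 := (Finset.HasAntidiagonal.sigmaAntidiagonalEquivProd (A := ℕ)).hasSum_iff.2 hf.hasSum
  have h2 := h1.sigma (fun m => hasSum_fintype _)
  have h3 : HasSum g (∑' b, f b) := by
    convert h2 using 2 with m
    rw [← hfg m, ← Finset.sum_coe_sort]
    rfl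
  rw [hg.unique h3]
  exact hf.hasSum

lemma summable_of_antidiagonal {f : ℕ × ℕ → ℝ} (hf : ∀ x, 0 ≤ f x)
    (h : Summable fun m => ∑ ki ∈ Finset.HasAntidiagonal.antidiagonal m, f ki) : Summable f := by
  rw [← (Finset.HasAntidiagonal.sigmaAntidiagonalEquivProd (A := ℕ)).summable_iff]
  refine (summable_sigma_of_nonneg fun _ => hf _).2 ⟨fun m => (hasSum_fintype _).summable, ?_⟩
  convert h with m
  rw [tsum_fintype, ← Finset.sum_coe_sort (Finset.HasAntidiagonal.antidiagonal m) f]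
  rfl

lemma sum_antidiagonal_binomial (B : ℕ → ℝ) (u v : ℝ) (m : ℕ) :
    ∑ ki ∈ Finset.HasAntidiagonal.antidiagonal m,
      B (ki.1 + ki.2) * ((ki.1 + ki.2).choose ki.1 * u ^ ki.1 * v ^ ki.2) = B m * (u + v) ^ m := by
  rw [add_pow, Finset.Nat.sum_antidiagonal_eq_sum_range_succ_mk, Finset.mul_sum]
  refine Finset.sum_congr rfl fun k hk => ?_
  have : k + (m - k) = m := by have := Finset.mem_range.1 hk; omega
  simp only [this]
  ring

lemma summable_binomial_abs {a u v : ℝ} (ha : 0 < a) (h : |u| + |v| < 1) :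
    Summable fun ki : ℕ × ℕ => negBinom a (ki.1 + ki.2) *
      ((ki.1 + ki.2).choose ki.1 * |u| ^ ki.1 * |v| ^ ki.2) := by
  refine summable_of_antidiagonal
    (fun x => mul_nonneg (negBinom_nonneg ha _) (by positivity)) ?_
  simp only [sum_antidiagonal_binomial]
  exact (hasSum_negBinom ha (by rwa [abs_of_nonneg (by positivity)])).summable

lemma hasSum_binomial {a u v : ℝ} (ha : 0 < a) (h : |u| + |v| < 1) :
    HasSum (fun ki : ℕ × ℕ => negBinom a (ki.1 + ki.2) *
      ((ki.1 + ki.2).choose ki.1 * u ^ ki.1 * v ^ ki.2)) (1 / (1 - (u + v)) ^ a) := by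
  refine sigma_antidiagonal_hasSum ?_
    (hasSum_negBinom ha ((abs_add_le u v).trans_lt h)) (sum_antidiagonal_binomial _ u v)
  refine Summable.of_norm ((summable_binomial_abs ha h).congr fun ki => ?_)
  simp [abs_of_nonneg (negBinom_nonneg ha _)]

/-- A form of the statement that the `m`-th difference of a monic polynomial of degree `m`
is `m!`. -/
lemma sum_antidiagonal_gamma {x : ℝ} (hx : 0 < x) (m : ℕ) :
    ∑ li ∈ Finset.HasAntidiagonal.antidiagonal m, (-1 : ℝ) ^ li.2 * Real.Gamma (x + (li.1 + m : ℕ)) /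
      (li.1.factorial * li.2.factorial * Real.Gamma (x + li.1)) = 1 := by
  have h := congrFun (Polynomial.fwdDiff_iter_degree_eq_factorial (ascPochhammer ℝ m)) x
  rw [ascPochhammer_natDegree, fwdDiff_iter_eq_sum_shift, (monic_ascPochhammer ℝ m)] at h
  simp only [nsmul_eq_mul, mul_one, zsmul_eq_mul, one_smul] at h
  have hm : ((m.factorial : ℝ)) ≠ 0 := by positivity
  rw [Finset.Nat.sum_antidiagonal_eq_sum_range_succ_mk]
  have h' : ∑ k ∈ Finset.range (m + 1), (-1 : ℝ) ^ (m - k) * Real.Gamma (x + (k + m : ℕ)) /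
      (k.factorial * (m - k).factorial * Real.Gamma (x + k)) =
      (∑ k ∈ Finset.range (m + 1), (((-1) ^ (m - k) * (m.choose k : ℤ) : ℤ) : ℝ) *
        Polynomial.eval (x + k) (ascPochhammer ℝ m)) / m.factorial := by
    rw [Finset.sum_div]
    refine Finset.sum_congr rfl fun k hk => ?_
    have hk' : k ≤ m := by have := Finset.mem_range.1 hk; omega
    have hG : Real.Gamma (x + k) ≠ 0 := (Real.Gamma_pos_of_pos (by positivity)).ne'
    rw [Nat.cast_add, ← add_assoc, gamma_add_natCast (by positivity)]
    push_cast
    rw [Nat.cast_choose ℝ hk']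
    field_simp
  rw [h']
  simp only [Pi.natCast_apply] at h
  rw [h, div_self hm]

end BinomialSeries

section GeneratingFunction

variable {d : ℕ}

/-- The normalisation constant of the Poisson type formula for spherical harmonics. -/
def poissonConst (d : ℕ) : ℝ :=
  2 * gaussInt (1 : MvPolynomial (Fin d) ℝ) / Real.Gamma ((d : ℝ) / 2)

lemma poissonConst_pos (hd : 0 < d) : 0 < poissonConst d :=
  div_pos (mul_pos two_pos gaussInt_one_pos) (Real.Gamma_pos_of_pos (by positivity))

lemma abs_inner_sphere_le (e x : Sph d) :
    |inner ℝ (e : EuclideanSpace ℝ (Fin d)) x| ≤ 1 := by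
  simpa using abs_real_inner_le_norm (e : EuclideanSpace ℝ (Fin d)) x

lemma integrable_sphere {f : Sph d → ℝ} (hf : Continuous f) : Integrable f (sphMeasure d) :=
  hf.integrable_of_hasCompactSupport (HasCompactSupport.of_compactSpace f)

lemma antidiagonal_term {P : MvPolynomial (Fin d) ℝ} {n : ℕ} (hd : 0 < d)
    (hP : P.IsHomogeneous n) (hh : IsHarmonicPoly P) (e : Sph d) (r : ℝ) (l i : ℕ) :
    negBinom ((d : ℝ) / 2) (n + 2 * l + i) *
        ((n + 2 * l + i).choose (n + 2 * l) * (2 * r) ^ (n + 2 * l) * (-r ^ 2) ^ i) *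
        ∫ x : Sph d, polyFun P x * inner ℝ (e : EuclideanSpace ℝ (Fin d)) x ^ (n + 2 * l)
          ∂(sphMeasure d) =
      poissonConst d * polyFun P e * r ^ n * (r ^ 2) ^ (l + i) *
        ((-1) ^ i * Real.Gamma ((d : ℝ) / 2 + n + (l + (l + i) : ℕ)) /
          (l.factorial * i.factorial * Real.Gamma ((d : ℝ) / 2 + n + l))) := by
  have h := sphere_integral_inner_pow hd hP hh e (n + 2 * l)
  have hG1 : Real.Gamma ((d : ℝ) / 2 + n + l) ≠ 0 := (Real.Gamma_pos_of_pos (by positivity)).ne'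
  have hG2 : Real.Gamma ((d : ℝ) / 2) ≠ 0 := (Real.Gamma_pos_of_pos (by positivity)).ne'
  rw [show ((n : ℝ) + (n + 2 * l : ℕ) + d) / 2 = d / 2 + n + l by push_cast; ring,
    harmMoment_add] at h
  rw [negBinom, poissonConst, Nat.cast_choose ℝ (Nat.le_add_right _ _), Nat.add_sub_cancel_left,
    show (d : ℝ) / 2 + (n + 2 * l + i : ℕ) = d / 2 + n + (l + (l + i) : ℕ) by push_cast; ring]
  set I := ∫ x : Sph d, polyFun P x * inner ℝ (e : EuclideanSpace ℝ (Fin d)) x ^ (n + 2 * l)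
          ∂(sphMeasure d)
  have hI : I = 2 * gaussInt (1 : MvPolynomial (Fin d) ℝ) *
      ((n + 2 * l).factorial / (2 ^ (n + 2 * l) * l.factorial)) * polyFun P e /
        Real.Gamma ((d : ℝ) / 2 + n + l) := by
    rw [eq_div_iff hG1, ← h]; ring
  rw [hI, neg_pow]
  field_simp
  ring

/-- The generating function identity for spherical harmonics, for small radii. -/
lemma integral_generating_function {P : MvPolynomial (Fin d) ℝ} {n : ℕ} (hd : 0 < d)
    (hP : P.IsHomogeneous n) (hh : IsHarmonicPoly P) (e : Sph d) {r : ℝ} (hr : |r| ≤ 1 / 4) :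
    ∫ x : Sph d, polyFun P x *
        (1 / (1 - 2 * r * inner ℝ (e : EuclideanSpace ℝ (Fin d)) x + r ^ 2) ^ ((d : ℝ) / 2))
        ∂(sphMeasure d) = poissonConst d * polyFun P e * r ^ n * (1 - r ^ 2)⁻¹ := by
  have hν : (0 : ℝ) < (d : ℝ) / 2 := by positivity
  have hr2 : r ^ 2 ≤ 1 / 16 := by
    rw [← sq_abs]; nlinarith [abs_nonneg r]
  let t : Sph d → ℝ := fun x => inner ℝ (e : EuclideanSpace ℝ (Fin d)) x
  have ht : Continuous t := by unfold t; fun_prop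
  have hY := continuous_polyFun_sphere P
  let F : ℕ × ℕ → Sph d → ℝ := fun ki x => negBinom ((d : ℝ) / 2) (ki.1 + ki.2) *
    ((ki.1 + ki.2).choose ki.1 * (2 * r) ^ ki.1 * (-r ^ 2) ^ ki.2) * (polyFun P x * t x ^ ki.1)
  have hF (x : Sph d) : HasSum (fun ki => F ki x)
      (polyFun P x * (1 / (1 - 2 * r * t x + r ^ 2) ^ ((d : ℝ) / 2))) := by
    have hx : |2 * r * t x| + |-r ^ 2| < 1 := by
      rw [abs_mul, abs_mul, abs_neg, abs_pow, sq_abs, abs_two]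
      have := abs_inner_sphere_le e x
      nlinarith [abs_nonneg r, abs_nonneg (t x)]
    have := (hasSum_binomial hν hx).mul_left (polyFun P x)
    rw [show 1 - 2 * r * t x + r ^ 2 = 1 - (2 * r * t x + -r ^ 2) by ring]
    have hfun : (fun ki => F ki x) = fun ki : ℕ × ℕ => polyFun P x *
        (negBinom ((d : ℝ) / 2) (ki.1 + ki.2) *
          ((ki.1 + ki.2).choose ki.1 * (2 * r * t x) ^ ki.1 * (-r ^ 2) ^ ki.2)) :=
      funext fun ki => by simp only [F, mul_pow]; ring
    rwa [hfun]
  have hint (ki : ℕ × ℕ) : Integrable (F ki) (sphMeasure d) :=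
    integrable_sphere (continuous_const.mul (hY.mul (ht.pow _)))
  have hsum : Summable fun ki => ∫ x, ‖F ki x‖ ∂(sphMeasure d) := by
    have hr3 : |2 * r| + |-r ^ 2| < 1 := by
      rw [abs_mul, abs_neg, abs_pow, sq_abs, abs_two]; linarith
    refine Summable.of_nonneg_of_le (fun _ => integral_nonneg fun _ => norm_nonneg _)
      (fun ki => ?_) ((summable_binomial_abs hν hr3).mul_right
        (∫ x, ‖polyFun P (x : Sph d)‖ ∂(sphMeasure d)))
    rw [← integral_const_mul]
    refine integral_mono (hint ki).norm ((integrable_sphere hY).norm.const_mul _) fun x => ?_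
    simp only [F, norm_mul, norm_pow, Real.norm_eq_abs, abs_of_nonneg (negBinom_nonneg hν _),
      Nat.abs_cast, abs_mul]
    refine mul_le_mul_of_nonneg_left ?_ (mul_nonneg (negBinom_nonneg hν _) (by positivity))
    exact mul_le_of_le_one_right (abs_nonneg _)
      (pow_le_one₀ (abs_nonneg _) (abs_inner_sphere_le e x))
  have h1 := hasSum_integral_of_summable_integral_norm hint hsum
  simp only [(hF _).tsum_eq] at h1
  let g : ℕ × ℕ → ℕ × ℕ := fun li => (n + 2 * li.1, li.2)
  have hg : Function.Injective g := by
    rintro ⟨a, b⟩ ⟨a', b'⟩ hab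
    simp only [g, Prod.mk.injEq] at hab ⊢
    omega
  have hoff : ∀ ki ∉ Set.range g, ∫ x, F ki x ∂(sphMeasure d) = 0 := by
    rintro ⟨k, i⟩ hki
    have hk : ¬ ∃ j, k = n + 2 * j := fun ⟨j, hj⟩ => hki ⟨(j, i), by simp [g, hj]⟩
    have := sphere_integral_inner_pow hd hP hh e k
    rw [harmMoment_of_not hk, mul_zero, zero_mul, mul_eq_zero] at this
    rw [integral_const_mul, this.resolve_left (Real.Gamma_pos_of_pos (by positivity)).ne', mul_zero]
  rw [← hg.hasSum_iff hoff] at h1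
  have hgeo : HasSum (fun m : ℕ => poissonConst d * polyFun P e * r ^ n * (r ^ 2) ^ m)
      (poissonConst d * polyFun P e * r ^ n * (1 - r ^ 2)⁻¹) :=
    (hasSum_geometric_of_lt_one (sq_nonneg r) (by linarith)).mul_left _
  refine h1.unique (sigma_antidiagonal_hasSum h1.summable hgeo fun m => ?_)
  rw [← mul_one (_ * (r ^ 2) ^ m),
    ← sum_antidiagonal_gamma (show (0 : ℝ) < (d : ℝ) / 2 + n by positivity) m, Finset.mul_sum]
  refine Finset.sum_congr rfl fun li hli => ?_
  obtain ⟨l, i⟩ := li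
  obtain rfl : l + i = m := by simpa using hli
  simp only [Function.comp, g, F, t]
  rw [integral_const_mul]
  exact antidiagonal_term hd hP hh e r l i

end GeneratingFunction

section Continuation

open Filter Topology

/-- A parametric integral over a compact space depending holomorphically on the parameter. -/
lemma hasDerivAt_integral_of_continuousOn {X : Type*} [TopologicalSpace X] [CompactSpace X]
    [MeasurableSpace X] [OpensMeasurableSpace X] {μ : Measure X} [IsFiniteMeasure μ]
    {f f' : ℂ → X → ℂ} {U : Set ℂ} (hU : IsOpen U)
    (hf : ContinuousOn (fun p : ℂ × X => f p.1 p.2) (U ×ˢ Set.univ))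
    (hf' : ContinuousOn (fun p : ℂ × X => f' p.1 p.2) (U ×ˢ Set.univ))
    (hd : ∀ z ∈ U, ∀ x, HasDerivAt (fun z => f z x) (f' z x) z) {z₀ : ℂ} (hz₀ : z₀ ∈ U) :
    HasDerivAt (fun z => ∫ x, f z x ∂μ) (∫ x, f' z₀ x ∂μ) z₀ := by
  have hsec {h : ℂ → X → ℂ} (hh : ContinuousOn (fun p : ℂ × X => h p.1 p.2) (U ×ˢ Set.univ)) {z : ℂ}
      (hz : z ∈ U) : Continuous (h z) :=
    hh.comp_continuous (f := fun x => (z, x)) (by fun_prop) fun x => ⟨hz, Set.mem_univ _⟩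
  have hint {h : X → ℂ} (hh : Continuous h) : Integrable h μ :=
    hh.integrable_of_hasCompactSupport (HasCompactSupport.of_compactSpace h)
  obtain ⟨ε, hε, hball⟩ := Metric.isOpen_iff.1 hU z₀ hz₀
  have hsub : Metric.closedBall z₀ (ε / 2) ⊆ U :=
    (Metric.closedBall_subset_ball (by linarith)).trans hball
  obtain ⟨C, hC⟩ := ((isCompact_closedBall z₀ (ε / 2)).prod
    (isCompact_univ (X := X))).exists_bound_of_continuousOn
      (hf'.mono (Set.prod_mono hsub subset_rfl))
  refine (hasDerivAt_integral_of_dominated_loc_of_deriv_le (bound := fun _ => C)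
    (Metric.closedBall_mem_nhds z₀ (half_pos hε)) ?_ (hint (hsec hf hz₀))
    (hint (hsec hf' hz₀)).aestronglyMeasurable ?_ (integrable_const C) ?_).2
  · filter_upwards [hU.mem_nhds hz₀] with z hz
    exact (hint (hsec hf hz)).aestronglyMeasurable
  · exact Eventually.of_forall fun x z hz => hC (z, x) ⟨hz, Set.mem_univ _⟩
  · exact Eventually.of_forall fun x z hz => hd z (hsub hz) x

/-- The kernel `(1 - z w) ^ (-a) * (1 - z * conj w) ^ (-a)`. -/
def sphereKernel (a : ℝ) (z w : ℂ) : ℂ :=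
  (1 - z * w) ^ ((-a : ℝ) : ℂ) * (1 - z * (starRingEnd ℂ) w) ^ ((-a : ℝ) : ℂ)

lemma one_sub_mul_mem_slitPlane {z w : ℂ} (hz : ‖z‖ < 1) (hw : ‖w‖ = 1) :
    1 - z * w ∈ Complex.slitPlane := by
  refine Or.inl ?_
  have := (Complex.re_le_norm (z * w))
  rw [norm_mul, hw, mul_one] at this
  simp only [Complex.sub_re, Complex.one_re]
  linarith

lemma norm_sphereKernel (a : ℝ) (z w : ℂ) :
    ‖sphereKernel a z w‖ = ‖1 - z * w‖ ^ (-a) * ‖1 - z * (starRingEnd ℂ) w‖ ^ (-a) := by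
  rw [sphereKernel, norm_mul, Complex.norm_cpow_real, Complex.norm_cpow_real]

lemma sphereKernel_ofReal (a : ℝ) {r : ℝ} (hr : |r| < 1) {w : ℂ} (hw : ‖w‖ = 1) :
    sphereKernel a r w = ((1 / (1 - 2 * r * w.re + r ^ 2) ^ a : ℝ) : ℂ) := by
  have hmem := one_sub_mul_mem_slitPlane (z := (r : ℂ)) (by simpa using hr) hw
  have hconj : 1 - (r : ℂ) * (starRingEnd ℂ) w = (starRingEnd ℂ) (1 - r * w) := by simp
  have hsq : ‖1 - r * w‖ ^ 2 = 1 - 2 * r * w.re + r ^ 2 := by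
    have h1 : w.re ^ 2 + w.im ^ 2 = 1 := by
      have := Complex.sq_norm w
      rw [hw, Complex.normSq_apply] at this
      linarith
    rw [Complex.sq_norm, Complex.normSq_apply]
    simp
    linear_combination r ^ 2 * h1
  rw [sphereKernel, hconj, Complex.conj_cpow _ _ (Complex.mem_slitPlane_iff_arg.1 hmem).1,
    Complex.conj_ofReal, Complex.mul_conj, Complex.normSq_eq_norm_sq, Complex.norm_cpow_real,
    ← hsq, ← Real.rpow_natCast, ← Real.rpow_natCast, ← Real.rpow_mul (norm_nonneg _),
    ← Real.rpow_mul (norm_nonneg _), one_div, ← Real.rpow_neg (norm_nonneg _)]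
  congr 2
  push_cast
  ring

lemma continuousOn_one_sub_cpow (s : ℂ) {X : Type*} [TopologicalSpace X] {w : X → ℂ}
    (hw : Continuous w) (hw1 : ∀ x, ‖w x‖ = 1) :
    ContinuousOn (fun p : ℂ × X => (1 - p.1 * w p.2) ^ s) (ball 0 1 ×ˢ Set.univ) := by
  refine ContinuousOn.cpow (by fun_prop) continuousOn_const fun p hp => ?_
  exact one_sub_mul_mem_slitPlane (by simpa using hp.1) (hw1 _)

lemma hasDerivAt_one_sub_cpow (s : ℂ) {z w : ℂ} (hz : ‖z‖ < 1) (hw : ‖w‖ = 1) :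
    HasDerivAt (fun z => (1 - z * w) ^ s) (s * (1 - z * w) ^ (s - 1) * (-w)) z := by
  have h1 : HasDerivAt (fun z : ℂ => 1 - z * w) (-w) z := by
    simpa using ((hasDerivAt_id z).mul_const w).const_sub 1
  exact h1.cpow_const (one_sub_mul_mem_slitPlane hz hw)

lemma differentiableOn_integral_sphereKernel {X : Type*} [TopologicalSpace X] [CompactSpace X]
    [MeasurableSpace X] [OpensMeasurableSpace X] {μ : Measure X} [IsFiniteMeasure μ] (a : ℝ)
    {g w : X → ℂ} (hg : Continuous g) (hw : Continuous w) (hw1 : ∀ x, ‖w x‖ = 1) :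
    DifferentiableOn ℂ (fun z => ∫ x, g x * sphereKernel a z (w x) ∂μ) (ball 0 1) := by
  unfold sphereKernel
  generalize ((-a : ℝ) : ℂ) = s
  have hcw : Continuous fun x => (starRingEnd ℂ) (w x) := Complex.continuous_conj.comp hw
  have hcw1 : ∀ x, ‖(starRingEnd ℂ) (w x)‖ = 1 := fun x => by rw [RCLike.norm_conj, hw1]
  have hg2 : ContinuousOn (fun p : ℂ × X => g p.2) (ball 0 1 ×ˢ Set.univ) := by fun_prop
  have hd (z : ℂ) (hz : z ∈ ball (0 : ℂ) 1) (x : X) :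
      HasDerivAt (fun z => g x * ((1 - z * w x) ^ s * (1 - z * (starRingEnd ℂ) (w x)) ^ s))
        (g x * ((s * (1 - z * w x) ^ (s - 1) * (-w x)) * (1 - z * (starRingEnd ℂ) (w x)) ^ s +
          (1 - z * w x) ^ s * (s * (1 - z * (starRingEnd ℂ) (w x)) ^ (s - 1) *
            (-(starRingEnd ℂ) (w x))))) z := by
    have hz' : ‖z‖ < 1 := by simpa using hz
    exact ((hasDerivAt_one_sub_cpow s hz' (hw1 x)).mul
      (hasDerivAt_one_sub_cpow s hz' (hcw1 x))).const_mul (g x)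
  have h1 := continuousOn_one_sub_cpow s hw hw1
  have h2 := continuousOn_one_sub_cpow s hcw hcw1
  have h3 := continuousOn_one_sub_cpow (s - 1) hw hw1
  have h4 := continuousOn_one_sub_cpow (s - 1) hcw hcw1
  have h5 : ContinuousOn (fun p : ℂ × X => -w p.2) (ball 0 1 ×ˢ Set.univ) := by fun_prop
  have h6 : ContinuousOn (fun p : ℂ × X => -(starRingEnd ℂ) (w p.2)) (ball 0 1 ×ˢ Set.univ) :=
    (hcw.comp continuous_snd).neg.continuousOn
  have h7 : ContinuousOn (fun _ : ℂ × X => s) (ball 0 1 ×ˢ Set.univ) := continuousOn_const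
  have hf := hg2.mul (h1.mul h2)
  have hf' := hg2.mul ((((h7.mul h3).mul h5).mul h2).add (h1.mul ((h7.mul h4).mul h6)))
  exact fun z hz => (hasDerivAt_integral_of_continuousOn isOpen_ball hf hf' hd
    hz).differentiableAt.differentiableWithinAt

variable {d : ℕ}

/-- The point `exp (iθ)` where `θ` is the angle between `e` and `x`. -/
def anglePoint (e x : Sph d) : ℂ :=
  Complex.exp (Real.arccos (inner ℝ (e : EuclideanSpace ℝ (Fin d)) x) * Complex.I)

lemma continuous_anglePoint (e : Sph d) : Continuous (anglePoint e) := by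
  unfold anglePoint
  have : Continuous fun x : Sph d => Real.arccos (inner ℝ (e : EuclideanSpace ℝ (Fin d)) x) :=
    Real.continuous_arccos.comp (by fun_prop)
  fun_prop

lemma norm_anglePoint (e x : Sph d) : ‖anglePoint e x‖ = 1 :=
  Complex.norm_exp_ofReal_mul_I _

lemma anglePoint_re (e x : Sph d) :
    (anglePoint e x).re = inner ℝ (e : EuclideanSpace ℝ (Fin d)) x := by
  have := abs_le.1 (abs_inner_sphere_le e x)
  rw [anglePoint, Complex.exp_ofReal_mul_I_re, Real.cos_arccos this.1 this.2]

/-- The generating function identity for spherical harmonics in the unit disc. -/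
lemma integral_mul_sphereKernel {P : MvPolynomial (Fin d) ℝ} {n : ℕ} (hd : 0 < d)
    (hP : P.IsHomogeneous n) (hh : IsHarmonicPoly P) (e : Sph d) {z : ℂ} (hz : ‖z‖ < 1) :
    ∫ x : Sph d, (polyFun P x : ℂ) * sphereKernel ((d : ℝ) / 2) z (anglePoint e x)
        ∂(sphMeasure d) = poissonConst d * polyFun P e * z ^ n * (1 - z ^ 2)⁻¹ := by
  have hF := differentiableOn_integral_sphereKernel (μ := sphMeasure d) ((d : ℝ) / 2)
    (g := fun x : Sph d => (polyFun P x : ℂ))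
    (Complex.continuous_ofReal.comp (continuous_polyFun_sphere P)) (continuous_anglePoint e)
    (norm_anglePoint e)
  have hG : DifferentiableOn ℂ (fun z : ℂ => (poissonConst d * polyFun P e : ℂ) * z ^ n *
      (1 - z ^ 2)⁻¹) (ball 0 1) := by
    refine DifferentiableOn.mul (by fun_prop) (DifferentiableOn.inv (by fun_prop) fun z hz => ?_)
    have hz' : ‖z‖ < 1 := by simpa using hz
    intro h0
    have : z ^ 2 = 1 := (sub_eq_zero.1 h0).symm
    have h2 := congrArg norm this
    rw [norm_pow, norm_one] at h2
    nlinarith [norm_nonneg z]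
  refine (hF.analyticOnNhd isOpen_ball).eqOn_of_preconnected_of_frequently_eq
    (hG.analyticOnNhd isOpen_ball) (convex_ball 0 1).isPreconnected
    (mem_ball_self one_pos) ?_ (by simpa using hz)
  have hreal (r : ℝ) (hr : |r| ≤ 1 / 4) :
      ∫ x : Sph d, (polyFun P x : ℂ) * sphereKernel ((d : ℝ) / 2) r (anglePoint e x)
        ∂(sphMeasure d) =
        (poissonConst d * polyFun P e : ℂ) * (r : ℂ) ^ n * (1 - (r : ℂ) ^ 2)⁻¹ := by
    have h := congrArg (fun y : ℝ => (y : ℂ)) (integral_generating_function hd hP hh e hr)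
    simp only [← integral_complex_ofReal] at h
    push_cast at h
    rw [← h]
    refine integral_congr_ae (Eventually.of_forall fun x => ?_)
    simp only
    rw [sphereKernel_ofReal _ (by linarith) (norm_anglePoint e x), anglePoint_re]
    push_cast
    rfl
  have htend : Tendsto (fun r : ℝ => (r : ℂ)) (𝓝[≠] 0) (𝓝[≠] 0) := by
    refine tendsto_nhdsWithin_of_tendsto_nhds_of_eventually_within _ ?_ ?_
    · exact (Complex.continuous_ofReal.tendsto' 0 0 (by simp)).mono_left nhdsWithin_le_nhds
    · filter_upwards [self_mem_nhdsWithin] with r hr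
      simpa using hr
  refine htend.frequently (Eventually.frequently ?_)
  have : ∀ᶠ r : ℝ in 𝓝[≠] 0, |r| ≤ 1 / 4 := by
    refine nhdsWithin_le_nhds ?_
    filter_upwards [Metric.closedBall_mem_nhds (0 : ℝ) (show (0 : ℝ) < 1 / 4 by norm_num)] with r hr
    simpa using hr
  filter_upwards [this] with r hr using hreal r hr

end Continuation

section SupBound

open Filter Topology

lemma norm_sq_one_sub_mul_exp (ρ β : ℝ) :
    ‖1 - (ρ : ℂ) * Complex.exp (β * Complex.I)‖ ^ 2 =
      (1 - ρ) ^ 2 + 2 * ρ * (1 - Real.cos β) := by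
  rw [Complex.sq_norm, Complex.normSq_apply]
  simp only [Complex.sub_re, Complex.one_re, Complex.sub_im, Complex.one_im,
    Complex.re_ofReal_mul, Complex.im_ofReal_mul, Complex.exp_ofReal_mul_I_re,
    Complex.exp_ofReal_mul_I_im]
  linear_combination ρ ^ 2 * Real.sin_sq_add_cos_sq β

lemma le_norm_one_sub_mul_exp {ρ β : ℝ} (h1 : 1 / 2 ≤ ρ) (h2 : ρ ≤ 1) (hβ : |β| ≤ Real.pi) :
    ((1 - ρ) + |β|) / 4 ≤ ‖1 - (ρ : ℂ) * Complex.exp (β * Complex.I)‖ := by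
  refine (pow_le_pow_iff_left₀ (by positivity [sub_nonneg.2 h2]) (norm_nonneg _) two_ne_zero).1 ?_
  rw [norm_sq_one_sub_mul_exp]
  have hc : 1 / 8 * β ^ 2 ≤ 1 - Real.cos β := by
    have h := Real.cos_le_one_sub_mul_cos_sq hβ
    have hpi : 1 / 8 ≤ 2 / Real.pi ^ 2 := by
      rw [div_le_div_iff₀ (by norm_num) (by positivity)]
      nlinarith [Real.pi_le_four, Real.pi_pos]
    nlinarith [mul_le_mul_of_nonneg_right hpi (sq_nonneg β)]
  have h3 : 1 - Real.cos β ≤ 2 * ρ * (1 - Real.cos β) := by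
    nlinarith [Real.cos_le_one β]
  have h4 : |β| ^ 2 = β ^ 2 := sq_abs β
  nlinarith [sq_nonneg (1 - ρ - |β|), sq_nonneg (1 - ρ), sq_nonneg β]

lemma le_norm_one_sub_mul_exp' {ρ β : ℝ} (h1 : 1 / 2 ≤ ρ) (h2 : ρ ≤ 1)
    (hβ : Real.pi / 4 ≤ β) (hβ' : β ≤ 7 * Real.pi / 4) :
    1 / 8 ≤ ‖1 - (ρ : ℂ) * Complex.exp (β * Complex.I)‖ := by
  have hpi := Real.pi_gt_three
  rcases le_total β Real.pi with h | h
  · have hb : |β| = β := abs_of_nonneg (by linarith)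
    have := le_norm_one_sub_mul_exp h1 h2 (hb.trans_le h)
    rw [hb] at this
    linarith
  · have hb : |2 * Real.pi - β| = 2 * Real.pi - β := abs_of_nonneg (by linarith)
    have := le_norm_one_sub_mul_exp h1 h2 (β := 2 * Real.pi - β) (by rw [hb]; linarith)
    have heq : ‖1 - (ρ : ℂ) * Complex.exp (((2 * Real.pi - β : ℝ) : ℂ) * Complex.I)‖ =
        ‖1 - (ρ : ℂ) * Complex.exp (β * Complex.I)‖ := by
      rw [← pow_left_inj₀ (norm_nonneg _) (norm_nonneg _) two_ne_zero, norm_sq_one_sub_mul_exp,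
        norm_sq_one_sub_mul_exp, Real.cos_two_pi_sub]
    rw [heq, hb] at this
    linarith

lemma norm_sphereKernel_le {a ρ α θ : ℝ} (ha : 0 ≤ a) (h1 : 1 / 2 ≤ ρ) (h2 : ρ < 1)
    (hα : Real.pi / 4 ≤ α) (hα' : α ≤ 3 * Real.pi / 4) (hθ : 0 ≤ θ) (hθ' : θ ≤ Real.pi) :
    ‖sphereKernel a (ρ * Complex.exp (α * Complex.I)) (Complex.exp (θ * Complex.I))‖ ≤
      32 ^ a * ((1 - ρ) + |α - θ|) ^ (-a) := by
  have hpi := Real.pi_pos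
  have hadd : (ρ : ℂ) * Complex.exp (α * Complex.I) * Complex.exp (θ * Complex.I) =
      ρ * Complex.exp ((α + θ : ℝ) * Complex.I) := by
    rw [mul_assoc, ← Complex.exp_add]; push_cast; ring_nf
  have hsub : (ρ : ℂ) * Complex.exp (α * Complex.I) *
      (starRingEnd ℂ) (Complex.exp (θ * Complex.I)) =
      ρ * Complex.exp ((α - θ : ℝ) * Complex.I) := by
    rw [← Complex.exp_conj, mul_assoc, ← Complex.exp_add]
    simp only [map_mul, Complex.conj_ofReal, Complex.conj_I]
    push_cast; ring_nf
  have hpos : 0 < (1 - ρ) + |α - θ| := add_pos_of_pos_of_nonneg (by linarith) (abs_nonneg _)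
  rw [norm_sphereKernel, hadd, hsub]
  have hb1 : ‖1 - (ρ : ℂ) * Complex.exp ((α + θ : ℝ) * Complex.I)‖ ^ (-a) ≤ 8 ^ a := by
    calc _ ≤ (1 / 8 : ℝ) ^ (-a) := Real.rpow_le_rpow_of_nonpos (by norm_num)
          (le_norm_one_sub_mul_exp' h1 h2.le (by linarith) (by linarith)) (by linarith)
      _ = _ := by rw [one_div, Real.inv_rpow (by norm_num), Real.rpow_neg (by norm_num), inv_inv]
  have hb2 : ‖1 - (ρ : ℂ) * Complex.exp ((α - θ : ℝ) * Complex.I)‖ ^ (-a) ≤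
      4 ^ a * ((1 - ρ) + |α - θ|) ^ (-a) := by
    calc _ ≤ (((1 - ρ) + |α - θ|) / 4) ^ (-a) := Real.rpow_le_rpow_of_nonpos (by positivity)
          (le_norm_one_sub_mul_exp h1 h2.le (abs_le.2 ⟨by linarith, by linarith⟩)) (by linarith)
      _ = _ := by
          rw [Real.div_rpow hpos.le (by norm_num), Real.rpow_neg (by norm_num : (0 : ℝ) ≤ 4),
            div_inv_eq_mul, mul_comm]
  calc _ ≤ 8 ^ a * (4 ^ a * ((1 - ρ) + |α - θ|) ^ (-a)) := by gcongr
    _ = _ := by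
      rw [← mul_assoc, ← Real.mul_rpow (by norm_num) (by norm_num)]; norm_num

lemma integral_shifted_rpow {a δ : ℝ} (hδ : 0 < δ) :
    ∫ x : ℝ, (δ + |x|) ^ (-a) = δ ^ (1 - a) * ∫ x : ℝ, (1 + ‖x‖) ^ (-a) := by
  have h := Measure.integral_comp_div (fun x : ℝ => (1 + ‖x‖) ^ (-a)) δ
  rw [abs_of_pos hδ, smul_eq_mul] at h
  rw [sub_eq_add_neg, Real.rpow_add hδ, Real.rpow_one, mul_right_comm, ← h, mul_comm,
    ← integral_const_mul]
  refine integral_congr_ae (Eventually.of_forall fun x => ?_)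
  simp only
  rw [← Real.mul_rpow hδ.le (by positivity), norm_div, Real.norm_eq_abs, Real.norm_eq_abs,
    abs_of_pos hδ]
  congr 1
  field_simp

lemma integrable_shifted_rpow {a δ : ℝ} (ha : 1 < a) (hδ : 0 < δ) :
    Integrable fun x : ℝ => (δ + |x|) ^ (-a) := by
  have h := ((integrable_one_add_norm (μ := (volume : Measure ℝ)) (r := a)
    (by simpa using ha)).comp_div hδ.ne').const_mul (δ ^ (-a))
  refine h.congr (Eventually.of_forall fun x => ?_)
  simp only
  rw [← Real.mul_rpow hδ.le (by positivity), norm_div, Real.norm_eq_abs, Real.norm_eq_abs,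
    abs_of_pos hδ]
  congr 1
  field_simp

lemma setIntegral_shifted_rpow_le {a δ : ℝ} (ha : 1 < a) (hδ : 0 < δ) (θ : ℝ) (s : Set ℝ) :
    ∫ α in s, (δ + |α - θ|) ^ (-a) ≤ δ ^ (1 - a) * ∫ x : ℝ, (1 + ‖x‖) ^ (-a) := by
  rw [← integral_shifted_rpow hδ, ← integral_sub_right_eq_self (fun x => (δ + |x|) ^ (-a)) θ]
  exact setIntegral_le_integral ((integrable_shifted_rpow ha hδ).comp_sub_right θ)
    (Eventually.of_forall fun x => by simp only [Pi.zero_apply]; positivity)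

lemma one_le_exp_one_mul_pow (n : ℕ) (hn : 1 ≤ n) :
    1 ≤ Real.exp 1 * (1 - 1 / ((n : ℝ) + 1)) ^ n := by
  have hn' : (0 : ℝ) < n := by exact_mod_cast hn
  have h1 : 1 - 1 / ((n : ℝ) + 1) = ((1 / (n : ℝ)) + 1)⁻¹ := by field_simp; ring
  have h2 : ((1 / (n : ℝ)) + 1) ^ n ≤ Real.exp 1 := by
    calc _ ≤ (Real.exp (1 / n)) ^ n := by gcongr; exact Real.add_one_le_exp _
      _ = _ := by rw [← Real.exp_nat_mul]; congr 1; field_simp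
  rw [h1, inv_pow, ← div_eq_mul_inv, one_le_div (by positivity)]
  exact h2

variable {d : ℕ}

/-- The supremum norm of a spherical harmonic is controlled by its `L¹` norm. -/
theorem exists_sup_le_integral_abs (hd : 3 ≤ d) :
    ∃ C : ℝ, 0 < C ∧ ∀ n : ℕ, 1 ≤ n → ∀ P : MvPolynomial (Fin d) ℝ, P.IsHomogeneous n →
      IsHarmonicPoly P → ∀ e : Sph d, |polyFun P e| ≤
        C * (n : ℝ) ^ (((d : ℝ) - 2) / 2) * ∫ x : Sph d, |polyFun P x| ∂(sphMeasure d) := by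
  have hd0 : 0 < d := by omega
  have hd3 : (3 : ℝ) ≤ d := by exact_mod_cast hd
  set a : ℝ := (d : ℝ) / 2 with ha_def
  have ha : 1 < a := by rw [ha_def]; linarith
  have hA := poissonConst_pos hd0
  set A := poissonConst d
  set J := ∫ x : ℝ, (1 + ‖x‖) ^ (-a) with hJ_def
  have hJ : 0 ≤ J := integral_nonneg fun x => by positivity
  have hpi := Real.pi_pos
  refine ⟨2 * Real.exp 1 / A * (2 / Real.pi) * (32 ^ a * (2 ^ (a - 1) * (J + 1))),
    by positivity, fun n hn P hP hh e => ?_⟩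
  have hn' : (1 : ℝ) ≤ n := by exact_mod_cast hn
  set δ : ℝ := 1 / ((n : ℝ) + 1) with hδ_def
  have hδ : 0 < δ := by positivity
  have hδ2 : δ ≤ 1 / 2 := by
    rw [hδ_def]; gcongr; linarith
  set ρ : ℝ := 1 - δ with hρ_def
  have hρδ : 1 - ρ = δ := by ring
  let θ : Sph d → ℝ := fun x => Real.arccos (inner ℝ (e : EuclideanSpace ℝ (Fin d)) x)
  have hθc : Continuous θ := Real.continuous_arccos.comp (by fun_prop)
  have hY := continuous_polyFun_sphere P
  have hk : Continuous fun p : ℝ × Sph d => (δ + |p.1 - θ p.2|) ^ (-a) := by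
    refine Continuous.rpow_const (by fun_prop) fun p => Or.inl ?_
    exact (add_pos_of_pos_of_nonneg hδ (abs_nonneg _)).ne'
  have hkc : Continuous fun p : ℝ × Sph d => |polyFun P p.2| * (δ + |p.1 - θ p.2|) ^ (-a) :=
    (hY.abs.comp continuous_snd).mul hk
  have hkb (p : ℝ × Sph d) : (δ + |p.1 - θ p.2|) ^ (-a) ≤ δ ^ (-a) :=
    Real.rpow_le_rpow_of_nonpos hδ (by linarith [abs_nonneg (p.1 - θ p.2)]) (by linarith)
  have hpoint (α : ℝ) (hα : α ∈ Set.Icc (Real.pi / 4) (3 * Real.pi / 4)) :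
      |polyFun P e| * A ≤ 2 * Real.exp 1 * 32 ^ a *
        ∫ x : Sph d, |polyFun P x| * (δ + |α - θ x|) ^ (-a) ∂(sphMeasure d) := by
    set z : ℂ := ρ * Complex.exp (α * Complex.I) with hz_def
    have hzn : ‖z‖ = ρ := by
      rw [hz_def, norm_mul, Complex.norm_exp_ofReal_mul_I, mul_one, Complex.norm_real,
        Real.norm_of_nonneg (by linarith)]
    have hz1 : ‖z‖ < 1 := by rw [hzn]; linarith
    have h1 := congrArg norm (integral_mul_sphereKernel hd0 hP hh e hz1)
    rw [norm_mul, norm_mul, norm_mul, norm_inv, norm_pow, hzn, Complex.norm_real,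
      Complex.norm_real, Real.norm_of_nonneg hA.le, Real.norm_eq_abs] at h1
    have h2 : ‖1 - z ^ 2‖ ≤ 2 := by
      refine (norm_sub_le _ _).trans ?_
      rw [norm_one, norm_pow]
      nlinarith [norm_nonneg z]
    have h2' : 0 < ‖1 - z ^ 2‖ := by
      refine norm_pos_iff.2 fun h0 => ?_
      have := congrArg norm (sub_eq_zero.1 h0)
      rw [norm_one, norm_pow] at this
      nlinarith [norm_nonneg z]
    have h3 : ‖∫ x : Sph d, (polyFun P x : ℂ) * sphereKernel a z (anglePoint e x)
        ∂(sphMeasure d)‖ ≤ ∫ x : Sph d, 32 ^ a * (|polyFun P x| * (δ + |α - θ x|) ^ (-a))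
          ∂(sphMeasure d) := by
      refine norm_integral_le_of_norm_le ((integrable_sphere ?_).const_mul _)
        (Eventually.of_forall fun x => ?_)
      · exact hkc.comp (f := fun x => (α, x)) (by fun_prop)
      · rw [norm_mul, Complex.norm_real, Real.norm_eq_abs, mul_left_comm]
        refine mul_le_mul_of_nonneg_left ?_ (abs_nonneg _)
        rw [← hρδ]
        exact norm_sphereKernel_le (by linarith) (by linarith) (by linarith) hα.1 hα.2
          (Real.arccos_nonneg _) (Real.arccos_le_pi _)
    rw [integral_const_mul] at h3
    have h4 := one_le_exp_one_mul_pow n hn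
    rw [← hδ_def, ← hρ_def] at h4
    set I := ∫ x : Sph d, |polyFun P x| * (δ + |α - θ x|) ^ (-a) ∂(sphMeasure d)
    have h5 : A * |polyFun P e| * ρ ^ n ≤ 2 * (32 ^ a * I) := by
      have h6 : A * |polyFun P e| * ρ ^ n * ‖1 - z ^ 2‖⁻¹ ≤ 32 ^ a * I := h1 ▸ h3
      rw [← div_eq_mul_inv, div_le_iff₀ h2'] at h6
      have : 0 ≤ 32 ^ a * I := (norm_nonneg _).trans h3
      nlinarith
    calc |polyFun P e| * A ≤ |polyFun P e| * A * (Real.exp 1 * ρ ^ n) :=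
          le_mul_of_one_le_right (by positivity) h4
      _ = Real.exp 1 * (A * |polyFun P e| * ρ ^ n) := by ring
      _ ≤ Real.exp 1 * (2 * (32 ^ a * I)) := by gcongr
      _ = _ := by ring
  have hint : Integrable (fun p : ℝ × Sph d => |polyFun P p.2| * (δ + |p.1 - θ p.2|) ^ (-a))
      ((volume.restrict (Set.Icc (Real.pi / 4) (3 * Real.pi / 4))).prod (sphMeasure d)) := by
    obtain ⟨M, hM⟩ := isCompact_univ.exists_bound_of_continuousOn hY.continuousOn
    refine Integrable.of_bound hkc.aestronglyMeasurable (M * δ ^ (-a))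
      (Eventually.of_forall fun p => ?_)
    have := hM p.2 (Set.mem_univ _)
    rw [norm_mul, Real.norm_eq_abs, abs_abs, Real.norm_of_nonneg (by positivity)]
    exact mul_le_mul this (hkb p) (by positivity) ((norm_nonneg _).trans this)
  have hswap := integral_integral_swap
    (f := fun (α : ℝ) (x : Sph d) => |polyFun P x| * (δ + |α - θ x|) ^ (-a)) hint
  have hvol : (volume : Measure ℝ).real (Set.Icc (Real.pi / 4) (3 * Real.pi / 4)) =
      Real.pi / 2 := by
    rw [Real.volume_real_Icc_of_le (by linarith)]; ring
  have hleft : |polyFun P e| * A * (Real.pi / 2) ≤ 2 * Real.exp 1 * 32 ^ a *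
      ∫ α in Set.Icc (Real.pi / 4) (3 * Real.pi / 4),
        ∫ x : Sph d, |polyFun P x| * (δ + |α - θ x|) ^ (-a) ∂(sphMeasure d) := by
    have h := setIntegral_mono_on (integrable_const (|polyFun P e| * A))
      (hint.integral_prod_left.const_mul (2 * Real.exp 1 * 32 ^ a)) measurableSet_Icc hpoint
    rw [setIntegral_const, hvol, integral_const_mul, smul_eq_mul] at h
    linarith
  have hright : ∫ x : Sph d, (∫ α in Set.Icc (Real.pi / 4) (3 * Real.pi / 4),
      |polyFun P x| * (δ + |α - θ x|) ^ (-a)) ∂(sphMeasure d) ≤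
      δ ^ (1 - a) * J * ∫ x : Sph d, |polyFun P x| ∂(sphMeasure d) := by
    rw [← integral_const_mul]
    refine integral_mono hint.integral_prod_right ((integrable_sphere hY.abs).const_mul _)
      fun x => ?_
    simp only
    rw [integral_const_mul, mul_comm]
    exact mul_le_mul_of_nonneg_right (setIntegral_shifted_rpow_le ha hδ _ _) (abs_nonneg _)
  have hδn : δ ^ (1 - a) ≤ 2 ^ (a - 1) * (n : ℝ) ^ (((d : ℝ) - 2) / 2) := by
    rw [show ((d : ℝ) - 2) / 2 = a - 1 by rw [ha_def]; ring,
      ← Real.mul_rpow (by norm_num) (by positivity), hδ_def, one_div, Real.inv_rpow (by positivity),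
      ← Real.rpow_neg (by positivity), neg_sub]
    exact Real.rpow_le_rpow (by positivity) (by linarith) (by linarith)
  rw [hswap] at hleft
  set I := ∫ x : Sph d, |polyFun P x| ∂(sphMeasure d)
  have hI : 0 ≤ I := integral_nonneg fun _ => abs_nonneg _
  have hfin : |polyFun P e| * A * (Real.pi / 2) ≤ 2 * Real.exp 1 * 32 ^ a *
      (2 ^ (a - 1) * (n : ℝ) ^ (((d : ℝ) - 2) / 2) * (J + 1) * I) := by
    refine hleft.trans (mul_le_mul_of_nonneg_left (hright.trans ?_) (by positivity))
    gcongr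
    linarith
  rw [mul_assoc, ← le_div_iff₀ (by positivity)] at hfin
  refine hfin.trans (le_of_eq ?_)
  field_simp

end SupBound

section SphereNorms

open Filter Topology

variable {d : ℕ}

/-- The `L^s` (quasi-)norm on the sphere as a real number. -/
def sphNorm (Y : Sph d → ℝ) (s : ℝ≥0∞) : ℝ := (eLpNorm Y s (sphMeasure d)).toReal

lemma sphNorm_nonneg (Y : Sph d → ℝ) (s : ℝ≥0∞) : 0 ≤ sphNorm Y s := ENNReal.toReal_nonneg

lemma eLpNorm_sphere_ne_top {Y : Sph d → ℝ} (hY : Continuous Y) (s : ℝ≥0∞) :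
    eLpNorm Y s (sphMeasure d) ≠ ∞ := by
  obtain ⟨M, hM⟩ := isCompact_univ.exists_bound_of_continuousOn hY.continuousOn
  exact (MemLp.of_bound hY.aestronglyMeasurable M
    (Eventually.of_forall fun x => hM x (Set.mem_univ _))).eLpNorm_ne_top

lemma ofReal_sphNorm {Y : Sph d → ℝ} (hY : Continuous Y) (s : ℝ≥0∞) :
    ENNReal.ofReal (sphNorm Y s) = eLpNorm Y s (sphMeasure d) :=
  ENNReal.ofReal_toReal (eLpNorm_sphere_ne_top hY s)

lemma sphNorm_one {Y : Sph d → ℝ} (hY : Continuous Y) :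
    sphNorm Y 1 = ∫ x, |Y x| ∂(sphMeasure d) := by
  rw [sphNorm, eLpNorm_one_eq_lintegral_enorm,
    ← integral_norm_eq_lintegral_enorm hY.aestronglyMeasurable]
  rfl

lemma sphNorm_top_le {Y : Sph d → ℝ} {C : ℝ} (hC : 0 ≤ C) (h : ∀ x, |Y x| ≤ C) :
    sphNorm Y ∞ ≤ C := by
  have := eLpNorm_le_of_ae_bound (p := ∞) (μ := sphMeasure d) (f := Y) (Eventually.of_forall h)
  exact ENNReal.toReal_le_of_le_ofReal hC (by simpa using this)

lemma inv_eq_ofReal_one_div_toReal {s : ℝ≥0∞} (hs : s ≠ 0) :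
    s⁻¹ = ENNReal.ofReal (1 / s.toReal) := by
  rcases eq_or_ne s ∞ with rfl | h
  · simp
  · rw [one_div, ENNReal.ofReal_inv_of_pos (ENNReal.toReal_pos hs h), ENNReal.ofReal_toReal h]

/-- Logarithmic convexity of the `L^s` (quasi-)norms in `1 / s`. -/
lemma sphNorm_le_rpow_mul_rpow {Y : Sph d → ℝ} (hY : Continuous Y) {p q r : ℝ≥0∞} {θ : ℝ}
    (hp : p ≠ 0) (hq : q ≠ 0) (hr : r ≠ 0) (h0 : 0 < θ) (h1 : θ < 1)
    (h : (1 - θ) * (1 / p.toReal) + θ * (1 / q.toReal) = 1 / r.toReal) :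
    sphNorm Y r ≤ sphNorm Y p ^ (1 - θ) * sphNorm Y q ^ θ := by
  have key {s : ℝ≥0∞} (hs : s ≠ 0) {t : ℝ} (ht : 0 < t) :
      eLpNorm (fun x => ‖Y x‖ ^ t) (s / ENNReal.ofReal t) (sphMeasure d) =
        eLpNorm Y s (sphMeasure d) ^ t := by
    rw [eLpNorm_norm_rpow _ ht,
      ENNReal.div_mul_cancel (by simpa using ht) ENNReal.ofReal_ne_top]
  have hinv {s : ℝ≥0∞} (hs : s ≠ 0) {t : ℝ} (ht : 0 < t) :
      (s / ENNReal.ofReal t)⁻¹ = ENNReal.ofReal (t * (1 / s.toReal)) := by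
    rw [ENNReal.inv_div (Or.inl ENNReal.ofReal_ne_top) (Or.inl (by simpa using ht)),
      div_eq_mul_inv, inv_eq_ofReal_one_div_toReal hs, ← ENNReal.ofReal_mul ht.le]
  have h1' : 0 < 1 - θ := by linarith
  have hH : ENNReal.HolderTriple (p / ENNReal.ofReal (1 - θ)) (q / ENNReal.ofReal θ) r := by
    constructor
    rw [hinv hp h1', hinv hq h0, ← ENNReal.ofReal_add (by positivity) (by positivity), h,
      inv_eq_ofReal_one_div_toReal hr]
  have hm {t : ℝ} (ht : 0 < t) : AEStronglyMeasurable (fun x => ‖Y x‖ ^ t) (sphMeasure d) :=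
    (hY.norm.rpow_const fun _ => Or.inr ht.le).aestronglyMeasurable
  have hle := eLpNorm_smul_le_mul_eLpNorm (hm h0) (hm h1') (hpqr := hH)
  have hprod : eLpNorm ((fun x => ‖Y x‖ ^ (1 - θ)) • fun x => ‖Y x‖ ^ θ) r (sphMeasure d) =
      eLpNorm Y r (sphMeasure d) := by
    rw [← eLpNorm_norm Y]
    congr 1
    funext x
    simp only [Pi.smul_apply', smul_eq_mul]
    rw [← Real.rpow_add_of_nonneg (norm_nonneg _) h1'.le h0.le, sub_add_cancel, Real.rpow_one]
  rw [hprod, key hp h1', key hq h0] at hle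
  unfold sphNorm
  rw [ENNReal.toReal_rpow, ENNReal.toReal_rpow, ← ENNReal.toReal_mul]
  refine ENNReal.toReal_mono (ENNReal.mul_ne_top ?_ ?_) hle
  · exact ENNReal.rpow_ne_top_of_nonneg h1'.le (eLpNorm_sphere_ne_top hY p)
  · exact ENNReal.rpow_ne_top_of_nonneg h0.le (eLpNorm_sphere_ne_top hY q)

/-- Passing from an `L^∞`-`L^1` bound to an `L^∞`-`L^p` bound. -/
lemma sphNorm_top_le_of_sphNorm_one {Y : Sph d → ℝ} (hY : Continuous Y) {p : ℝ≥0∞} (hp0 : 0 < p)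
    (hp1 : p ≤ 1) {K : ℝ} (hK : 0 ≤ K) (h : sphNorm Y ∞ ≤ K * sphNorm Y 1) :
    sphNorm Y ∞ ≤ K ^ (1 / p.toReal) * sphNorm Y p := by
  have hpt : p ≠ ∞ := (hp1.trans_lt ENNReal.one_lt_top).ne
  have hp : 0 < p.toReal := ENNReal.toReal_pos hp0.ne' hpt
  rcases eq_or_lt_of_le hp1 with rfl | hlt
  · simpa using h
  have hlt' : p.toReal < 1 := by
    simpa using (ENNReal.toReal_lt_toReal hpt ENNReal.one_ne_top).2 hlt
  rcases eq_or_lt_of_le (sphNorm_nonneg Y ∞) with h0 | h0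
  · rw [← h0]; exact mul_nonneg (by positivity) (sphNorm_nonneg _ _)
  have hc := sphNorm_le_rpow_mul_rpow hY (p := p) (q := ∞) (r := 1) (θ := 1 - p.toReal) hp0.ne'
    (by simp) (by simp) (by linarith) (by linarith) (by simp [hp.ne'])
  rw [sub_sub_cancel] at hc
  have h2 : sphNorm Y ∞ ^ p.toReal ≤ K * sphNorm Y p ^ p.toReal := by
    have h3 := h.trans (mul_le_mul_of_nonneg_left hc hK)
    rw [Real.rpow_sub h0, Real.rpow_one, ← mul_assoc, ← mul_div_assoc,
      le_div_iff₀ (Real.rpow_pos_of_pos h0 _), mul_comm] at h3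
    exact le_of_mul_le_mul_right h3 h0
  have h4 := Real.rpow_le_rpow (Real.rpow_nonneg h0.le _) h2 (one_div_nonneg.2 hp.le)
  rwa [Real.mul_rpow hK (Real.rpow_nonneg (sphNorm_nonneg _ _) _), ← Real.rpow_mul h0.le,
    ← Real.rpow_mul (sphNorm_nonneg _ _), mul_one_div_cancel hp.ne', Real.rpow_one,
    Real.rpow_one] at h4

/-- Passing from an `L^∞`-`L^p` bound to an `L^q`-`L^p` bound. -/
lemma sphNorm_le_of_sphNorm_top {Y : Sph d → ℝ} (hY : Continuous Y) {p q : ℝ≥0∞} (hp0 : 0 < p)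
    (hpq : p < q) {K : ℝ} (hK : 0 ≤ K) (h : sphNorm Y ∞ ≤ K * sphNorm Y p) :
    sphNorm Y q ≤ K ^ (1 - p.toReal * (1 / q.toReal)) * sphNorm Y p := by
  rcases eq_or_ne q ∞ with rfl | hq
  · simpa using h
  have hpt : p ≠ ∞ := hpq.ne_top
  have hp : 0 < p.toReal := ENNReal.toReal_pos hp0.ne' hpt
  have hpq' : p.toReal < q.toReal := (ENNReal.toReal_lt_toReal hpt hq).2 hpq
  have hq0 : 0 < q.toReal := hp.trans hpq'
  have hlt : p.toReal * (1 / q.toReal) < 1 := by rw [mul_one_div, div_lt_one hq0]; exact hpq'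
  have hpos : 0 < p.toReal * (1 / q.toReal) := by positivity
  have hc := sphNorm_le_rpow_mul_rpow hY (p := p) (q := ∞) (r := q)
    (θ := 1 - p.toReal * (1 / q.toReal)) hp0.ne' (by simp) (hp0.trans hpq).ne' (by linarith)
    (by linarith) (by simp; field_simp)
  rw [sub_sub_cancel] at hc
  set t := p.toReal * (1 / q.toReal)
  calc sphNorm Y q ≤ sphNorm Y p ^ t * sphNorm Y ∞ ^ (1 - t) := hc
    _ ≤ sphNorm Y p ^ t * (K * sphNorm Y p) ^ (1 - t) := by
        refine mul_le_mul_of_nonneg_left ?_ (Real.rpow_nonneg (sphNorm_nonneg _ _) _)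
        exact Real.rpow_le_rpow (sphNorm_nonneg _ _) h (by linarith)
    _ = K ^ (1 - t) * (sphNorm Y p ^ t * sphNorm Y p ^ (1 - t)) := by
        rw [Real.mul_rpow hK (sphNorm_nonneg _ _)]; ring
    _ = _ := by
        rw [← Real.rpow_add_of_nonneg (sphNorm_nonneg _ _) hpos.le (by linarith),
          add_sub_cancel, Real.rpow_one]

/-- The `L^∞`-`L^p` estimate for spherical harmonics. -/
lemma exists_sphNorm_top_le (hd : 3 ≤ d) {p : ℝ≥0∞} (hp0 : 0 < p) (hp1 : p ≤ 1) :
    ∃ C : ℝ, 0 < C ∧ ∀ n : ℕ, 1 ≤ n → ∀ P : MvPolynomial (Fin d) ℝ, P.IsHomogeneous n →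
      IsHarmonicPoly P → sphNorm (fun x : Sph d => polyFun P x) ∞ ≤
        C * (n : ℝ) ^ (((d : ℝ) - 2) / 2 * (1 / p.toReal)) *
          sphNorm (fun x : Sph d => polyFun P x) p := by
  obtain ⟨C, hC, h⟩ := exists_sup_le_integral_abs hd
  refine ⟨C ^ (1 / p.toReal), Real.rpow_pos_of_pos hC _, fun n hn P hP hh => ?_⟩
  have hY := continuous_polyFun_sphere P
  have hn0 : (0 : ℝ) ≤ n := Nat.cast_nonneg n
  rw [Real.rpow_mul hn0, ← Real.mul_rpow hC.le (Real.rpow_nonneg hn0 _)]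
  refine sphNorm_top_le_of_sphNorm_one hY hp0 hp1 (by positivity) ?_
  have hK : 0 ≤ C * (n : ℝ) ^ (((d : ℝ) - 2) / 2) := by positivity
  refine sphNorm_top_le (mul_nonneg hK (sphNorm_nonneg _ _)) fun e => ?_
  rw [sphNorm_one hY]
  exact h n hn P hP hh e

/-- The `L^q`-`L^p` estimate for spherical harmonics. -/
lemma exists_sphNorm_le (hd : 3 ≤ d) {p q : ℝ≥0∞} (hp0 : 0 < p) (hp1 : p ≤ 1) (hpq : p < q) :
    ∃ C : ℝ, 0 < C ∧ ∀ n : ℕ, 1 ≤ n → ∀ P : MvPolynomial (Fin d) ℝ, P.IsHomogeneous n →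
      IsHarmonicPoly P → sphNorm (fun x : Sph d => polyFun P x) q ≤
        C * (n : ℝ) ^ (((d : ℝ) - 2) / 2 * (1 / p.toReal - 1 / q.toReal)) *
          sphNorm (fun x : Sph d => polyFun P x) p := by
  obtain ⟨C, hC, h⟩ := exists_sphNorm_top_le hd hp0 hp1
  refine ⟨C ^ (1 - p.toReal * (1 / q.toReal)), Real.rpow_pos_of_pos hC _, fun n hn P hP hh => ?_⟩
  have hn0 : (0 : ℝ) ≤ n := Nat.cast_nonneg n
  have hp : 0 < p.toReal := ENNReal.toReal_pos hp0.ne' (hp1.trans_lt ENNReal.one_lt_top).ne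
  have h2 := sphNorm_le_of_sphNorm_top (continuous_polyFun_sphere P) hp0 hpq (by positivity)
    (h n hn P hP hh)
  rw [Real.mul_rpow hC.le (Real.rpow_nonneg hn0 _), ← Real.rpow_mul hn0] at h2
  have hexp : ((d : ℝ) - 2) / 2 * (1 / p.toReal) * (1 - p.toReal * (1 / q.toReal)) =
      ((d : ℝ) - 2) / 2 * (1 / p.toReal - 1 / q.toReal) := by
    have : 1 / p.toReal * p.toReal = 1 := one_div_mul_cancel hp.ne'
    linear_combination (-(((d : ℝ) - 2) / 2 * (1 / q.toReal))) * this
  rwa [hexp] at h2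

end SphereNorms

section PlanarPower

open MvPolynomial

variable {d : ℕ}

/-- The real and imaginary parts of `(X i + √-1 X j) ^ n`. -/
def planarPower (i j : Fin d) : ℕ → MvPolynomial (Fin d) ℝ × MvPolynomial (Fin d) ℝ
  | 0 => (1, 0)
  | n + 1 => (X i * (planarPower i j n).1 - X j * (planarPower i j n).2,
      X j * (planarPower i j n).1 + X i * (planarPower i j n).2)

lemma isHomogeneous_planarPower (i j : Fin d) (n : ℕ) :
    (planarPower i j n).1.IsHomogeneous n ∧ (planarPower i j n).2.IsHomogeneous n := by
  induction n with
  | zero => exact ⟨isHomogeneous_one _ _, isHomogeneous_zero _ _ _⟩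
  | succ n ih =>
    obtain ⟨h1, h2⟩ := ih
    rw [add_comm n 1]
    have e : planarPower i j (1 + n) = planarPower i j (n + 1) := by rw [add_comm]
    rw [e]
    exact ⟨((isHomogeneous_X ℝ i).mul h1).sub ((isHomogeneous_X ℝ j).mul h2),
      ((isHomogeneous_X ℝ j).mul h1).add ((isHomogeneous_X ℝ i).mul h2)⟩

lemma pderiv_planarPower_of_ne {i j k : Fin d} (hi : k ≠ i) (hj : k ≠ j) (n : ℕ) :
    pderiv k (planarPower i j n).1 = 0 ∧ pderiv k (planarPower i j n).2 = 0 := by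
  induction n with
  | zero => simp [planarPower]
  | succ n ih =>
    simp [planarPower, ih.1, ih.2, Derivation.leibniz, pderiv_X_of_ne hi.symm,
      pderiv_X_of_ne hj.symm]

lemma cauchyRiemann_planarPower {i j : Fin d} (hij : i ≠ j) (n : ℕ) :
    pderiv i (planarPower i j n).1 = pderiv j (planarPower i j n).2 ∧
      pderiv j (planarPower i j n).1 = -pderiv i (planarPower i j n).2 := by
  induction n with
  | zero => simp [planarPower]
  | succ n ih =>
    simp only [planarPower, map_add, map_sub, Derivation.leibniz, pderiv_X_self,
      pderiv_X_of_ne hij, pderiv_X_of_ne hij.symm, smul_eq_mul]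
    constructor
    · linear_combination X i * ih.1 - X j * ih.2
    · linear_combination X i * ih.2 + X j * ih.1

lemma isHarmonicPoly_planarPower {i j : Fin d} (hij : i ≠ j) (n : ℕ) :
    IsHarmonicPoly (planarPower i j n).1 := by
  unfold IsHarmonicPoly
  rw [Finset.sum_eq_add i j hij (fun k _ hk => by
    rw [(pderiv_planarPower_of_ne hk.1 hk.2 n).1, map_zero]) (by simp) (by simp),
    (cauchyRiemann_planarPower hij n).1, (cauchyRiemann_planarPower hij n).2, map_neg,
    pderiv_comm_apply, add_neg_cancel]

lemma polyFun_planarPower_sq_add_sq (i j : Fin d) (n : ℕ) (x : EuclideanSpace ℝ (Fin d)) :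
    polyFun (planarPower i j n).1 x ^ 2 + polyFun (planarPower i j n).2 x ^ 2 =
      (x i ^ 2 + x j ^ 2) ^ n := by
  induction n with
  | zero => simp [planarPower, polyFun]
  | succ n ih =>
    rw [pow_succ (x i ^ 2 + x j ^ 2), ← ih]
    simp only [polyFun, planarPower, map_sub, map_add, map_mul, eval_X]
    ring

lemma polyFun_planarPower_single {i j : Fin d} (hij : i ≠ j) (n : ℕ) :
    polyFun (planarPower i j n).1 (EuclideanSpace.single i 1) = 1 := by
  induction n with
  | zero => simp [planarPower, polyFun]
  | succ n ih =>
    rw [planarPower, sub_eq_add_neg, ← neg_mul, polyFun_add, polyFun_mul, ih]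
    simp [polyFun, hij.symm]

lemma sq_add_sq_le_one {i j : Fin d} (hij : i ≠ j) (x : Sph d) :
    (x : EuclideanSpace ℝ (Fin d)) i ^ 2 + (x : EuclideanSpace ℝ (Fin d)) j ^ 2 ≤ 1 := by
  have hx : ‖(x : EuclideanSpace ℝ (Fin d))‖ ^ 2 = 1 := by
    rw [norm_eq_of_mem_sphere x, one_pow]
  rw [EuclideanSpace.norm_sq_eq] at hx
  simp only [Real.norm_eq_abs, sq_abs] at hx
  rw [← hx, ← Finset.sum_pair hij (f := fun k => (x : EuclideanSpace ℝ (Fin d)) k ^ 2)]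
  exact Finset.sum_le_sum_of_subset_of_nonneg (Finset.subset_univ _) fun _ _ _ => sq_nonneg _

/-- A power of `x i ^ 2 + x j ^ 2` has explicit Gaussian integral. -/
lemma gaussInt_sq_add_sq_pow {i j : Fin d} (hij : i ≠ j) (k : ℕ) :
    gaussInt ((X i ^ 2 + X j ^ 2 : MvPolynomial (Fin d) ℝ) ^ k) =
      (k.factorial : ℝ) * gaussInt (1 : MvPolynomial (Fin d) ℝ) := by
  induction k with
  | zero => simp
  | succ k ih =>
    have h0 := gaussInt_X_mul i (X i * (X i ^ 2 + X j ^ 2 : MvPolynomial (Fin d) ℝ) ^ k)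
    have h1 := gaussInt_X_mul j (X j * (X i ^ 2 + X j ^ 2 : MvPolynomial (Fin d) ℝ) ^ k)
    have hsum : gaussInt ((X i ^ 2 + X j ^ 2 : MvPolynomial (Fin d) ℝ) ^ (k + 1)) =
        gaussInt (X i * (X i * (X i ^ 2 + X j ^ 2 : MvPolynomial (Fin d) ℝ) ^ k)) +
        gaussInt (X j * (X j * (X i ^ 2 + X j ^ 2 : MvPolynomial (Fin d) ℝ) ^ k)) := by
      rw [← gaussInt_add]
      congr 1
      ring
    have hder : pderiv i (X i * (X i ^ 2 + X j ^ 2 : MvPolynomial (Fin d) ℝ) ^ k) +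
        pderiv j (X j * (X i ^ 2 + X j ^ 2 : MvPolynomial (Fin d) ℝ) ^ k) =
        C (2 * (k + 1) : ℝ) * (X i ^ 2 + X j ^ 2 : MvPolynomial (Fin d) ℝ) ^ k := by
      rcases k with _ | k
      · simp only [pow_zero, mul_one, pderiv_X_self, CharP.cast_eq_zero, zero_add]
        rw [map_ofNat]
        norm_num
      · simp only [Derivation.leibniz, Derivation.leibniz_pow, map_add, pderiv_X_self,
          pderiv_X_of_ne hij, pderiv_X_of_ne hij.symm, smul_eq_mul, nsmul_eq_mul, map_mul,
          map_one, map_natCast, map_ofNat, Nat.add_sub_cancel]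
        push_cast
        ring
    have := gaussInt_add (pderiv i (X i * (X i ^ 2 + X j ^ 2 : MvPolynomial (Fin d) ℝ) ^ k))
      (pderiv j (X j * (X i ^ 2 + X j ^ 2 : MvPolynomial (Fin d) ℝ) ^ k))
    rw [hder, gaussInt_C_mul, ih] at this
    rw [hsum, Nat.factorial_succ]
    push_cast
    linarith

lemma Gamma_add_one_le (k : ℕ) {l : ℝ} (hl : 0 < l) :
    ((k : ℝ) + 1) ^ l * (k.factorial : ℝ) ≤ (1 + l) * Real.Gamma (k + 1 + l) := by
  have hk : (0 : ℝ) < k + 1 := by positivity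
  set G := Real.Gamma (k + 1 + l) with hG
  have hG0 : 0 < G := Real.Gamma_pos_of_pos (by positivity)
  have hF : (0 : ℝ) < k.factorial := by positivity
  have hF1 : Real.Gamma ((k : ℝ) + 1) = k.factorial := Real.Gamma_nat_eq_factorial k
  have hF2 : Real.Gamma ((k : ℝ) + 2) = (k + 1) * k.factorial := by
    rw [show (k : ℝ) + 2 = (k + 1) + 1 by ring, Real.Gamma_add_one hk.ne', hF1]
  have hG2 : Real.Gamma ((k : ℝ) + 2 + l) = (k + 1 + l) * G := by
    rw [show (k : ℝ) + 2 + l = (k + 1 + l) + 1 by ring, Real.Gamma_add_one (by positivity)]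
  have hconv := Real.Gamma_mul_add_mul_le_rpow_Gamma_mul_rpow_Gamma (s := (k : ℝ) + 1)
    (t := (k : ℝ) + 2 + l) (a := l / (1 + l)) (b := 1 / (1 + l)) (by positivity) (by positivity)
    (by positivity) (by positivity) (by field_simp; ring)
  rw [show l / (1 + l) * ((k : ℝ) + 1) + 1 / (1 + l) * ((k : ℝ) + 2 + l) = k + 2 by
    field_simp; ring, hF1, hF2, hG2] at hconv
  have hpow := Real.rpow_le_rpow (by positivity) hconv (show (0 : ℝ) ≤ 1 + l by positivity)
  rw [Real.mul_rpow (x := (k.factorial : ℝ) ^ (l / (1 + l))) (by positivity) (by positivity),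
    ← Real.rpow_mul hF.le, ← Real.rpow_mul (by positivity), div_mul_cancel₀ _ (by positivity),
    div_mul_cancel₀ _ (by positivity), Real.rpow_one, Real.mul_rpow hk.le hF.le,
    Real.rpow_add hk, Real.rpow_add hF, Real.rpow_one, Real.rpow_one] at hpow
  have hFl : 0 < (k.factorial : ℝ) ^ l := Real.rpow_pos_of_pos hF _
  have h3 : ((k : ℝ) + 1) * (((k : ℝ) + 1) ^ l * (k.factorial : ℝ)) ≤ (k + 1 + l) * G := by
    refine le_of_mul_le_mul_left (a := (k.factorial : ℝ) ^ l) ?_ hFl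
    linarith
  refine le_of_mul_le_mul_left (h3.trans ?_) hk
  have : (k : ℝ) + 1 + l ≤ (k + 1) * (1 + l) := by nlinarith [Nat.cast_nonneg (α := ℝ) k]
  calc (k + 1 + l) * G ≤ ((k + 1) * (1 + l)) * G := by gcongr
    _ = _ := by ring

lemma exists_sphere_integral_sq_add_sq_pow_le (hd : 3 ≤ d) {i j : Fin d} (hij : i ≠ j) :
    ∃ C : ℝ, 0 < C ∧ ∀ k : ℕ,
      ∫ x : Sph d, ((x : EuclideanSpace ℝ (Fin d)) i ^ 2 + (x : EuclideanSpace ℝ (Fin d)) j ^ 2) ^ k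
        ∂(sphMeasure d) ≤ C * ((k : ℝ) + 1) ^ (-(((d : ℝ) - 2) / 2)) := by
  have hd3 : (3 : ℝ) ≤ d := by exact_mod_cast hd
  set l : ℝ := ((d : ℝ) - 2) / 2 with hl_def
  have hl : 0 < l := by rw [hl_def]; linarith
  have hg := gaussInt_one_pos (d := d)
  refine ⟨2 * (1 + l) * gaussInt (1 : MvPolynomial (Fin d) ℝ), by positivity, fun k => ?_⟩
  have hhom : ((X i ^ 2 + X j ^ 2 : MvPolynomial (Fin d) ℝ) ^ k).IsHomogeneous (2 * k) :=
    (((isHomogeneous_X ℝ i).pow 2).add ((isHomogeneous_X ℝ j).pow 2)).pow k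
  have h := gaussInt_eq_sphere (by omega) hhom
  have hfun : ∀ x : Sph d, polyFun ((X i ^ 2 + X j ^ 2 : MvPolynomial (Fin d) ℝ) ^ k) x =
      ((x : EuclideanSpace ℝ (Fin d)) i ^ 2 + (x : EuclideanSpace ℝ (Fin d)) j ^ 2) ^ k := by
    intro x
    simp [polyFun]
  simp only [hfun] at h
  rw [gaussInt_sq_add_sq_pow hij, show (((2 * k : ℕ) : ℝ) + d) / 2 = k + 1 + l by
    rw [hl_def]; push_cast; ring] at h
  set I := ∫ x : Sph d,
    ((x : EuclideanSpace ℝ (Fin d)) i ^ 2 + (x : EuclideanSpace ℝ (Fin d)) j ^ 2) ^ k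
      ∂(sphMeasure d)
  set g := gaussInt (1 : MvPolynomial (Fin d) ℝ)
  have hGam := Gamma_add_one_le k hl
  have hF : (0 : ℝ) < k.factorial := by positivity
  have hk : (0 : ℝ) < ((k : ℝ) + 1) ^ l := by positivity
  have hI : 0 ≤ I := integral_nonneg fun x => by positivity
  rw [Real.rpow_neg (by positivity), ← div_eq_mul_inv, le_div_iff₀ hk]
  refine le_of_mul_le_mul_left (a := (k.factorial : ℝ)) ?_ hF
  have := mul_le_mul_of_nonneg_right hGam hI
  nlinarith

/-- The `L^s` (quasi-)norm of the planar power of degree `n` is at most a multiple of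
`n ^ (-λ / s)`. -/
lemma exists_sphNorm_planarPower_le (hd : 3 ≤ d) {i j : Fin d} (hij : i ≠ j) {s : ℝ≥0∞}
    (hs0 : s ≠ 0) (hs : s ≠ ∞) :
    ∃ C : ℝ, 0 < C ∧ ∀ n : ℕ, 1 ≤ n →
      sphNorm (fun x : Sph d => polyFun (planarPower i j n).1 x) s ≤
        C * (n : ℝ) ^ (-(((d : ℝ) - 2) / 2 * (1 / s.toReal))) := by
  have hd3 : (3 : ℝ) ≤ d := by exact_mod_cast hd
  obtain ⟨C, hC, h⟩ := exists_sphere_integral_sq_add_sq_pow_le hd hij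
  set l : ℝ := ((d : ℝ) - 2) / 2 with hl_def
  have hl : 0 < l := by rw [hl_def]; linarith
  set t := s.toReal with ht_def
  have ht : 0 < t := ENNReal.toReal_pos hs0 hs
  refine ⟨(C * (t / 2) ^ (-l)) ^ (1 / t), by positivity, fun n hn => ?_⟩
  have hn0 : (0 : ℝ) < n := by exact_mod_cast hn
  set Y : Sph d → ℝ := fun x => polyFun (planarPower i j n).1 x with hY_def
  have hY : Continuous Y := continuous_polyFun_sphere _
  set k := ⌊(n : ℝ) * t / 2⌋₊
  have hk1 : (k : ℝ) ≤ n * t / 2 := Nat.floor_le (by positivity)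
  have hk2 : n * t / 2 ≤ (k : ℝ) + 1 := (Nat.lt_floor_add_one _).le
  have hpt : ∀ x : Sph d, ‖Y x‖ ^ t ≤
      ((x : EuclideanSpace ℝ (Fin d)) i ^ 2 + (x : EuclideanSpace ℝ (Fin d)) j ^ 2) ^ k := by
    intro x
    have hw1 := sq_add_sq_le_one hij x
    have hq := polyFun_planarPower_sq_add_sq i j n (x : EuclideanSpace ℝ (Fin d))
    set w := (x : EuclideanSpace ℝ (Fin d)) i ^ 2 + (x : EuclideanSpace ℝ (Fin d)) j ^ 2
    have hw : 0 ≤ w := by positivity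
    have hYw : ‖Y x‖ ^ 2 ≤ w ^ n := by
      rw [← hq, Real.norm_eq_abs, sq_abs]
      exact le_add_of_nonneg_right (sq_nonneg _)
    calc ‖Y x‖ ^ t = (‖Y x‖ ^ 2) ^ (t / 2) := by
          rw [← Real.rpow_natCast, ← Real.rpow_mul (norm_nonneg _)]
          congr 1
          push_cast
          ring
      _ ≤ (w ^ n) ^ (t / 2) := by gcongr
      _ = w ^ ((n : ℝ) * t / 2) := by
          rw [← Real.rpow_natCast, ← Real.rpow_mul hw, mul_div_assoc]
      _ ≤ w ^ (k : ℝ) := by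
          rcases hw.eq_or_lt with h0 | h0
          · rw [← h0, Real.zero_rpow (by positivity)]
            positivity
          · exact Real.rpow_le_rpow_of_exponent_ge h0 hw1 hk1
      _ = w ^ k := Real.rpow_natCast _ _
  have hYt : Continuous fun x => ‖Y x‖ ^ t :=
    hY.norm.rpow_const fun _ => Or.inr ht.le
  have hint : ∫ x, ‖Y x‖ ^ t ∂(sphMeasure d) ≤ C * (t / 2) ^ (-l) * (n : ℝ) ^ (-l) := by
    refine (integral_mono (integrable_sphere hYt) (integrable_sphere (by fun_prop)) hpt).trans
      ((h k).trans ?_)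
    rw [mul_assoc, ← Real.mul_rpow (by positivity) hn0.le]
    refine mul_le_mul_of_nonneg_left ?_ hC.le
    exact Real.rpow_le_rpow_of_nonpos (by positivity) (by linarith) (by linarith)
  have hmem : MemLp Y s (sphMeasure d) :=
    ⟨hY.aestronglyMeasurable, (eLpNorm_sphere_ne_top hY s).lt_top⟩
  have hI : 0 ≤ ∫ x, ‖Y x‖ ^ t ∂(sphMeasure d) := integral_nonneg fun _ => by positivity
  rw [sphNorm, hmem.eLpNorm_eq_integral_rpow_norm hs0 hs,
    ENNReal.toReal_ofReal (Real.rpow_nonneg hI _), ← one_div]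
  calc (∫ x, ‖Y x‖ ^ t ∂(sphMeasure d)) ^ (1 / t)
      ≤ (C * (t / 2) ^ (-l) * (n : ℝ) ^ (-l)) ^ (1 / t) := by gcongr
    _ = _ := by
        rw [Real.mul_rpow (by positivity) (by positivity), ← Real.rpow_mul hn0.le, neg_mul]

/-- The `L^p` (quasi-)norm of the planar power of degree `n` is at least a multiple of
`n ^ (-λ / p)`, for `p ≤ 1`. -/
lemma exists_one_le_sphNorm_planarPower (hd : 3 ≤ d) {i j : Fin d} (hij : i ≠ j) {p : ℝ≥0∞}
    (hp0 : 0 < p) (hp1 : p ≤ 1) :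
    ∃ C : ℝ, 0 < C ∧ ∀ n : ℕ, 1 ≤ n →
      1 ≤ C * (n : ℝ) ^ (((d : ℝ) - 2) / 2 * (1 / p.toReal)) *
        sphNorm (fun x : Sph d => polyFun (planarPower i j n).1 x) p := by
  obtain ⟨C, hC, h⟩ := exists_sup_le_integral_abs hd
  have hbase : ∀ n : ℕ, 1 ≤ n → 1 ≤ C * (n : ℝ) ^ (((d : ℝ) - 2) / 2) *
      sphNorm (fun x : Sph d => polyFun (planarPower i j n).1 x) 1 := by
    intro n hn
    have := h n hn _ (isHomogeneous_planarPower i j n).1 (isHarmonicPoly_planarPower hij n)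
      ⟨EuclideanSpace.single i 1, by simp⟩
    rwa [polyFun_planarPower_single hij, abs_one,
      ← sphNorm_one (continuous_polyFun_sphere _)] at this
  rcases hp1.eq_or_lt with rfl | hp
  · exact ⟨C, hC, by simpa using hbase⟩
  · obtain ⟨C', hC', h'⟩ := exists_sphNorm_le hd hp0 hp1 hp
    refine ⟨C * C', by positivity, fun n hn => (hbase n hn).trans ?_⟩
    have hn0 : (0 : ℝ) < n := by exact_mod_cast hn
    refine (mul_le_mul_of_nonneg_left (h' n hn _ (isHomogeneous_planarPower i j n).1
      (isHarmonicPoly_planarPower hij n)) (by positivity)).trans (le_of_eq ?_)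
    have e : ((d : ℝ) - 2) / 2 * (1 / p.toReal) =
        ((d : ℝ) - 2) / 2 + ((d : ℝ) - 2) / 2 * (1 / p.toReal - 1 / (1 : ℝ≥0∞).toReal) := by
      simp
      ring
    rw [e, Real.rpow_add hn0]
    ring

/-- The planar powers show that the `L^q`-`L^p` estimate for spherical harmonics is sharp. -/
lemma exists_le_sphNorm_planarPower (hd : 3 ≤ d) {i j : Fin d} (hij : i ≠ j) {p q : ℝ≥0∞}
    (hp0 : 0 < p) (hp1 : p ≤ 1) (hpq : p < q) :
    ∃ c : ℝ, 0 < c ∧ ∀ n : ℕ, 1 ≤ n →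
      c * (n : ℝ) ^ (((d : ℝ) - 2) / 2 * (1 / p.toReal - 1 / q.toReal)) *
        sphNorm (fun x : Sph d => polyFun (planarPower i j n).1 x) p ≤
      sphNorm (fun x : Sph d => polyFun (planarPower i j n).1 x) q := by
  have hd3 : (3 : ℝ) ≤ d := by exact_mod_cast hd
  have hptop : p ≠ ∞ := (hp1.trans_lt ENNReal.one_lt_top).ne
  have hp : 0 < p.toReal := ENNReal.toReal_pos hp0.ne' hptop
  have hr0 : p / 2 ≠ 0 := (ENNReal.div_pos hp0.ne' (by simp)).ne'
  have hrtop : p / 2 ≠ ∞ := (ENNReal.div_lt_top hptop (by simp)).ne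
  have hr : 1 / (p / 2).toReal = 2 * (1 / p.toReal) := by
    rw [ENNReal.toReal_div]
    simp
    ring
  have hqp : 1 / q.toReal < 1 / p.toReal := by
    rcases eq_or_ne q ∞ with rfl | hq
    · simpa using hp
    · exact one_div_lt_one_div_of_lt hp ((ENNReal.toReal_lt_toReal hptop hq).2 hpq)
  have hv0 : 0 ≤ 1 / q.toReal := by positivity
  have hu0 : 0 < 1 / p.toReal := by positivity
  obtain ⟨C₁, hC₁, h1⟩ := exists_one_le_sphNorm_planarPower hd hij hp0 hp1
  obtain ⟨C₂, hC₂, h2⟩ := exists_sphNorm_planarPower_le hd hij hr0 hrtop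
  obtain ⟨C₃, hC₃, h3⟩ := exists_sphNorm_planarPower_le hd hij hp0.ne' hptop
  rw [hr] at h2
  set l : ℝ := ((d : ℝ) - 2) / 2 with hl_def
  have hl : 0 < l := by rw [hl_def]; linarith
  set u := 1 / p.toReal with hu
  set v := 1 / q.toReal with hv
  set θ := u / (2 * u - v) with hθ
  have hden : 0 < 2 * u - v := by linarith
  have hθ0 : 0 < θ := by positivity
  have hθ1 : θ < 1 := by rw [hθ, div_lt_one hden]; linarith
  have hθeq : (1 - θ) * (2 * u) + θ * v = u := by
    have : θ * (2 * u - v) = u := div_mul_cancel₀ _ hden.ne'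
    linear_combination -this
  set K := C₁ * C₂ ^ (1 - θ) with hK
  have hK0 : 0 < K := by positivity
  refine ⟨(K⁻¹) ^ (1 / θ) * C₃⁻¹, by positivity, fun n hn => ?_⟩
  have hn0 : (0 : ℝ) < n := by exact_mod_cast hn
  have hint := sphNorm_le_rpow_mul_rpow (continuous_polyFun_sphere (planarPower i j n).1)
    (p := p / 2) (q := q) (r := p) hr0 (hp0.trans hpq).ne' hp0.ne' hθ0 hθ1 (by rw [hr]; exact hθeq)
  have h1n := h1 n hn
  have h2n := h2 n hn
  have h3n := h3 n hn
  set R := sphNorm (fun x : Sph d => polyFun (planarPower i j n).1 x) (p / 2)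
  set P := sphNorm (fun x : Sph d => polyFun (planarPower i j n).1 x) p
  set Q := sphNorm (fun x : Sph d => polyFun (planarPower i j n).1 x) q
  have hR : 0 ≤ R := sphNorm_nonneg _ _
  have hQ : 0 ≤ Q := sphNorm_nonneg _ _
  have hlow : K⁻¹ * (n : ℝ) ^ (-(l * v) * θ) ≤ Q ^ θ := by
    rw [inv_mul_le_iff₀ hK0]
    have hb : 1 ≤ C₁ * (n : ℝ) ^ (l * u) *
        ((C₂ * (n : ℝ) ^ (-(l * (2 * u)))) ^ (1 - θ) * Q ^ θ) := by
      refine h1n.trans (mul_le_mul_of_nonneg_left (hint.trans ?_) (by positivity))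
      exact mul_le_mul_of_nonneg_right (Real.rpow_le_rpow hR h2n (by linarith)) (by positivity)
    have he : C₁ * (n : ℝ) ^ (l * u) * ((C₂ * (n : ℝ) ^ (-(l * (2 * u)))) ^ (1 - θ) * Q ^ θ) =
        (n : ℝ) ^ (l * v * θ) * (K * Q ^ θ) := by
      rw [Real.mul_rpow hC₂.le (by positivity), ← Real.rpow_mul hn0.le,
        show l * v * θ = l * u + -(l * (2 * u)) * (1 - θ) by linear_combination l * hθeq,
        Real.rpow_add hn0, hK]
      ring
    rw [he] at hb
    rw [neg_mul, Real.rpow_neg hn0.le, inv_le_iff_one_le_mul₀ (by positivity), mul_comm]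
    exact hb
  have hQlow : (K⁻¹) ^ (1 / θ) * (n : ℝ) ^ (-(l * v)) ≤ Q := by
    have := Real.rpow_le_rpow (by positivity) hlow (show 0 ≤ 1 / θ by positivity)
    rwa [Real.mul_rpow (by positivity) (by positivity), ← Real.rpow_mul hn0.le,
      ← Real.rpow_mul hQ, mul_assoc, mul_one_div_cancel hθ0.ne', mul_one, Real.rpow_one] at this
  refine le_trans ?_ hQlow
  calc (K⁻¹) ^ (1 / θ) * C₃⁻¹ * (n : ℝ) ^ (l * (u - v)) * P
      ≤ (K⁻¹) ^ (1 / θ) * C₃⁻¹ * (n : ℝ) ^ (l * (u - v)) * (C₃ * (n : ℝ) ^ (-(l * u))) := by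
        gcongr
    _ = (K⁻¹) ^ (1 / θ) * ((n : ℝ) ^ (l * (u - v)) * (n : ℝ) ^ (-(l * u))) := by
        field_simp
    _ = _ := by
        rw [← Real.rpow_add hn0]
        ring_nf

end PlanarPower

/-- Theorem 1.1(i), case `0 < p ≤ 1 < q ≤ ∞`: the sharp reverse Hölder inequality
`‖Y_n‖_q ∼ n^{λ(1/p - 1/q)} ‖Y_n‖_p` for spherical harmonics of degree `n`,
where `λ = (d-2)/2`. -/
theorem reverse_holder_small_p
    (d : ℕ) (hd : 3 ≤ d) (p q : ℝ≥0∞)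
    (hp0 : 0 < p) (hp1 : p ≤ 1) (hpq : p < q) (hq : q ≤ ∞) :
    ∃ c C : ℝ, 0 < c ∧ 0 < C ∧ ∀ n : ℕ, 1 ≤ n →
      ((∀ Y : Sph d → ℝ, IsSphericalHarmonic d n Y →
          eLpNorm Y q (sphMeasure d) ≤
            ENNReal.ofReal
                (C * (n : ℝ) ^ ((((d : ℝ) - 2) / 2) * (1 / p.toReal - 1 / q.toReal))) *
              eLpNorm Y p (sphMeasure d)) ∧
        (∃ Y : Sph d → ℝ, IsSphericalHarmonic d n Y ∧ Y ≠ 0 ∧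
          ENNReal.ofReal
              (c * (n : ℝ) ^ ((((d : ℝ) - 2) / 2) * (1 / p.toReal - 1 / q.toReal))) *
            eLpNorm Y p (sphMeasure d) ≤ eLpNorm Y q (sphMeasure d))) := by
  obtain ⟨C, hC, hupper⟩ := exists_sphNorm_le hd hp0 hp1 hpq
  have hij : (⟨0, by omega⟩ : Fin d) ≠ ⟨1, by omega⟩ := by simp
  obtain ⟨c, hc, hlower⟩ := exists_le_sphNorm_planarPower hd hij hp0 hp1 hpq
  refine ⟨c, C, hc, hC, fun n hn => ⟨?_, ?_⟩⟩
  · rintro Y ⟨P, hP, hharm, hY⟩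
    obtain rfl : Y = fun x : Sph d => polyFun P x := funext hY
    have hcont := continuous_polyFun_sphere P
    rw [← ofReal_sphNorm hcont, ← ofReal_sphNorm hcont, ← ENNReal.ofReal_mul (by positivity)]
    exact ENNReal.ofReal_le_ofReal (hupper n hn P hP hharm)
  · set P := (planarPower (⟨0, by omega⟩ : Fin d) ⟨1, by omega⟩ n).1 with hP
    have hcont := continuous_polyFun_sphere P
    refine ⟨fun x => polyFun P x, ⟨P, (isHomogeneous_planarPower _ _ n).1,
      isHarmonicPoly_planarPower hij n, fun _ => rfl⟩, fun h0 => ?_, ?_⟩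
    · have h1 := congrFun h0 ⟨EuclideanSpace.single ⟨0, by omega⟩ 1, by simp⟩
      simp only [hP, polyFun_planarPower_single hij, Pi.zero_apply, one_ne_zero] at h1
    · rw [← ofReal_sphNorm hcont, ← ofReal_sphNorm hcont, ← ENNReal.ofReal_mul (by positivity)]
      exact ENNReal.ofReal_le_ofReal (hlower n hn)
end
end

section
/- Let d ≥ 3 and let 2 + 1/λ < p < q ≤ ∞ (with the convention 1/∞ = 0). Then there exist constants c, C > 0 such that for every integer n ≥ 1: (a) every spherical harmonic Y_n of degree n on S^{d-1} satisfies ‖Y_n‖_q ≤ C · n^{(2λ+1)(1/p − 1/q)} · ‖Y_n‖_p; and (b) there exists a nonzero spherical harmonic Y_n of degree n on S^{d-1} with ‖Y_n‖_q ≥ c · n^{(2λ+1)(1/p − 1/q)} · ‖Y_n‖_p. -/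
open MeasureTheory Metric
open scoped ENNReal

noncomputable section

section ComplexBound

lemma MvPolynomial.IsHomogeneous.aeval_mul_left {ι R A : Type*} [CommSemiring R]
    [CommSemiring A] [Algebra R A] {P : MvPolynomial ι R} {n : ℕ} (hP : P.IsHomogeneous n)
    (c : A) (z : ι → A) :
    MvPolynomial.aeval (fun i => c * z i) P = c ^ n * MvPolynomial.aeval z P := by
  simp only [MvPolynomial.aeval_def, MvPolynomial.eval₂_eq, Finset.mul_sum]
  refine Finset.sum_congr rfl fun s hs => ?_
  have hs' : ∑ i ∈ s.support, s i = n := by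
    have := hP (MvPolynomial.mem_support_iff.mp hs)
    rwa [Finsupp.weight_apply, Finsupp.sum, Finset.sum_congr rfl fun i _ => by
      rw [Pi.one_apply, smul_eq_mul, mul_one]] at this
  simp only [mul_pow, Finset.prod_mul_distrib, Finset.prod_pow_eq_pow_sum, hs']
  ring

lemma MvPolynomial.aeval_ofReal {ι : Type*} (P : MvPolynomial ι ℝ) (x : ι → ℝ) :
    MvPolynomial.aeval (fun i => (x i : ℂ)) P = ((MvPolynomial.eval x P : ℝ) : ℂ) := by
  refine (MvPolynomial.aeval_algebraMap_apply ℂ x P).trans ?_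
  rw [MvPolynomial.aeval_eq_eval]
  rfl

lemma MvPolynomial.differentiable_aeval {ι : Type*} (P : MvPolynomial ι ℝ) {f : ℂ → ι → ℂ}
    (hf : ∀ i, Differentiable ℂ fun w => f w i) :
    Differentiable ℂ fun w => MvPolynomial.aeval (f w) P := by
  induction P using MvPolynomial.induction_on with
  | C a => simp
  | add p q hp hq =>
    simp only [map_add]
    exact hp.add hq
  | mul_X p i hp =>
    simp only [map_mul, MvPolynomial.aeval_X]
    exact hp.mul (hf i)

variable {d n : ℕ} {P : MvPolynomial (Fin d) ℝ} {M : ℝ}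

lemma MvPolynomial.IsHomogeneous.eval_smul_euclidean (hP : P.IsHomogeneous n) (r : ℝ)
    (x : EuclideanSpace ℝ (Fin d)) :
    MvPolynomial.eval (fun i => (r • x) i) P = r ^ n * MvPolynomial.eval (fun i => x i) P := by
  simpa [MvPolynomial.aeval_eq_eval] using hP.aeval_mul_left r fun i => x i

lemma abs_eval_le_of_norm_le_one (hP : P.IsHomogeneous n)
    (hM : ∀ x : EuclideanSpace ℝ (Fin d), ‖x‖ = 1 → |MvPolynomial.eval (fun i => x i) P| ≤ M)
    (hd : 0 < d) {x : EuclideanSpace ℝ (Fin d)} (hx : ‖x‖ ≤ 1) :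
    |MvPolynomial.eval (fun i => x i) P| ≤ M := by
  obtain ⟨u, hu, hxu⟩ : ∃ u : EuclideanSpace ℝ (Fin d), ‖u‖ = 1 ∧ x = ‖x‖ • u := by
    rcases eq_or_ne x 0 with rfl | h
    · exact ⟨EuclideanSpace.single ⟨0, hd⟩ 1, by simp, by simp⟩
    · exact ⟨‖x‖⁻¹ • x, norm_smul_inv_norm h, by
        rw [smul_inv_smul₀ (norm_ne_zero_iff.mpr h)]⟩
  rw [hxu, hP.eval_smul_euclidean, abs_mul, abs_of_nonneg (by positivity)]
  calc ‖x‖ ^ n * _ ≤ 1 * M :=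
        mul_le_mul (pow_le_one₀ (norm_nonneg _) hx) (hM u hu) (abs_nonneg _) zero_le_one
    _ = M := one_mul M

/-- Restriction of a polynomial to the complexified plane spanned by `x` and `y`, in the
isotropic coordinates `a = s + i t`, `b = s - i t` of the point `s x + t y`. -/
def planeRestriction (P : MvPolynomial (Fin d) ℝ) (x y : EuclideanSpace ℝ (Fin d))
    (a b : ℂ) : ℂ :=
  MvPolynomial.aeval (fun i => (a + b) / 2 * (x i : ℂ) + (a - b) / (2 * Complex.I) * (y i : ℂ)) P

lemma planeRestriction_mul (hP : P.IsHomogeneous n) (x y : EuclideanSpace ℝ (Fin d))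
    (c a b : ℂ) :
    planeRestriction P x y (c * a) (c * b) = c ^ n * planeRestriction P x y a b := by
  rw [planeRestriction, planeRestriction, ← hP.aeval_mul_left]
  congr 2
  ext i
  ring

lemma norm_planeRestriction_le_of_norm_eq_one (hP : P.IsHomogeneous n)
    (hM : ∀ x : EuclideanSpace ℝ (Fin d), ‖x‖ = 1 → |MvPolynomial.eval (fun i => x i) P| ≤ M)
    (hd : 0 < d) {x y : EuclideanSpace ℝ (Fin d)} (hxy : inner ℝ x y = 0) (hx : ‖x‖ ≤ 1)
    (hy : ‖y‖ ≤ 1) {a b : ℂ} (ha : ‖a‖ = 1) (hb : ‖b‖ = 1) :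
    ‖planeRestriction P x y a b‖ ≤ M := by
  set t : ℝ := (a.arg - b.arg) / 2 with ht
  set c : ℂ := Complex.exp (((a.arg + b.arg) / 2 : ℝ) * Complex.I) with hc
  have ha' : a = c * Complex.exp (t * Complex.I) := by
    rw [hc, ← Complex.exp_add]
    conv_lhs => rw [← Complex.norm_mul_exp_arg_mul_I a, ha, Complex.ofReal_one, one_mul]
    congr 1
    rw [ht]; push_cast; ring
  have hb' : b = c * Complex.exp (-t * Complex.I) := by
    rw [hc, ← Complex.exp_add]
    conv_lhs => rw [← Complex.norm_mul_exp_arg_mul_I b, hb, Complex.ofReal_one, one_mul]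
    congr 1
    rw [ht]; push_cast; ring
  have hQ : planeRestriction P x y (Complex.exp (t * Complex.I)) (Complex.exp (-t * Complex.I))
      = ((MvPolynomial.eval (fun i => (Real.cos t • x + Real.sin t • y) i) P : ℝ) : ℂ) := by
    rw [← MvPolynomial.aeval_ofReal, planeRestriction]
    congr 2
    ext i
    have h1 : (Complex.exp (t * Complex.I) - Complex.exp (-t * Complex.I)) / (2 * Complex.I)
        = Complex.sin t := by
      rw [Complex.sin]
      field_simp
      rw [Complex.I_sq]; ring
    rw [h1]
    simp [Complex.cos]
  have hnorm : ‖Real.cos t • x + Real.sin t • y‖ ≤ 1 := by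
    rw [← sq_le_one_iff₀ (norm_nonneg _), norm_add_sq_real, norm_smul, norm_smul,
      real_inner_smul_left, real_inner_smul_right, hxy, mul_pow, mul_pow]
    simp only [Real.norm_eq_abs, sq_abs, mul_zero, add_zero]
    have h1 : ‖x‖ ^ 2 ≤ 1 := pow_le_one₀ (norm_nonneg _) hx
    have h2 : ‖y‖ ^ 2 ≤ 1 := pow_le_one₀ (norm_nonneg _) hy
    nlinarith [Real.sin_sq_add_cos_sq t, sq_nonneg (Real.sin t), sq_nonneg (Real.cos t)]
  rw [ha', hb', planeRestriction_mul hP, norm_mul, norm_pow, hc, Complex.norm_exp_ofReal_mul_I,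
    one_pow, one_mul, hQ, Complex.norm_real, Real.norm_eq_abs]
  exact abs_eval_le_of_norm_le_one hP hM hd hnorm

lemma norm_le_of_norm_le_on_unit_circle {f : ℂ → ℂ} (hf : Differentiable ℂ f)
    (h : ∀ z : ℂ, ‖z‖ = 1 → ‖f z‖ ≤ M) {z : ℂ} (hz : ‖z‖ ≤ 1) : ‖f z‖ ≤ M := by
  refine Complex.norm_le_of_forall_mem_frontier_norm_le (U := Metric.ball 0 1)
    Metric.isBounded_ball hf.diffContOnCl (fun w hw => h w ?_) ?_
  · rw [frontier_ball _ one_ne_zero] at hw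
    simpa using hw
  · rw [closure_ball _ one_ne_zero]
    simpa using hz

lemma norm_planeRestriction_le (hP : P.IsHomogeneous n)
    (hM : ∀ x : EuclideanSpace ℝ (Fin d), ‖x‖ = 1 → |MvPolynomial.eval (fun i => x i) P| ≤ M)
    (hd : 0 < d) {x y : EuclideanSpace ℝ (Fin d)} (hxy : inner ℝ x y = 0) (hx : ‖x‖ ≤ 1)
    (hy : ‖y‖ ≤ 1) {R : ℝ} (hR : 0 < R) {a b : ℂ} (ha : ‖a‖ ≤ R) (hb : ‖b‖ ≤ R) :
    ‖planeRestriction P x y a b‖ ≤ R ^ n * M := by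
  have key : ∀ a b : ℂ, ‖a‖ ≤ 1 → ‖b‖ ≤ 1 → ‖planeRestriction P x y a b‖ ≤ M := by
    intro a b ha hb
    have hdb : ∀ a, Differentiable ℂ fun b => planeRestriction P x y a b := fun a =>
      MvPolynomial.differentiable_aeval P fun i => by fun_prop
    have hda : ∀ b, Differentiable ℂ fun a => planeRestriction P x y a b := fun b =>
      MvPolynomial.differentiable_aeval P fun i => by fun_prop
    refine norm_le_of_norm_le_on_unit_circle (hda b) (fun a ha => ?_) ha
    exact norm_le_of_norm_le_on_unit_circle (hdb a)
      (fun b hb => norm_planeRestriction_le_of_norm_eq_one hP hM hd hxy hx hy ha hb) hb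
  have hR' : (R : ℂ) ≠ 0 := by exact_mod_cast hR.ne'
  have hscale : ∀ w : ℂ, ‖w‖ ≤ R → ‖(R : ℂ)⁻¹ * w‖ ≤ 1 := fun w hw => by
    rw [norm_mul, norm_inv, Complex.norm_real, Real.norm_of_nonneg hR.le]
    exact inv_mul_le_one_of_le₀ hw hR.le
  have := planeRestriction_mul hP x y R ((R : ℂ)⁻¹ * a) ((R : ℂ)⁻¹ * b)
  rw [mul_inv_cancel_left₀ hR', mul_inv_cancel_left₀ hR'] at this
  rw [this, norm_mul, norm_pow, Complex.norm_real, Real.norm_of_nonneg hR.le]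
  exact mul_le_mul_of_nonneg_left (key _ _ (hscale a ha) (hscale b hb)) (by positivity)

lemma norm_aeval_complex_line_le (hP : P.IsHomogeneous n)
    (hM : ∀ x : EuclideanSpace ℝ (Fin d), ‖x‖ = 1 → |MvPolynomial.eval (fun i => x i) P| ≤ M)
    (hd : 0 < d) {x v : EuclideanSpace ℝ (Fin d)} (hx : ‖x‖ = 1) (hv : ‖v‖ = 1) (ζ : ℂ) :
    ‖MvPolynomial.aeval (fun i => (x i : ℂ) + ζ * (v i : ℂ)) P‖ ≤ (1 + ‖ζ‖) ^ n * M := by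
  set α : ℝ := inner ℝ x v with hα
  set w := v - α • x with hw
  set β := ‖w‖ with hβ
  set y := β⁻¹ • w with hy
  have hxw : inner ℝ x w = 0 := by
    rw [hw, inner_sub_right, real_inner_smul_right, real_inner_self_eq_norm_sq, hx]
    simp [hα]
  have hxy : inner ℝ x y = 0 := by rw [hy, real_inner_smul_right, hxw, mul_zero]
  have hy1 : ‖y‖ ≤ 1 := by
    rw [hy, norm_smul, norm_inv, norm_norm]
    exact inv_mul_le_one
  have hwy : w = β • y := by
    rcases eq_or_ne β 0 with h | h
    · rw [h, zero_smul]; exact norm_eq_zero.mp h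
    · rw [hy, smul_inv_smul₀ h]
  have hvxy : v = α • x + β • y := by rw [← hwy, hw]; abel
  have hαβ : α ^ 2 + β ^ 2 = 1 := by
    have h1 : v = α • x + w := by rw [hw]; abel
    have h2 : ‖v‖ ^ 2 = α ^ 2 + β ^ 2 := by
      rw [h1, norm_add_sq_real, real_inner_smul_left, hxw, norm_smul, hx, hβ]
      simp
    rw [← h2, hv, one_pow]
  have hn1 : ‖(α : ℂ) + β * Complex.I‖ = 1 := by
    rw [Complex.norm_add_mul_I, hαβ, Real.sqrt_one]
  have hn2 : ‖(α : ℂ) + (-β : ℝ) * Complex.I‖ = 1 := by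
    rw [Complex.norm_add_mul_I, neg_sq, hαβ, Real.sqrt_one]
  have heq : MvPolynomial.aeval (fun i => (x i : ℂ) + ζ * (v i : ℂ)) P =
      planeRestriction P x y (1 + ζ * (α + β * Complex.I))
        (1 + ζ * (α + (-β : ℝ) * Complex.I)) := by
    rw [planeRestriction]
    congr 2
    ext i
    have : v i = α * x i + β * y i := by
      conv_lhs => rw [hvxy]
      simp
    rw [this]
    push_cast
    field_simp
    ring
  rw [heq]
  refine norm_planeRestriction_le hP hM hd hxy hx.le hy1 (by positivity) ?_ ?_
  · refine (norm_add_le _ _).trans ?_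
    rw [norm_mul, hn1, norm_one, mul_one]
  · refine (norm_add_le _ _).trans ?_
    rw [norm_mul, hn2, norm_one, mul_one]

/-- A homogeneous polynomial of degree `n` stays comparable to its maximum over the sphere
in a ball of radius comparable to `1 / n` around a maximum point. -/
lemma half_le_abs_eval_of_isMax (hP : P.IsHomogeneous n) (hn : 1 ≤ n)
    {x₀ : EuclideanSpace ℝ (Fin d)} (hx₀ : ‖x₀‖ = 1)
    (hmax : ∀ x : EuclideanSpace ℝ (Fin d), ‖x‖ = 1 →
      |MvPolynomial.eval (fun i => x i) P| ≤ |MvPolynomial.eval (fun i => x₀ i) P|)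
    {x : EuclideanSpace ℝ (Fin d)} (hx : ‖x - x₀‖ ≤ 1 / (2 * Real.exp 2 * n)) :
    |MvPolynomial.eval (fun i => x₀ i) P| / 2 ≤ |MvPolynomial.eval (fun i => x i) P| := by
  have hd : 0 < d := by
    rcases Nat.eq_zero_or_pos d with rfl | h
    · rw [Subsingleton.elim x₀ 0] at hx₀; simp at hx₀
    · exact h
  have hn0 : (0 : ℝ) < n := by exact_mod_cast hn
  set M := |MvPolynomial.eval (fun i => x₀ i) P| with hM
  rcases eq_or_ne x x₀ with rfl | hne
  · linarith [abs_nonneg (MvPolynomial.eval (fun i => x i) P)]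
  set t := ‖x - x₀‖ with ht
  have ht0 : 0 < t := norm_pos_iff.mpr (sub_ne_zero.mpr hne)
  set v := t⁻¹ • (x - x₀) with hv
  have hv1 : ‖v‖ = 1 := norm_smul_inv_norm (sub_ne_zero.mpr hne)
  have hxv : x = x₀ + t • v := by rw [hv, smul_inv_smul₀ ht0.ne']; abel
  set f : ℂ → ℂ := fun ζ => MvPolynomial.aeval (fun i => (x₀ i : ℂ) + ζ * (v i : ℂ)) P with hf
  have hfd : Differentiable ℂ f := MvPolynomial.differentiable_aeval P fun i => by fun_prop
  have hfb : ∀ ζ : ℂ, ‖ζ‖ ≤ 2 / n → ‖f ζ‖ ≤ Real.exp 2 * M := fun ζ hζ => by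
    refine (norm_aeval_complex_line_le hP hmax hd hx₀ hv1 ζ).trans ?_
    refine mul_le_mul_of_nonneg_right ?_ (abs_nonneg _)
    calc (1 + ‖ζ‖) ^ n ≤ (Real.exp (2 / n)) ^ n := by
          refine pow_le_pow_left₀ (by positivity) ?_ n
          linarith [Real.add_one_le_exp (2 / n : ℝ)]
      _ = Real.exp 2 := by rw [← Real.exp_nat_mul]; congr 1; field_simp
  have hder : ∀ ζ ∈ Metric.closedBall (0 : ℂ) (1 / n), ‖deriv f ζ‖ ≤ Real.exp 2 * M * n := by
    intro ζ hζ
    have := Complex.norm_deriv_le_of_forall_mem_sphere_norm_le (c := ζ) (R := 1 / n)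
      (C := Real.exp 2 * M) (by positivity) hfd.diffContOnCl fun w hw => hfb w ?_
    · simpa using this
    · have h1 : ‖w - ζ‖ = 1 / n := by simpa [dist_eq_norm] using hw
      have h2 : ‖ζ‖ ≤ 1 / n := by simpa using hζ
      calc ‖w‖ = ‖(w - ζ) + ζ‖ := by rw [sub_add_cancel]
        _ ≤ ‖w - ζ‖ + ‖ζ‖ := norm_add_le _ _
        _ ≤ 1 / n + 1 / n := by rw [h1]; gcongr
        _ = 2 / n := by ring
  have ht1 : t ≤ 1 / n := by
    refine hx.trans (one_div_le_one_div_of_le hn0 ?_)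
    nlinarith [Real.add_one_le_exp (2 : ℝ)]
  have hmem0 : (0 : ℂ) ∈ Metric.closedBall (0 : ℂ) (1 / n) :=
    Metric.mem_closedBall_self (by positivity)
  have hmemt : (t : ℂ) ∈ Metric.closedBall (0 : ℂ) (1 / n) := by
    rw [mem_closedBall_zero_iff, Complex.norm_real, Real.norm_of_nonneg ht0.le]
    exact ht1
  have hdiff : ‖f t - f 0‖ ≤ Real.exp 2 * M * n * ‖(t : ℂ) - 0‖ :=
    Convex.norm_image_sub_le_of_norm_deriv_le (fun ζ _ => hfd ζ) hder
      (convex_closedBall (0 : ℂ) (1 / n)) hmem0 hmemt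
  have hft : f t = ((MvPolynomial.eval (fun i => x i) P : ℝ) : ℂ) := by
    refine Eq.trans ?_ (MvPolynomial.aeval_ofReal P _)
    refine congrArg (fun g : Fin d → ℂ => MvPolynomial.aeval g P) (funext fun i => ?_)
    have hi : x i = x₀ i + t * v i := congrArg (fun y : EuclideanSpace ℝ (Fin d) => y i) hxv
    rw [hi]
    push_cast
    rfl
  have hf0 : f 0 = ((MvPolynomial.eval (fun i => x₀ i) P : ℝ) : ℂ) := by
    refine Eq.trans ?_ (MvPolynomial.aeval_ofReal P _)
    refine congrArg (fun g : Fin d → ℂ => MvPolynomial.aeval g P) (funext fun i => ?_)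
    rw [zero_mul, add_zero]
  rw [hft, hf0, sub_zero, ← Complex.ofReal_sub, Complex.norm_real, Complex.norm_real,
    Real.norm_eq_abs, Real.norm_of_nonneg ht0.le] at hdiff
  have hbound : Real.exp 2 * M * n * t ≤ M / 2 := by
    calc Real.exp 2 * M * n * t ≤ Real.exp 2 * M * n * (1 / (2 * Real.exp 2 * n)) := by
          refine mul_le_mul_of_nonneg_left hx ?_
          have := abs_nonneg (MvPolynomial.eval (fun i => x₀ i) P)
          positivity
      _ = M / 2 := by field_simp
  have := abs_sub_abs_le_abs_sub (MvPolynomial.eval (fun i => x₀ i) P)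
    (MvPolynomial.eval (fun i => x i) P)
  rw [abs_sub_comm] at this
  linarith

end ComplexBound

section Polar

lemma lintegral_eq_lintegral_toSphere {E : Type*} [NormedAddCommGroup E] [NormedSpace ℝ E]
    [MeasurableSpace E] [BorelSpace E] [FiniteDimensional ℝ E] [Nontrivial E] (μ : Measure E)
    [μ.IsAddHaarMeasure] {F : E → ℝ≥0∞} (hF : Measurable F) :
    ∫⁻ x, F x ∂μ = ∫⁻ ω : sphere (0 : E) 1, ∫⁻ r in Set.Ioi (0 : ℝ),
      ENNReal.ofReal (r ^ (Module.finrank ℝ E - 1)) * F (r • (ω : E)) ∂volume ∂μ.toSphere := by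
  have hG : Measurable fun z : sphere (0 : E) 1 × Set.Ioi (0 : ℝ) => F ((z.2 : ℝ) • (z.1 : E)) :=
    hF.comp (by fun_prop)
  calc ∫⁻ x, F x ∂μ = ∫⁻ x : ({0}ᶜ : Set E), F x ∂(μ.comap (↑)) := by
        rw [lintegral_subtype_comap (measurableSet_singleton _).compl,
          restrict_compl_singleton]
    _ = ∫⁻ z, F ((z.2 : ℝ) • (z.1 : E))
          ∂μ.toSphere.prod (Measure.volumeIoiPow (Module.finrank ℝ E - 1)) := by
        rw [← μ.measurePreserving_homeomorphUnitSphereProd.lintegral_comp hG]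
        refine lintegral_congr fun x => ?_
        congr 1
        simp [smul_smul, mul_inv_cancel₀ (norm_ne_zero_iff.mpr x.2)]
    _ = _ := by
        rw [lintegral_prod _ hG.aemeasurable]
        refine lintegral_congr fun ω => ?_
        have hg : Measurable fun r : Set.Ioi (0 : ℝ) => F ((r : ℝ) • (ω : E)) :=
          hF.comp (by fun_prop)
        rw [Measure.volumeIoiPow, lintegral_withDensity_eq_lintegral_mul _ (by fun_prop) hg]
        exact lintegral_subtype_comap measurableSet_Ioi
          fun r => ENNReal.ofReal (r ^ (Module.finrank ℝ E - 1)) * F (r • (ω : E))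

end Polar

section Nikolskii

variable {d n : ℕ} {P : MvPolynomial (Fin d) ℝ}

lemma continuous_eval_euclidean (P : MvPolynomial (Fin d) ℝ) :
    Continuous fun x : EuclideanSpace ℝ (Fin d) => MvPolynomial.eval (fun i => x i) P :=
  (MvPolynomial.continuous_eval P).comp (by fun_prop)

lemma lintegral_shell_le (hd : 1 ≤ d) (hP : P.IsHomogeneous n) (hn : 1 ≤ n) {p : ℝ}
    (hp : 0 < p) :
    ∫⁻ x in {x : EuclideanSpace ℝ (Fin d) | ‖x‖ ∈ Set.Icc (1 - 1 / n : ℝ) (1 + 1 / n)},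
        ‖MvPolynomial.eval (fun i => x i) P‖ₑ ^ p ≤
      ENNReal.ofReal (2 ^ d * Real.exp p / n) *
        ∫⁻ ω : Sph d, ‖MvPolynomial.eval (fun i => (ω : EuclideanSpace ℝ (Fin d)) i) P‖ₑ ^ p
          ∂sphMeasure d := by
  have hn0 : (0 : ℝ) < n := by exact_mod_cast hn
  have : NeZero d := ⟨by omega⟩
  set A := {x : EuclideanSpace ℝ (Fin d) | ‖x‖ ∈ Set.Icc (1 - 1 / n : ℝ) (1 + 1 / n)} with hA
  have hAm : MeasurableSet A := measurableSet_Icc.preimage measurable_norm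
  have hmeas : Measurable fun x : EuclideanSpace ℝ (Fin d) =>
      ‖MvPolynomial.eval (fun i => x i) P‖ₑ ^ p :=
    (continuous_eval_euclidean P).measurable.enorm.pow_const p
  rw [← lintegral_indicator hAm, lintegral_eq_lintegral_toSphere _ (hmeas.indicator hAm),
    ← lintegral_const_mul' _ _ ENNReal.ofReal_ne_top]
  refine lintegral_mono fun ω => ?_
  have hω : ‖(ω : EuclideanSpace ℝ (Fin d))‖ = 1 := by simp
  calc _ ≤ ∫⁻ r in Set.Ioi (0 : ℝ), (Set.Icc (1 - 1 / n : ℝ) (1 + 1 / n)).indicator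
            (fun _ => ENNReal.ofReal (2 ^ (d - 1) * Real.exp p) *
              ‖MvPolynomial.eval (fun i => (ω : EuclideanSpace ℝ (Fin d)) i) P‖ₑ ^ p) r := by
        refine setLIntegral_mono' measurableSet_Ioi fun r (hr : 0 < r) => ?_
        rw [finrank_euclideanSpace_fin]
        have hmem : r • (ω : EuclideanSpace ℝ (Fin d)) ∈ A ↔
            r ∈ Set.Icc (1 - 1 / n : ℝ) (1 + 1 / n) := by
          rw [hA, Set.mem_ofPred_eq, norm_smul, hω, mul_one, Real.norm_of_nonneg hr.le]
        by_cases h : r ∈ Set.Icc (1 - 1 / n : ℝ) (1 + 1 / n)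
        · rw [Set.indicator_of_mem h, Set.indicator_of_mem (hmem.mpr h),
            hP.eval_smul_euclidean, enorm_mul, ENNReal.mul_rpow_of_nonneg _ _ hp.le, ← mul_assoc,
            Real.enorm_of_nonneg (by positivity),
            ENNReal.ofReal_rpow_of_nonneg (by positivity) hp.le,
            ← ENNReal.ofReal_mul (by positivity)]
          refine mul_le_mul_left (ENNReal.ofReal_le_ofReal ?_) _
          refine mul_le_mul (pow_le_pow_left₀ hr.le (h.2.trans ?_) _) ?_ (by positivity)
            (by positivity)
          · have : 1 / (n : ℝ) ≤ 1 := by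
              rw [div_le_one hn0]; exact_mod_cast hn
            linarith
          · refine Real.rpow_le_rpow (z := p) (y := Real.exp 1) (by positivity) ?_ hp.le |>.trans ?_
            · calc r ^ n ≤ (Real.exp (1 / n)) ^ n := by
                    refine pow_le_pow_left₀ hr.le (h.2.trans ?_) n
                    linarith [Real.add_one_le_exp (1 / n : ℝ)]
                _ = Real.exp 1 := by rw [← Real.exp_nat_mul]; congr 1; field_simp
            · rw [← Real.exp_mul, one_mul]
        · rw [Set.indicator_of_notMem h, Set.indicator_of_notMem (mt hmem.mp h), mul_zero]
    _ ≤ ∫⁻ r, (Set.Icc (1 - 1 / n : ℝ) (1 + 1 / n)).indicator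
            (fun _ => ENNReal.ofReal (2 ^ (d - 1) * Real.exp p) *
              ‖MvPolynomial.eval (fun i => (ω : EuclideanSpace ℝ (Fin d)) i) P‖ₑ ^ p) r :=
        setLIntegral_le_lintegral _ _
    _ = _ := by
        rw [lintegral_indicator_const measurableSet_Icc, Real.volume_Icc, mul_right_comm,
          ← ENNReal.ofReal_mul (by positivity)]
        congr 2
        have : (2 : ℝ) ^ d = 2 ^ (d - 1) * 2 := by rw [← pow_succ, Nat.sub_add_cancel hd]
        rw [this]; ring

/-- The constant in the Nikolskii inequality between `L^∞` and `L^p`. -/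
lemma exists_ofReal_max_rpow_le (hd : 1 ≤ d) {p : ℝ} (hp : 0 < p) :
    ∃ K : ℝ, 0 < K ∧ ∀ (n : ℕ) (P : MvPolynomial (Fin d) ℝ) (x₀ : EuclideanSpace ℝ (Fin d)),
      1 ≤ n → P.IsHomogeneous n → ‖x₀‖ = 1 →
      (∀ x : EuclideanSpace ℝ (Fin d), ‖x‖ = 1 →
        |MvPolynomial.eval (fun i => x i) P| ≤ |MvPolynomial.eval (fun i => x₀ i) P|) →
      ENNReal.ofReal (|MvPolynomial.eval (fun i => x₀ i) P| ^ p) ≤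
        ENNReal.ofReal (K * (n : ℝ) ^ (d - 1)) *
          ∫⁻ ω : Sph d, ‖MvPolynomial.eval (fun i => (ω : EuclideanSpace ℝ (Fin d)) i) P‖ₑ ^ p
            ∂sphMeasure d := by
  have : NeZero d := ⟨by omega⟩
  set V := (volume (ball (0 : EuclideanSpace ℝ (Fin d)) 1)).toReal with hV
  have hV0 : 0 < V := ENNReal.toReal_pos (measure_ball_pos _ _ one_pos).ne' measure_ball_lt_top.ne
  set δ := 1 / (2 * Real.exp 2) with hδ
  have hδ0 : 0 < δ := by positivity
  have hδ1 : δ ≤ 1 := by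
    rw [hδ, div_le_one (by positivity)]
    nlinarith [Real.add_one_le_exp (2 : ℝ)]
  refine ⟨2 ^ p * (2 ^ d * Real.exp p) / (δ ^ d * V), by positivity,
    fun n P x₀ hn hP hx₀ hmax => ?_⟩
  have hn0 : (0 : ℝ) < n := by exact_mod_cast hn
  set M := |MvPolynomial.eval (fun i => x₀ i) P| with hM
  have hM0 : 0 ≤ M := abs_nonneg _
  set I := ∫⁻ ω : Sph d, ‖MvPolynomial.eval (fun i => (ω : EuclideanSpace ℝ (Fin d)) i) P‖ₑ ^ p
            ∂sphMeasure d
  have hvol : volume (closedBall x₀ (δ / n)) = ENNReal.ofReal ((δ / n) ^ d * V) := by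
    rw [Measure.addHaar_closedBall _ _ (by positivity), finrank_euclideanSpace_fin,
      ENNReal.ofReal_mul (by positivity), hV, ENNReal.ofReal_toReal measure_ball_lt_top.ne]
  have hlow : ENNReal.ofReal ((M / 2) ^ p * ((δ / n) ^ d * V)) ≤
      ENNReal.ofReal (2 ^ d * Real.exp p / n) * I := by
    refine le_trans ?_ (lintegral_shell_le hd hP hn hp)
    calc ENNReal.ofReal ((M / 2) ^ p * ((δ / n) ^ d * V))
        = ∫⁻ x in closedBall x₀ (δ / n), ENNReal.ofReal ((M / 2) ^ p) := by
          rw [setLIntegral_const, hvol, ← ENNReal.ofReal_mul (by positivity)]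
      _ ≤ ∫⁻ x in closedBall x₀ (δ / n), ‖MvPolynomial.eval (fun i => x i) P‖ₑ ^ p := by
          refine setLIntegral_mono' measurableSet_closedBall fun x hx => ?_
          rw [← ENNReal.ofReal_rpow_of_nonneg (by positivity) hp.le, ← ofReal_norm]
          refine ENNReal.rpow_le_rpow (ENNReal.ofReal_le_ofReal ?_) hp.le
          refine half_le_abs_eval_of_isMax hP hn hx₀ hmax ?_
          rw [mem_closedBall, dist_eq_norm] at hx
          rwa [hδ, div_div] at hx
      _ ≤ _ := by
          refine lintegral_mono_set fun x hx => ?_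
          rw [mem_closedBall, dist_eq_norm] at hx
          have h1 : δ / n ≤ 1 / n := by gcongr
          have h2 := abs_norm_sub_norm_le x x₀
          rw [hx₀] at h2
          have h3 := abs_le.mp (h2.trans (hx.trans h1))
          constructor <;> linarith [h3.1, h3.2]
  have hfac : M ^ p = (2 ^ p * n ^ d / (δ ^ d * V)) * ((M / 2) ^ p * ((δ / n) ^ d * V)) := by
    clear_value δ
    rw [Real.div_rpow hM0 zero_le_two, div_pow]
    field_simp
  rw [hfac, ENNReal.ofReal_mul (by positivity)]
  refine (mul_le_mul_right hlow _).trans_eq ?_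
  rw [← mul_assoc, ← ENNReal.ofReal_mul (by positivity)]
  congr 2
  have : (n : ℝ) ^ d = n ^ (d - 1) * n := by rw [← pow_succ, Nat.sub_add_cancel hd]
  rw [this]
  field_simp

lemma exists_ofReal_max_le_eLpNorm (hd : 1 ≤ d) {p : ℝ≥0∞} (hp : p ≠ 0) :
    ∃ K : ℝ, 0 < K ∧ ∀ (n : ℕ) (P : MvPolynomial (Fin d) ℝ) (x₀ : EuclideanSpace ℝ (Fin d)),
      1 ≤ n → P.IsHomogeneous n → ‖x₀‖ = 1 →
      (∀ x : EuclideanSpace ℝ (Fin d), ‖x‖ = 1 →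
        |MvPolynomial.eval (fun i => x i) P| ≤ |MvPolynomial.eval (fun i => x₀ i) P|) →
      ENNReal.ofReal |MvPolynomial.eval (fun i => x₀ i) P| ≤
        ENNReal.ofReal (K * (n : ℝ) ^ (((d : ℝ) - 1) / p.toReal)) *
          eLpNorm (fun ω : Sph d => MvPolynomial.eval (fun i => (ω : EuclideanSpace ℝ (Fin d)) i) P)
            p (sphMeasure d) := by
  rcases eq_or_ne p ⊤ with rfl | hp'
  · refine ⟨1, one_pos, fun n P x₀ hn hP hx₀ hmax => ?_⟩
    simp only [ENNReal.toReal_top, div_zero, Real.rpow_zero, mul_one, ENNReal.ofReal_one, one_mul,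
      eLpNorm_exponent_top]
    have : NeZero d := ⟨by omega⟩
    set Y := fun ω : Sph d => MvPolynomial.eval (fun i => (ω : EuclideanSpace ℝ (Fin d)) i) P
    have hY : Continuous Y := (continuous_eval_euclidean P).comp continuous_subtype_val
    have hopen : (sphMeasure d).IsOpenPosMeasure := Measure.toSphere.instIsOpenPosMeasure _
    have hae : ∀ᵐ ω ∂sphMeasure d, ‖Y ω‖ₑ ≤ eLpNormEssSup Y (sphMeasure d) :=
      ae_le_eLpNormEssSup
    have hcl : IsClosed {ω | ‖Y ω‖ₑ ≤ eLpNormEssSup Y (sphMeasure d)} :=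
      isClosed_le hY.enorm continuous_const
    have huniv := (Measure.dense_of_ae hae).closure_eq
    rw [hcl.closure_eq] at huniv
    have hx := huniv.symm ▸ Set.mem_univ (⟨x₀, by simpa using hx₀⟩ : Sph d)
    rw [← Real.norm_eq_abs, ofReal_norm]
    exact hx
  · have hp0 : 0 < p.toReal := ENNReal.toReal_pos hp hp'
    obtain ⟨K, hK, h⟩ := exists_ofReal_max_rpow_le hd hp0
    refine ⟨K ^ (1 / p.toReal), by positivity, fun n P x₀ hn hP hx₀ hmax => ?_⟩
    have := ENNReal.rpow_le_rpow (h n P x₀ hn hP hx₀ hmax) (one_div_nonneg.mpr hp0.le)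
    rw [ENNReal.mul_rpow_of_nonneg _ _ (one_div_nonneg.mpr hp0.le),
      ENNReal.ofReal_rpow_of_nonneg (by positivity) (by positivity),
      ENNReal.ofReal_rpow_of_nonneg (by positivity) (by positivity), ← Real.rpow_mul (by positivity),
      mul_one_div_cancel hp0.ne', Real.rpow_one] at this
    rw [eLpNorm_eq_lintegral_rpow_enorm_toReal hp hp']
    convert this using 3
    rw [Real.mul_rpow hK.le (by positivity), ← Real.rpow_natCast, ← Real.rpow_mul (by positivity),
      Nat.cast_sub hd]
    congr 2
    push_cast
    ring

lemma exists_isMax_abs_eval (hd : 1 ≤ d) (P : MvPolynomial (Fin d) ℝ) :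
    ∃ x₀ : EuclideanSpace ℝ (Fin d), ‖x₀‖ = 1 ∧ ∀ x : EuclideanSpace ℝ (Fin d), ‖x‖ = 1 →
      |MvPolynomial.eval (fun i => x i) P| ≤ |MvPolynomial.eval (fun i => x₀ i) P| := by
  have hne : (sphere (0 : EuclideanSpace ℝ (Fin d)) 1).Nonempty :=
    ⟨EuclideanSpace.single ⟨0, hd⟩ 1, by simp⟩
  obtain ⟨x₀, hx₀, h⟩ := (isCompact_sphere (0 : EuclideanSpace ℝ (Fin d)) 1).exists_isMaxOn hne
    (continuous_eval_euclidean P).abs.continuousOn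
  exact ⟨x₀, by simpa using hx₀, fun x hx => h (by simpa using hx)⟩

lemma eLpNorm_le_of_max_le {α : Type*} [MeasurableSpace α] {μ : Measure α} {Y : α → ℝ} {D : ℝ}
    (hD : 0 < D) {p q : ℝ≥0∞} (hp : p ≠ 0) (hpq : p < q)
    (hY : ∀ x, ‖Y x‖ₑ ≤ ENNReal.ofReal D * eLpNorm Y p μ) :
    eLpNorm Y q μ ≤ ENNReal.ofReal (D ^ (1 - p.toReal / q.toReal)) * eLpNorm Y p μ := by
  rcases eq_or_ne q ⊤ with rfl | hq
  · simp only [ENNReal.toReal_top, div_zero, sub_zero, Real.rpow_one, eLpNorm_exponent_top]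
    exact essSup_le_of_ae_le _ (Filter.Eventually.of_forall hY)
  · have hp' : p ≠ ⊤ := (hpq.trans_le le_top).ne
    have hp0 : 0 < p.toReal := ENNReal.toReal_pos hp hp'
    have hpq' : p.toReal < q.toReal := (ENNReal.toReal_lt_toReal hp' hq).mpr hpq
    have hq0 : 0 < q.toReal := hp0.trans hpq'
    have hqne : q ≠ 0 := (bot_le.trans_lt hpq).ne'
    set a := p.toReal with ha
    set b := q.toReal with hb
    set N := eLpNorm Y p μ with hN
    have hNp : N ^ a = ∫⁻ x, ‖Y x‖ₑ ^ a ∂μ := by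
      rw [hN, eLpNorm_eq_lintegral_rpow_enorm_toReal hp hp', ← ENNReal.rpow_mul,
        one_div_mul_cancel hp0.ne', ENNReal.rpow_one]
    have hint : ∫⁻ x, ‖Y x‖ₑ ^ b ∂μ ≤ (ENNReal.ofReal D * N) ^ (b - a) * N ^ a := by
      rcases eq_or_ne ((ENNReal.ofReal D * N) ^ (b - a)) ⊤ with htop | htop
      · have hNt : N = ⊤ := by
          by_contra hne
          exact ENNReal.rpow_ne_top_of_nonneg (sub_nonneg.mpr hpq'.le)
            (ENNReal.mul_ne_top ENNReal.ofReal_ne_top hne) htop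
        rw [htop, hNt, ENNReal.top_rpow_of_pos hp0, ENNReal.top_mul_top]
        exact le_top
      rw [hNp, ← lintegral_const_mul' _ _ htop]
      refine lintegral_mono fun x => ?_
      have : b = (b - a) + a := by ring
      conv_lhs => rw [this, ENNReal.rpow_add_of_nonneg _ _ (by linarith) hp0.le]
      exact mul_le_mul_left (ENNReal.rpow_le_rpow (hY x) (by linarith)) _
    rw [eLpNorm_eq_lintegral_rpow_enorm_toReal hqne hq]
    refine (ENNReal.rpow_le_rpow hint (by positivity)).trans_eq ?_
    rw [ENNReal.mul_rpow_of_nonneg _ N (by linarith), mul_assoc,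
      ← ENNReal.rpow_add_of_nonneg _ _ (by linarith) hp0.le, sub_add_cancel,
      ENNReal.mul_rpow_of_nonneg _ _ (by positivity), ← ENNReal.rpow_mul, ← ENNReal.rpow_mul,
      mul_one_div_cancel hq0.ne', ENNReal.rpow_one, ENNReal.ofReal_rpow_of_pos hD]
    congr 3
    rw [← hb]
    field_simp

end Nikolskii

section ZonalODE

/-- A solution of the Gegenbauer equation in the angular variable decays like
`(n sin θ)^{-m/2}` away from the pole, relative to its maximum. -/
lemma sq_mul_pow_le_of_gegenbauer_ode (m : ℕ) :
    ∃ A : ℝ, 0 < A ∧ ∀ (n : ℕ) (M : ℝ) (u u₁ u₂ : ℝ → ℝ), 1 ≤ n →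
      (∀ θ ∈ Set.Ioo 0 (Real.pi / 2), HasDerivAt u (u₁ θ) θ) →
      (∀ θ ∈ Set.Ioo 0 (Real.pi / 2), HasDerivAt u₁ (u₂ θ) θ) →
      (∀ θ ∈ Set.Ioo 0 (Real.pi / 2),
        u₂ θ + m * (Real.cos θ / Real.sin θ) * u₁ θ + n * (n + m) * u θ = 0) →
      (∀ θ, |u θ| ≤ M) →
      ∀ θ ∈ Set.Ioo 0 (Real.pi / 2), u θ ^ 2 * (1 + n * Real.sin θ) ^ m ≤ A * M ^ 2 := by
  set l : ℝ := m / 2 with hl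
  have hl0 : 0 ≤ l := by positivity
  set K : ℝ := l ^ 2 + l with hK
  set B : ℝ := (4 + 2 * l) ^ 2 + 1 with hB
  have hK0 : 0 ≤ K := by positivity
  have hB1 : 1 ≤ B := by rw [hB]; nlinarith [sq_nonneg (4 + 2 * l)]
  have hE1 : 1 ≤ Real.exp (2 * K) * B :=
    one_le_mul_of_one_le_of_one_le (Real.one_le_exp (by positivity)) hB1
  refine ⟨2 ^ m * (1 + Real.exp (2 * K) * B), by positivity,
    fun n M u u₁ u₂ hn hu hu₁ hode hM θ hθ => ?_⟩
  have hn1 : (1 : ℝ) ≤ n := by exact_mod_cast hn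
  set N : ℝ := n + l with hN
  have hnN : (n : ℝ) ≤ N := by linarith
  have hN1 : 1 ≤ N := by linarith
  have hN0 : 0 < N := by linarith
  have hpi := Real.pi_gt_three
  have hM0 : 0 ≤ M := (abs_nonneg _).trans (hM 0)
  have hu2 : ∀ θ, u θ ^ 2 ≤ M ^ 2 := fun θ => sq_le_sq' (abs_le.mp (hM θ)).1 (abs_le.mp (hM θ)).2
  have hsin : ∀ θ ∈ Set.Ioo 0 (Real.pi / 2), 0 < Real.sin θ := fun θ hθ =>
    Real.sin_pos_of_pos_of_lt_pi hθ.1 (by linarith [hθ.2])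
  have hcos : ∀ θ ∈ Set.Ioo 0 (Real.pi / 2), 0 < Real.cos θ := fun θ hθ =>
    Real.cos_pos_of_mem_Ioo ⟨by linarith [hθ.1], hθ.2⟩
  set w : ℝ → ℝ := fun θ => u₁ θ + l * (Real.cos θ / Real.sin θ) * u θ with hw
  set F : ℝ → ℝ := fun θ => Real.sin θ ^ m * (w θ ^ 2 + N ^ 2 * u θ ^ 2) with hF
  set G : ℝ → ℝ := fun θ => F θ * Real.exp (K / N * (Real.cos θ / Real.sin θ)) with hG
  have hcot : ∀ θ ∈ Set.Ioo 0 (Real.pi / 2),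
      HasDerivAt (fun θ => Real.cos θ / Real.sin θ) (-1 / Real.sin θ ^ 2) θ := by
    intro θ hθ
    have := (Real.hasDerivAt_cos θ).div (Real.hasDerivAt_sin θ) (hsin θ hθ).ne'
    refine this.congr_deriv ?_
    congr 1
    nlinarith [Real.sin_sq_add_cos_sq θ]
  have hwd : ∀ θ ∈ Set.Ioo 0 (Real.pi / 2), HasDerivAt w
      (-(l * (Real.cos θ / Real.sin θ)) * w θ + (l ^ 2 - l) / Real.sin θ ^ 2 * u θ
        - N ^ 2 * u θ) θ := by
    intro θ hθ
    have := (hu₁ θ hθ).add (((hcot θ hθ).const_mul l).mul (hu θ hθ))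
    refine this.congr_deriv ?_
    have h2 : u₂ θ = -(m * (Real.cos θ / Real.sin θ) * u₁ θ + n * (n + m) * u θ) := by
      linarith [hode θ hθ]
    have hm : (m : ℝ) = 2 * l := by rw [hl]; ring
    have hs := (hsin θ hθ).ne'
    have hc2 : Real.cos θ ^ 2 = 1 - Real.sin θ ^ 2 := by linarith [Real.sin_sq_add_cos_sq θ]
    rw [h2, hm, hw, hN]
    field_simp
    ring_nf
    rw [hc2]
    ring
  have hFd : ∀ θ ∈ Set.Ioo 0 (Real.pi / 2), HasDerivAt F
      (Real.sin θ ^ m * (2 * (l ^ 2 - l) * u θ * w θ / Real.sin θ ^ 2)) θ := by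
    intro θ hθ
    have hs := (hsin θ hθ).ne'
    have := ((Real.hasDerivAt_sin θ).pow m).mul
      (((hwd θ hθ).pow 2).add (((hu θ hθ).pow 2).const_mul (N ^ 2)))
    refine this.congr_deriv ?_
    have hpow : (m : ℝ) * Real.sin θ ^ (m - 1) = 2 * l * Real.sin θ ^ m / Real.sin θ := by
      rcases Nat.eq_zero_or_pos m with h | h
      · simp [hl, h]
      · obtain ⟨k, rfl⟩ := Nat.exists_eq_succ_of_ne_zero h.ne'
        rw [hl, Nat.succ_eq_add_one, Nat.add_sub_cancel, pow_succ]
        field_simp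
    have hu1 : u₁ θ = w θ - l * (Real.cos θ / Real.sin θ) * u θ := by rw [hw]; ring
    simp only [Pi.add_apply, Pi.pow_apply]
    rw [hpow, hu1]
    generalize Real.sin θ ^ m = S
    field_simp
    ring
  have hGd : ∀ θ ∈ Set.Ioo 0 (Real.pi / 2), HasDerivAt G
      (Real.sin θ ^ m / Real.sin θ ^ 2 * Real.exp (K / N * (Real.cos θ / Real.sin θ)) *
        (2 * (l ^ 2 - l) * u θ * w θ - K / N * (w θ ^ 2 + N ^ 2 * u θ ^ 2))) θ := by
    intro θ hθ
    have hs := (hsin θ hθ).ne'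
    have := (hFd θ hθ).mul ((hcot θ hθ).const_mul (K / N)).exp
    refine this.congr_deriv ?_
    simp only [hF]
    field_simp
    ring
  have hanti : AntitoneOn G (Set.Ioo 0 (Real.pi / 2)) := by
    refine antitoneOn_of_deriv_nonpos (convex_Ioo _ _)
      (fun θ hθ => (hGd θ hθ).continuousAt.continuousWithinAt)
      (fun θ hθ => (hGd θ (interior_subset hθ)).differentiableAt.differentiableWithinAt)
      fun θ hθ => ?_
    have hθ := interior_subset hθ
    have hs := hsin θ hθ
    rw [(hGd θ hθ).deriv]
    refine mul_nonpos_of_nonneg_of_nonpos (by positivity) ?_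
    have hq : K / N * (w θ ^ 2 + N ^ 2 * u θ ^ 2) =
        K / N * (|w θ| - N * |u θ|) ^ 2 + 2 * K * (|u θ| * |w θ|) := by
      rw [sub_sq, mul_pow, sq_abs, sq_abs]
      field_simp
      ring
    have habs : 2 * (l ^ 2 - l) * u θ * w θ ≤ 2 * K * (|u θ| * |w θ|) := by
      calc 2 * (l ^ 2 - l) * u θ * w θ ≤ |2 * (l ^ 2 - l) * u θ * w θ| := le_abs_self _
        _ = 2 * |l ^ 2 - l| * (|u θ| * |w θ|) := by
          rw [abs_mul, abs_mul, abs_mul, abs_two]; ring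
        _ ≤ 2 * K * (|u θ| * |w θ|) := by
          have : |l ^ 2 - l| ≤ K := by
            rw [abs_le, hK]; constructor <;> nlinarith [sq_nonneg l]
          gcongr
    have : 0 ≤ K / N * (|w θ| - N * |u θ|) ^ 2 := by positivity
    rw [hq]; linarith
  -- Choose a starting point `ξ ∼ 1 / N` with a good bound for the derivative.
  have hsub : ∀ θ, 1 / (2 * N) ≤ θ → θ ≤ 1 / N → θ ∈ Set.Ioo 0 (Real.pi / 2) := by
    intro θ h1 h2
    have : 1 / N ≤ 1 := by rw [div_le_one hN0]; exact hN1
    have : 0 < 1 / (2 * N) := by positivity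
    constructor <;> linarith
  have hlt : 1 / (2 * N) < 1 / N := one_div_lt_one_div_of_lt hN0 (by linarith)
  obtain ⟨ξ, hξ, hslope⟩ := exists_hasDerivAt_eq_slope u u₁ hlt
    (fun θ hθ => (hu θ (hsub θ hθ.1 hθ.2)).continuousAt.continuousWithinAt)
    fun θ hθ => hu θ (hsub θ hθ.1.le hθ.2.le)
  have hξ' := hsub ξ hξ.1.le hξ.2.le
  have hu1ξ : |u₁ ξ| ≤ 4 * N * M := by
    have hd : 1 / N - 1 / (2 * N) = 1 / (2 * N) := by field_simp; norm_num
    rw [hslope, hd, abs_div, abs_of_pos (show 0 < 1 / (2 * N) by positivity),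
      div_le_iff₀ (by positivity)]
    have h1 := abs_sub (u (1 / N)) (u (1 / (2 * N)))
    have h2 := hM (1 / N)
    have h3 := hM (1 / (2 * N))
    have h4 : 4 * N * M * (1 / (2 * N)) = 2 * M := by field_simp; ring
    rw [h4]; linarith
  have hcotξ : Real.cos ξ / Real.sin ξ ≤ 2 * N := by
    have h1 : ξ < Real.tan ξ := Real.lt_tan hξ'.1 hξ'.2
    rw [Real.tan_eq_sin_div_cos, lt_div_iff₀ (hcos ξ hξ')] at h1
    rw [div_le_iff₀ (hsin ξ hξ')]
    have h2 : 1 ≤ 2 * N * ξ := by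
      have := mul_le_mul_of_nonneg_left hξ.1.le (show 0 ≤ 2 * N by positivity)
      rwa [mul_one_div_cancel (by positivity)] at this
    calc Real.cos ξ = 1 * Real.cos ξ := by ring
      _ ≤ 2 * N * ξ * Real.cos ξ := by gcongr; exact (hcos ξ hξ').le
      _ = 2 * N * (ξ * Real.cos ξ) := by ring
      _ ≤ 2 * N * Real.sin ξ := by gcongr
  have hcotξ0 : 0 ≤ Real.cos ξ / Real.sin ξ := (div_pos (hcos ξ hξ') (hsin ξ hξ')).le
  have hwξ : |w ξ| ≤ (4 + 2 * l) * (N * M) := by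
    calc |w ξ| ≤ |u₁ ξ| + |l * (Real.cos ξ / Real.sin ξ) * u ξ| := abs_add_le _ _
      _ = |u₁ ξ| + l * (Real.cos ξ / Real.sin ξ) * |u ξ| := by
        rw [abs_mul, abs_of_nonneg (mul_nonneg hl0 hcotξ0)]
      _ ≤ 4 * N * M + l * (2 * N) * M := by
        gcongr
        exact hM ξ
      _ = _ := by ring
  have hFξ : N ^ m * F ξ ≤ B * (N ^ 2 * M ^ 2) := by
    have h1 : w ξ ^ 2 ≤ ((4 + 2 * l) * (N * M)) ^ 2 :=
      sq_le_sq' (abs_le.mp hwξ).1 (abs_le.mp hwξ).2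
    have h2 : N * Real.sin ξ ≤ 1 := by
      have h3 : Real.sin ξ ≤ 1 / N := (Real.sin_le hξ'.1.le).trans hξ.2.le
      rw [le_div_iff₀ hN0] at h3
      linarith
    calc N ^ m * F ξ = (N * Real.sin ξ) ^ m * (w ξ ^ 2 + N ^ 2 * u ξ ^ 2) := by
          rw [hF, mul_pow]; ring
      _ ≤ 1 * (((4 + 2 * l) * (N * M)) ^ 2 + N ^ 2 * M ^ 2) := by
          refine mul_le_mul (pow_le_one₀ ?_ h2) ?_ (by positivity) zero_le_one
          · have := (hsin ξ hξ').le
            positivity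
          · have := hu2 ξ
            gcongr
      _ = _ := by rw [hB]; ring
  have hmain : (N * Real.sin θ) ^ m * u θ ^ 2 ≤ Real.exp (2 * K) * B * M ^ 2 := by
    have hsθ := hsin θ hθ
    rcases le_total ξ θ with h | h
    · have hcotθ : 0 ≤ Real.cos θ / Real.sin θ := (div_pos (hcos θ hθ) hsθ).le
      have hF0 : ∀ θ ∈ Set.Ioo 0 (Real.pi / 2), 0 ≤ F θ := fun θ hθ => by
        have := hsin θ hθ
        rw [hF]; positivity
      have h1 : F θ ≤ G θ := by
        rw [hG]
        exact le_mul_of_one_le_right (hF0 θ hθ) (Real.one_le_exp (by positivity))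
      have h2 : G ξ ≤ F ξ * Real.exp (2 * K) := by
        rw [hG]
        refine mul_le_mul_of_nonneg_left (Real.exp_le_exp.mpr ?_) (hF0 ξ hξ')
        calc K / N * (Real.cos ξ / Real.sin ξ) ≤ K / N * (2 * N) := by gcongr
          _ = 2 * K := by field_simp
      have h3 : F θ ≤ F ξ * Real.exp (2 * K) := (h1.trans (hanti hξ' hθ h)).trans h2
      have h4 : Real.sin θ ^ m * (N ^ 2 * u θ ^ 2) ≤ F θ := by
        rw [hF]
        refine mul_le_mul_of_nonneg_left ?_ (by positivity)
        linarith [sq_nonneg (w θ)]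
      have h5 : N ^ 2 * ((N * Real.sin θ) ^ m * u θ ^ 2) ≤
          N ^ 2 * (Real.exp (2 * K) * B * M ^ 2) := by
        calc N ^ 2 * ((N * Real.sin θ) ^ m * u θ ^ 2)
            = N ^ m * (Real.sin θ ^ m * (N ^ 2 * u θ ^ 2)) := by rw [mul_pow]; ring
          _ ≤ N ^ m * (F ξ * Real.exp (2 * K)) :=
            mul_le_mul_of_nonneg_left (h4.trans h3) (by positivity)
          _ = (N ^ m * F ξ) * Real.exp (2 * K) := by ring
          _ ≤ B * (N ^ 2 * M ^ 2) * Real.exp (2 * K) := by gcongr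
          _ = _ := by ring
      exact le_of_mul_le_mul_left h5 (by positivity)
    · have h2 : N * Real.sin θ ≤ 1 := by
        have h3 : Real.sin θ ≤ 1 / N := (Real.sin_le hθ.1.le).trans (h.trans hξ.2.le)
        rw [le_div_iff₀ hN0] at h3
        linarith
      calc (N * Real.sin θ) ^ m * u θ ^ 2 ≤ 1 * M ^ 2 :=
            mul_le_mul (pow_le_one₀ (by positivity) h2) (hu2 θ) (sq_nonneg _) zero_le_one
        _ ≤ _ := by gcongr
  have hsθ := hsin θ hθ
  calc u θ ^ 2 * (1 + n * Real.sin θ) ^ m ≤ u θ ^ 2 * (1 + N * Real.sin θ) ^ m := by gcongr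
    _ ≤ u θ ^ 2 * (2 ^ m * (1 + (N * Real.sin θ) ^ m)) := by
      refine mul_le_mul_of_nonneg_left ?_ (sq_nonneg _)
      refine (add_pow_le zero_le_one (by positivity) m).trans ?_
      rw [one_pow]
      gcongr
      · norm_num
      · omega
    _ = 2 ^ m * (u θ ^ 2 + (N * Real.sin θ) ^ m * u θ ^ 2) := by ring
    _ ≤ 2 ^ m * (M ^ 2 + Real.exp (2 * K) * B * M ^ 2) :=
      mul_le_mul_of_nonneg_left (add_le_add (hu2 θ) hmain) (by positivity)
    _ = _ := by ring

end ZonalODE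

section Zonal

open MvPolynomial in
/-- The sum of squares of all coordinates but the first. -/
def tailSq (m : ℕ) : MvPolynomial (Fin (m + 2)) ℝ := ∑ j : Fin (m + 1), X j.succ ^ 2

lemma pderiv_zero_tailSq (m : ℕ) : MvPolynomial.pderiv 0 (tailSq m) = 0 := by
  simp [tailSq, MvPolynomial.pderiv_X, Fin.succ_ne_zero]

lemma pderiv_succ_tailSq (m : ℕ) (j : Fin (m + 1)) :
    MvPolynomial.pderiv j.succ (tailSq m) = 2 * MvPolynomial.X j.succ := by
  simp [tailSq, MvPolynomial.pderiv_X, Pi.single_apply, Fin.succ_inj]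

lemma laplacian_X_pow_mul_tailSq_pow (m a k : ℕ) :
    ∑ i : Fin (m + 2), MvPolynomial.pderiv i (MvPolynomial.pderiv i
      (MvPolynomial.X 0 ^ a * tailSq m ^ k)) =
    (2 * (k : ℝ) * (2 * k + m - 1)) • (MvPolynomial.X 0 ^ a * tailSq m ^ (k - 1)) +
    ((a : ℝ) * (a - 1)) • (MvPolynomial.X 0 ^ (a - 2) * tailSq m ^ k) := by
  have h0 : MvPolynomial.pderiv 0 (MvPolynomial.pderiv 0
      (MvPolynomial.X 0 ^ a * tailSq m ^ k)) =
      ((a : ℝ) * (a - 1)) • (MvPolynomial.X 0 ^ (a - 2) * tailSq m ^ k) := by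
    simp only [Derivation.leibniz, Derivation.leibniz_pow, pderiv_zero_tailSq,
      MvPolynomial.pderiv_X_self, smul_zero, zero_add, smul_eq_mul, nsmul_eq_mul, mul_one,
      mul_zero, add_zero, Derivation.map_natCast]
    rcases a with _ | _ | a
    · simp
    · simp
    · rw [show ((a + 1 + 1 : ℕ) : ℝ) * ((a + 1 + 1 : ℕ) - 1) = ((a + 1 + 1) * (a + 1) : ℕ) by
        push_cast; ring, MvPolynomial.smul_eq_C_mul, map_natCast]
      push_cast
      simp only [add_assoc]
      ring
  have h1 : ∀ j : Fin (m + 1), MvPolynomial.pderiv j.succ (MvPolynomial.pderiv j.succ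
      (MvPolynomial.X 0 ^ a * tailSq m ^ k)) =
      MvPolynomial.X 0 ^ a * (4 * ((k : MvPolynomial (Fin (m + 2)) ℝ) * ((k - 1 : ℕ) : MvPolynomial (Fin (m + 2)) ℝ)) *
        tailSq m ^ (k - 2) * MvPolynomial.X j.succ ^ 2 +
        2 * (k : MvPolynomial (Fin (m + 2)) ℝ) * tailSq m ^ (k - 1)) := by
    intro j
    have h2 : MvPolynomial.pderiv j.succ (MvPolynomial.X 0 : MvPolynomial (Fin (m + 2)) ℝ) = 0 :=
      MvPolynomial.pderiv_X_of_ne (Fin.succ_ne_zero j).symm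
    have h3 : MvPolynomial.pderiv j.succ (2 : MvPolynomial (Fin (m + 2)) ℝ) = 0 := by
      simpa using (MvPolynomial.pderiv j.succ).map_natCast 2
    simp only [Derivation.leibniz, Derivation.leibniz_pow, pderiv_succ_tailSq, h2, h3,
      MvPolynomial.pderiv_X_self, smul_zero, smul_eq_mul, nsmul_eq_mul, mul_one,
      mul_zero, add_zero, Derivation.map_natCast, Nat.sub_sub, Nat.reduceAdd]
    ring
  rw [Fin.sum_univ_succ, h0, Finset.sum_congr rfl fun j _ => h1 j,
    add_comm (_ • _ : MvPolynomial (Fin (m + 2)) ℝ)]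
  congr 1
  rw [← Finset.mul_sum, Finset.sum_add_distrib, ← Finset.mul_sum]
  change _ * (_ * tailSq m + _) = _
  simp only [Finset.sum_const, Finset.card_univ, Fintype.card_fin, nsmul_eq_mul,
    MvPolynomial.smul_eq_C_mul]
  rcases k with _ | k
  · simp
  · rw [show 2 * ((k + 1 : ℕ) : ℝ) * (2 * (k + 1 : ℕ) + m - 1) =
        (2 * (k + 1) * (2 * k + m + 1) : ℕ) by
        push_cast; ring, map_natCast]
    rcases k with _ | k
    · simp
      ring
    · push_cast
      simp only [add_assoc]
      ring

/-- Coefficients of the zonal harmonic of degree `n` in `m + 2` variables. -/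
def zonalCoeff (m n : ℕ) : ℕ → ℝ
  | 0 => 1
  | k + 1 => -zonalCoeff m n k * ((n - 2 * k) * (n - 2 * k - 1)) /
      (2 * ((k + 1 : ℕ) : ℝ) * (2 * ((k + 1 : ℕ) : ℝ) + m - 1))

lemma zonalCoeff_succ_mul (m n k : ℕ) :
    zonalCoeff m n (k + 1) * (2 * ((k + 1 : ℕ) : ℝ) * (2 * ((k + 1 : ℕ) : ℝ) + m - 1)) =
      -(zonalCoeff m n k * ((n - 2 * k) * (n - 2 * k - 1))) := by
  have h : 2 * ((k + 1 : ℕ) : ℝ) * (2 * ((k + 1 : ℕ) : ℝ) + m - 1) ≠ 0 := by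
    push_cast
    have h1 : (0 : ℝ) ≤ k := k.cast_nonneg
    have h2 : (0 : ℝ) ≤ m := m.cast_nonneg
    apply ne_of_gt
    apply mul_pos <;> linarith
  rw [zonalCoeff, div_mul_cancel₀ _ h, neg_mul]

lemma sum_zonalCoeff_smul_eq_zero {V : Type*} [AddCommGroup V] [Module ℝ V] (m n : ℕ)
    (Z : ℕ → V) :
    ∑ k ∈ Finset.range (n / 2 + 1),
      ((zonalCoeff m n k * (2 * k * (2 * k + m - 1))) • Z k +
        (zonalCoeff m n k * ((n - 2 * k) * (n - 2 * k - 1))) • Z (k + 1)) = 0 := by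
  have h : ∀ k ∈ Finset.range (n / 2 + 1),
      (zonalCoeff m n k * (2 * k * (2 * k + m - 1))) • Z k +
        (zonalCoeff m n k * ((n - 2 * k) * (n - 2 * k - 1))) • Z (k + 1) =
      (fun k : ℕ => (zonalCoeff m n k * (2 * k * (2 * k + m - 1))) • Z k) k -
      (fun k : ℕ => (zonalCoeff m n k * (2 * k * (2 * k + m - 1))) • Z k) (k + 1) := by
    intro k _
    simp only [zonalCoeff_succ_mul, neg_smul, sub_neg_eq_add]
  rw [Finset.sum_congr rfl h, Finset.sum_range_sub', zonalCoeff_succ_mul]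
  have h2 : ((n : ℝ) - 2 * (n / 2 : ℕ)) * (n - 2 * (n / 2 : ℕ) - 1) = 0 := by
    have h3 : (n : ℝ) = 2 * (n / 2 : ℕ) + (n % 2 : ℕ) := by
      exact_mod_cast (Nat.div_add_mod n 2).symm
    rcases Nat.mod_two_eq_zero_or_one n with h4 | h4
    · rw [h4] at h3
      rw [sub_eq_zero.mpr (by simpa using h3), zero_mul]
    · rw [h4] at h3
      rw [mul_eq_zero]
      right
      push_cast at h3
      linarith
  rw [h2]
  simp

/-- The zonal harmonic of degree `n` with pole at the first basis vector. -/
def zonal (m n : ℕ) : MvPolynomial (Fin (m + 2)) ℝ :=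
  ∑ k ∈ Finset.range (n / 2 + 1),
    zonalCoeff m n k • (MvPolynomial.X 0 ^ (n - 2 * k) * tailSq m ^ k)

lemma two_mul_le_of_mem_range {n k : ℕ} (hk : k ∈ Finset.range (n / 2 + 1)) : 2 * k ≤ n := by
  have := Finset.mem_range.mp hk
  omega

lemma isHomogeneous_zonal (m n : ℕ) : (zonal m n).IsHomogeneous n := by
  refine MvPolynomial.IsHomogeneous.sum _ _ _ fun k hk => ?_
  have hk := two_mul_le_of_mem_range hk
  have h1 : (tailSq m).IsHomogeneous 2 :=
    MvPolynomial.IsHomogeneous.sum _ _ _ fun j _ => by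
      simpa using (MvPolynomial.isHomogeneous_X ℝ j.succ).pow 2
  have h2 := ((MvPolynomial.isHomogeneous_X ℝ (0 : Fin (m + 2))).pow (n - 2 * k)).mul (h1.pow k)
  rw [MvPolynomial.smul_eq_C_mul]
  have h3 := (MvPolynomial.isHomogeneous_C (Fin (m + 2)) (zonalCoeff m n k)).mul h2
  convert h3 using 1
  omega

lemma laplacian_zonal (m n : ℕ) :
    ∑ i : Fin (m + 2), MvPolynomial.pderiv i (MvPolynomial.pderiv i (zonal m n)) = 0 := by
  simp only [zonal, map_sum, Derivation.map_smul]
  rw [Finset.sum_comm, ← sum_zonalCoeff_smul_eq_zero m n fun k =>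
    (MvPolynomial.X 0 ^ (n - 2 * k) * tailSq m ^ (k - 1) : MvPolynomial (Fin (m + 2)) ℝ)]
  refine Finset.sum_congr rfl fun k hk => ?_
  rw [← Finset.smul_sum, laplacian_X_pow_mul_tailSq_pow, smul_add, smul_smul, smul_smul,
    Nat.cast_sub (two_mul_le_of_mem_range hk), Nat.add_sub_cancel, mul_add, Nat.sub_sub]
  push_cast
  rfl

lemma eval_zonal (m n : ℕ) (x : Fin (m + 2) → ℝ) :
    MvPolynomial.eval x (zonal m n) = ∑ k ∈ Finset.range (n / 2 + 1),
      zonalCoeff m n k * (x 0 ^ (n - 2 * k) * (∑ j : Fin (m + 1), x j.succ ^ 2) ^ k) := by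
  simp [zonal, tailSq, MvPolynomial.smul_eval]

lemma natCast_mul_pow_pred {x : ℝ} (hx : x ≠ 0) (a : ℕ) :
    (a : ℝ) * x ^ (a - 1) = a * x ^ a / x := by
  rcases a with _ | a
  · simp
  · rw [Nat.add_sub_cancel, pow_succ]
    field_simp

lemma hasDerivAt_cos_pow_mul_sin_pow (a b : ℕ) {θ : ℝ} (hc : Real.cos θ ≠ 0)
    (hs : Real.sin θ ≠ 0) :
    HasDerivAt (fun θ => Real.cos θ ^ a * Real.sin θ ^ b)
      (Real.cos θ ^ a * Real.sin θ ^ b *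
        (b * (Real.cos θ / Real.sin θ) - a * (Real.sin θ / Real.cos θ))) θ := by
  have := ((Real.hasDerivAt_cos θ).pow a).mul ((Real.hasDerivAt_sin θ).pow b)
  refine this.congr_deriv ?_
  rw [natCast_mul_pow_pred hc, natCast_mul_pow_pred hs]
  simp only [Pi.pow_apply]
  field_simp
  ring

lemma hasDerivAt_cos_pow_mul_sin_pow_mul (a b : ℕ) {θ : ℝ} (hc : Real.cos θ ≠ 0)
    (hs : Real.sin θ ≠ 0) :
    HasDerivAt (fun θ => Real.cos θ ^ a * Real.sin θ ^ b *
        (b * (Real.cos θ / Real.sin θ) - a * (Real.sin θ / Real.cos θ)))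
      (Real.cos θ ^ a * Real.sin θ ^ b *
        ((b * (Real.cos θ / Real.sin θ) - a * (Real.sin θ / Real.cos θ)) ^ 2
          - b / Real.sin θ ^ 2 - a / Real.cos θ ^ 2)) θ := by
  have h1 := ((Real.hasDerivAt_cos θ).div (Real.hasDerivAt_sin θ) hs).const_mul (b : ℝ)
  have h2 := ((Real.hasDerivAt_sin θ).div (Real.hasDerivAt_cos θ) hc).const_mul (a : ℝ)
  refine ((hasDerivAt_cos_pow_mul_sin_pow a b hc hs).mul (h1.sub h2)).congr_deriv ?_
  have h3 : -Real.sin θ * Real.sin θ - Real.cos θ * Real.cos θ = -1 := by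
    linarith [Real.sin_sq_add_cos_sq θ]
  have h4 : Real.cos θ * Real.cos θ - Real.sin θ * -Real.sin θ = 1 := by
    linarith [Real.sin_sq_add_cos_sq θ]
  rw [h3, h4]
  simp only [Pi.sub_apply, Pi.div_apply]
  ring

lemma gegenbauer_term (m n k : ℕ) (hk : 2 * k ≤ n) {θ : ℝ} (hc : Real.cos θ ≠ 0)
    (hs : Real.sin θ ≠ 0) (t g : ℝ)
    (hg : g = (2 * k : ℕ) * (Real.cos θ / Real.sin θ) -
      (n - 2 * k : ℕ) * (Real.sin θ / Real.cos θ)) :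
    t * (g ^ 2 - (2 * k : ℕ) / Real.sin θ ^ 2 - (n - 2 * k : ℕ) / Real.cos θ ^ 2) +
      m * (Real.cos θ / Real.sin θ) * (t * g) + n * (n + m) * t =
    (2 * k * (2 * k + m - 1)) * (t / Real.sin θ ^ 2) +
      ((n - 2 * k) * (n - 2 * k - 1)) * (t / Real.cos θ ^ 2) := by
  obtain ⟨a, rfl⟩ := Nat.exists_eq_add_of_le hk
  rw [Nat.add_sub_cancel_left] at *
  have h1 : (Real.cos θ / Real.sin θ) ^ 2 = 1 / Real.sin θ ^ 2 - 1 := by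
    field_simp
    linarith [Real.sin_sq_add_cos_sq θ]
  have h2 : (Real.sin θ / Real.cos θ) ^ 2 = 1 / Real.cos θ ^ 2 - 1 := by
    field_simp
    linarith [Real.sin_sq_add_cos_sq θ]
  have h3 : Real.cos θ / Real.sin θ * (Real.sin θ / Real.cos θ) = 1 := by
    field_simp
  rw [hg]
  generalize Real.cos θ / Real.sin θ = x at *
  generalize Real.sin θ / Real.cos θ = y at *
  rw [div_eq_mul_one_div _ (Real.sin θ ^ 2), div_eq_mul_one_div _ (Real.cos θ ^ 2),
    div_eq_mul_one_div t (Real.sin θ ^ 2), div_eq_mul_one_div t (Real.cos θ ^ 2)]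
  have h1' : 1 / Real.sin θ ^ 2 = x ^ 2 + 1 := by linarith
  have h2' : 1 / Real.cos θ ^ 2 = y ^ 2 + 1 := by linarith
  rw [h1', h2']
  push_cast
  linear_combination (-t * (2 * (2 * k) * a + m * a)) * h3

/-- The zonal harmonic of degree `n` as a function of the angle to the pole. -/
def zonalAngle (m n : ℕ) (θ : ℝ) : ℝ := ∑ k ∈ Finset.range (n / 2 + 1),
  zonalCoeff m n k * (Real.cos θ ^ (n - 2 * k) * Real.sin θ ^ (2 * k))

lemma continuous_zonalAngle (m n : ℕ) : Continuous (zonalAngle m n) := by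
  unfold zonalAngle
  fun_prop

lemma exists_gegenbauer_ode_zonalAngle (m n : ℕ) : ∃ u₁ u₂ : ℝ → ℝ,
    (∀ θ ∈ Set.Ioo 0 (Real.pi / 2), HasDerivAt (zonalAngle m n) (u₁ θ) θ) ∧
    (∀ θ ∈ Set.Ioo 0 (Real.pi / 2), HasDerivAt u₁ (u₂ θ) θ) ∧
    ∀ θ ∈ Set.Ioo 0 (Real.pi / 2),
      u₂ θ + m * (Real.cos θ / Real.sin θ) * u₁ θ + n * (n + m) * zonalAngle m n θ = 0 := by
  have hsin : ∀ θ ∈ Set.Ioo 0 (Real.pi / 2), Real.sin θ ≠ 0 := fun θ hθ =>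
    (Real.sin_pos_of_pos_of_lt_pi hθ.1 (by linarith [hθ.2, Real.pi_pos])).ne'
  have hcos : ∀ θ ∈ Set.Ioo 0 (Real.pi / 2), Real.cos θ ≠ 0 := fun θ hθ =>
    (Real.cos_pos_of_mem_Ioo ⟨by linarith [hθ.1, Real.pi_pos], hθ.2⟩).ne'
  refine ⟨_, _, fun θ hθ => HasDerivAt.fun_sum fun k _ =>
      (hasDerivAt_cos_pow_mul_sin_pow (n - 2 * k) (2 * k) (hcos θ hθ) (hsin θ hθ)).const_mul
        (zonalCoeff m n k),
    fun θ hθ => HasDerivAt.fun_sum fun k _ =>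
      (hasDerivAt_cos_pow_mul_sin_pow_mul (n - 2 * k) (2 * k) (hcos θ hθ) (hsin θ hθ)).const_mul
        (zonalCoeff m n k), fun θ hθ => ?_⟩
  have hs := hsin θ hθ
  have hc := hcos θ hθ
  rw [zonalAngle, Finset.mul_sum, Finset.mul_sum, ← Finset.sum_add_distrib,
    ← Finset.sum_add_distrib, ← sum_zonalCoeff_smul_eq_zero m n fun k =>
      Real.cos θ ^ (n - 2 * k) * Real.sin θ ^ (2 * k) / Real.sin θ ^ 2]
  refine Finset.sum_congr rfl fun k hk => ?_
  have hk := two_mul_le_of_mem_range hk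
  have h1 := gegenbauer_term m n k hk hc hs
    (Real.cos θ ^ (n - 2 * k) * Real.sin θ ^ (2 * k)) _ rfl
  have h2 : ((n : ℝ) - 2 * k) * (n - 2 * k - 1) *
      (Real.cos θ ^ (n - 2 * k) * Real.sin θ ^ (2 * k) / Real.cos θ ^ 2) =
      ((n : ℝ) - 2 * k) * (n - 2 * k - 1) *
      (Real.cos θ ^ (n - 2 * (k + 1)) * Real.sin θ ^ (2 * (k + 1)) / Real.sin θ ^ 2) := by
    obtain ⟨a, rfl⟩ := Nat.exists_eq_add_of_le hk
    rcases a with _ | _ | a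
    · simp
    · simp
    · rw [show 2 * k + (a + 1 + 1) - 2 * k = a + 2 by omega,
        show 2 * k + (a + 1 + 1) - 2 * (k + 1) = a by omega, mul_add 2 k 1, pow_add, pow_add]
      field_simp
  rw [h2] at h1
  simp only [smul_eq_mul]
  linear_combination (zonalCoeff m n k) * h1

lemma zonalAngle_arccos_eq (m n : ℕ) {x : EuclideanSpace ℝ (Fin (m + 2))} (hx : ‖x‖ = 1) :
    MvPolynomial.eval (fun i => x i) (zonal m n) = zonalAngle m n (Real.arccos (x 0)) := by
  have h1 : x 0 ^ 2 + ∑ j : Fin (m + 1), x j.succ ^ 2 = 1 := by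
    have := EuclideanSpace.real_norm_sq_eq x
    rw [hx, Fin.sum_univ_succ] at this
    linarith
  have h2 : 0 ≤ ∑ j : Fin (m + 1), x j.succ ^ 2 := Finset.sum_nonneg fun j _ => sq_nonneg _
  have h3 : |x 0| ≤ 1 := by rw [← sq_le_one_iff_abs_le_one]; linarith
  rw [eval_zonal, zonalAngle, Real.cos_arccos (abs_le.mp h3).1 (abs_le.mp h3).2]
  refine Finset.sum_congr rfl fun k _ => ?_
  rw [pow_mul, Real.sin_arccos, Real.sq_sqrt (by linarith)]
  congr 3
  linarith

lemma exists_eval_zonal_eq_zonalAngle (m n : ℕ) (θ : ℝ) :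
    ∃ x : EuclideanSpace ℝ (Fin (m + 2)), ‖x‖ = 1 ∧
      MvPolynomial.eval (fun i => x i) (zonal m n) = zonalAngle m n θ := by
  have hs : ∑ j : Fin (m + 1), (Pi.single 0 (Real.sin θ) : Fin (m + 1) → ℝ) j ^ 2 =
      Real.sin θ ^ 2 := by
    rw [Fin.sum_univ_succ]
    simp
  refine ⟨WithLp.toLp 2 (Fin.cons (Real.cos θ) (Pi.single 0 (Real.sin θ))), ?_, ?_⟩
  · rw [← sq_eq_sq₀ (norm_nonneg _) zero_le_one, EuclideanSpace.real_norm_sq_eq,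
      Fin.sum_univ_succ]
    simp only [Fin.cons_zero, Fin.cons_succ, hs]
    linarith [Real.sin_sq_add_cos_sq θ]
  · rw [eval_zonal]
    simp only [Fin.cons_zero, Fin.cons_succ, hs, zonalAngle, ← pow_mul]

lemma zonalAngle_zero (m n : ℕ) : zonalAngle m n 0 = 1 := by
  rw [zonalAngle, Finset.sum_range_succ']
  simp [zonalCoeff]

/-- Decay of zonal harmonics away from the poles. -/
lemma sq_eval_zonal_mul_le (m : ℕ) :
    ∃ A : ℝ, 0 < A ∧ ∀ (n : ℕ) (M : ℝ), 1 ≤ n →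
      (∀ x : EuclideanSpace ℝ (Fin (m + 2)), ‖x‖ = 1 →
        |MvPolynomial.eval (fun i => x i) (zonal m n)| ≤ M) →
      ∀ x : EuclideanSpace ℝ (Fin (m + 2)), ‖x‖ = 1 →
        MvPolynomial.eval (fun i => x i) (zonal m n) ^ 2 *
          (1 + n * ‖fun j : Fin (m + 1) => x j.succ‖) ^ m ≤ A * M ^ 2 := by
  obtain ⟨A, hA, h⟩ := sq_mul_pow_le_of_gegenbauer_ode m
  refine ⟨A, hA, fun n M hn hM => ?_⟩
  obtain ⟨u₁, u₂, hu, hu₁, hode⟩ := exists_gegenbauer_ode_zonalAngle m n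
  have hMu : ∀ θ, |zonalAngle m n θ| ≤ M := fun θ => by
    obtain ⟨x, hx, hx'⟩ := exists_eval_zonal_eq_zonalAngle m n θ
    exact hx' ▸ hM x hx
  have hIoo := h n M _ u₁ u₂ hn hu hu₁ hode hMu
  have hIcc : ∀ θ ∈ Set.Icc 0 (Real.pi / 2),
      zonalAngle m n θ ^ 2 * (1 + n * Real.sin θ) ^ m ≤ A * M ^ 2 := by
    have hc : Continuous fun θ => zonalAngle m n θ ^ 2 * (1 + n * Real.sin θ) ^ m := by
      have := continuous_zonalAngle m n
      fun_prop
    rw [← closure_Ioo (by positivity)]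
    exact fun θ hθ => closure_minimal hIoo (isClosed_le hc continuous_const) hθ
  have hpos : ∀ x : EuclideanSpace ℝ (Fin (m + 2)), ‖x‖ = 1 → 0 ≤ x 0 →
      MvPolynomial.eval (fun i => x i) (zonal m n) ^ 2 *
          (1 + n * ‖fun j : Fin (m + 1) => x j.succ‖) ^ m ≤ A * M ^ 2 := by
    intro x hx hx0
    rw [zonalAngle_arccos_eq m n hx]
    refine le_trans ?_ (hIcc (Real.arccos (x 0)) ⟨Real.arccos_nonneg _,
      Real.arccos_le_pi_div_two.mpr hx0⟩)
    have h1 : x 0 ^ 2 + ∑ j : Fin (m + 1), x j.succ ^ 2 = 1 := by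
      have := EuclideanSpace.real_norm_sq_eq x
      rw [hx, Fin.sum_univ_succ] at this
      linarith
    have h2 : ‖fun j : Fin (m + 1) => x j.succ‖ ≤ Real.sin (Real.arccos (x 0)) := by
      rw [Real.sin_arccos, pi_norm_le_iff_of_nonneg (Real.sqrt_nonneg _)]
      intro j
      refine Real.le_sqrt_of_sq_le ?_
      rw [Real.norm_eq_abs, sq_abs, show 1 - x 0 ^ 2 = ∑ j : Fin (m + 1), x j.succ ^ 2 by linarith]
      exact Finset.single_le_sum (f := fun j : Fin (m + 1) => x j.succ ^ 2)
        (fun j _ => sq_nonneg _) (Finset.mem_univ j)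
    gcongr
  intro x hx
  rcases le_total 0 (x 0) with hx0 | hx0
  · exact hpos x hx hx0
  · have h1 := hpos (-x) (by rwa [norm_neg]) (by simpa using hx0)
    have h2 := (isHomogeneous_zonal m n).eval_smul_euclidean (-1) x
    rw [neg_one_smul] at h2
    rw [h2, mul_pow, ← pow_mul, mul_comm n 2, pow_mul, neg_one_sq, one_pow, one_mul] at h1
    have h3 : ‖fun j : Fin (m + 1) => (-x) j.succ‖ = ‖fun j : Fin (m + 1) => x j.succ‖ :=
      norm_neg (fun j : Fin (m + 1) => x j.succ)
    rwa [h3] at h1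

end Zonal

section SphereIntegral

lemma lintegral_one_add_mul_norm_rpow (k : ℕ) {n : ℝ} (hn : 0 < n) (r : ℝ) :
    ∫⁻ y : Fin k → ℝ, ENNReal.ofReal ((1 + n * ‖y‖) ^ (-r)) =
      ENNReal.ofReal ((n ^ k)⁻¹) * ∫⁻ y : Fin k → ℝ, ENNReal.ofReal ((1 + ‖y‖) ^ (-r)) := by
  have hmeas : Measurable fun y : Fin k → ℝ => ENNReal.ofReal ((1 + ‖y‖) ^ (-r)) := by
    fun_prop
  have h1 := lintegral_map (μ := (volume : Measure (Fin k → ℝ))) hmeas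
    (measurable_const_smul n)
  rw [show (volume : Measure (Fin k → ℝ)).map (n • ·) = _ from
    Measure.map_addHaar_smul volume hn.ne', lintegral_smul_measure] at h1
  simp only [norm_smul, Real.norm_of_nonneg hn.le, Module.finrank_fin_fun] at h1
  rw [← h1, abs_of_pos (by positivity), smul_eq_mul]

/-- Integration against the first and the remaining coordinates. -/
lemma lintegral_mul_tail (m : ℕ) {f : ℝ → ℝ≥0∞} {φ : (Fin (m + 1) → ℝ) → ℝ≥0∞}
    (hf : Measurable f) (hφ : Measurable φ) :
    ∫⁻ x : EuclideanSpace ℝ (Fin (m + 2)), f (x 0) * φ (fun j => x j.succ) =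
      (∫⁻ t, f t) * ∫⁻ y, φ y := by
  have h1 := (PiLp.volume_preserving_ofLp (Fin (m + 2))).lintegral_comp
    (f := fun x : Fin (m + 2) → ℝ => f (x 0) * φ (fun j => x j.succ)) (by fun_prop)
  have h2 := (volume_preserving_piFinSuccAbove (fun _ : Fin (m + 2) => ℝ) 0).lintegral_comp
    (f := fun z : ℝ × (Fin (m + 1) → ℝ) => f z.1 * φ z.2) (by fun_prop)
  have h3 := lintegral_prod_mul (μ := (volume : Measure ℝ))
    (ν := (volume : Measure (Fin (m + 1) → ℝ))) hf.aemeasurable hφ.aemeasurable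
  exact h1.trans (h2.trans h3)

lemma lintegral_sphere_tail_le (m : ℕ) {φ : (Fin (m + 1) → ℝ) → ℝ≥0∞} (hφ : Measurable φ)
    (hanti : ∀ y, ∀ r ∈ Set.Ioc (0 : ℝ) 1, φ y ≤ φ (r • y)) :
    ∫⁻ ω : Sph (m + 2), φ (fun j => (ω : EuclideanSpace ℝ (Fin (m + 2))) j.succ)
      ∂sphMeasure (m + 2) ≤ 2 ^ (m + 3) * ∫⁻ y, φ y := by
  have hI : Measurable ((Set.Icc (-1 : ℝ) 1).indicator (1 : ℝ → ℝ≥0∞)) :=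
    measurable_one.indicator measurableSet_Icc
  have h1 := lintegral_mul_tail m hI hφ
  rw [lintegral_indicator_one measurableSet_Icc, Real.volume_Icc,
    lintegral_eq_lintegral_toSphere _ (by fun_prop)] at h1
  have h2 : ENNReal.ofReal ((1 / 2) ^ (m + 2)) *
      ∫⁻ ω : Sph (m + 2), φ (fun j => (ω : EuclideanSpace ℝ (Fin (m + 2))) j.succ)
      ∂sphMeasure (m + 2) ≤ ENNReal.ofReal 2 * ∫⁻ y, φ y := by
    rw [show (2 : ℝ) = 1 - -1 by norm_num, ← h1, ← lintegral_const_mul' _ _ ENNReal.ofReal_ne_top]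
    refine lintegral_mono fun ω => ?_
    have hω : ‖(ω : EuclideanSpace ℝ (Fin (m + 2)))‖ = 1 := by simp
    have hω0 := PiLp.norm_apply_le (ω : EuclideanSpace ℝ (Fin (m + 2))) 0
    rw [hω, Real.norm_eq_abs, abs_le] at hω0
    calc _ = ∫⁻ r in Set.Ioc (1 / 2 : ℝ) 1, ENNReal.ofReal ((1 / 2) ^ (m + 1)) *
          φ (fun j => (ω : EuclideanSpace ℝ (Fin (m + 2))) j.succ) := by
          rw [setLIntegral_const, Real.volume_Ioc, mul_right_comm,
            ← ENNReal.ofReal_mul (by positivity)]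
          congr 2
          rw [pow_succ]
          norm_num
      _ ≤ ∫⁻ r in Set.Ioc (1 / 2 : ℝ) 1, ENNReal.ofReal
          (r ^ (Module.finrank ℝ (EuclideanSpace ℝ (Fin (m + 2))) - 1)) *
          ((Set.Icc (-1 : ℝ) 1).indicator (1 : ℝ → ℝ≥0∞)
            ((r • (ω : EuclideanSpace ℝ (Fin (m + 2)))) 0) *
          φ (fun j => (r • (ω : EuclideanSpace ℝ (Fin (m + 2)))) j.succ)) := by
        refine setLIntegral_mono' measurableSet_Ioc fun r hr => ?_
        have hr0 : 0 < r := lt_trans (by norm_num) hr.1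
        have hmem : (r • (ω : EuclideanSpace ℝ (Fin (m + 2)))) 0 ∈ Set.Icc (-1 : ℝ) 1 := by
          rw [PiLp.smul_apply, smul_eq_mul]
          constructor <;> nlinarith [hr.2, hω0.1, hω0.2]
        rw [Set.indicator_of_mem hmem, Pi.one_apply, one_mul, finrank_euclideanSpace_fin]
        refine mul_le_mul' (ENNReal.ofReal_le_ofReal ?_) (hanti _ r ⟨hr0, hr.2⟩)
        exact pow_le_pow_left₀ (by norm_num) hr.1.le _
      _ ≤ _ := lintegral_mono_set fun r hr => lt_trans (by norm_num) hr.1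
  have h3 : ENNReal.ofReal (2 ^ (m + 2)) * ENNReal.ofReal ((1 / 2) ^ (m + 2)) = 1 := by
    rw [← ENNReal.ofReal_mul (by positivity), ← mul_pow]
    norm_num
  have h4 := mul_le_mul_right h2 (ENNReal.ofReal (2 ^ (m + 2)))
  rw [← mul_assoc, h3, one_mul, ← mul_assoc, ← ENNReal.ofReal_mul (by positivity)] at h4
  convert h4 using 2
  rw [← pow_succ, ENNReal.ofReal_pow (by norm_num)]
  simp

/-- The mass of `(1 + n ρ)^{-r}`, `ρ` being the distance to the polar axis. -/
lemma exists_lintegral_sphere_rpow_le (m : ℕ) {r : ℝ} (hr : (m : ℝ) + 1 < r) :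
    ∃ C : ℝ, 0 < C ∧ ∀ n : ℕ, 1 ≤ n →
      ∫⁻ ω : Sph (m + 2), ENNReal.ofReal ((1 + n *
        ‖fun j : Fin (m + 1) => (ω : EuclideanSpace ℝ (Fin (m + 2))) j.succ‖) ^ (-r))
        ∂sphMeasure (m + 2) ≤ ENNReal.ofReal (C * ((n : ℝ) ^ (m + 1))⁻¹) := by
  have hfin : ∫⁻ y : Fin (m + 1) → ℝ, ENNReal.ofReal ((1 + ‖y‖) ^ (-r)) ≠ ∞ :=
    (finite_integral_one_add_norm (by simpa using hr)).ne
  set I := ∫⁻ y : Fin (m + 1) → ℝ, ENNReal.ofReal ((1 + ‖y‖) ^ (-r))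
  have hm : (0 : ℝ) ≤ m := m.cast_nonneg
  refine ⟨2 ^ (m + 3) * (I.toReal + 1), by positivity, fun n hn => ?_⟩
  have hn0 : (0 : ℝ) < n := by exact_mod_cast hn
  refine (lintegral_sphere_tail_le m (φ := fun y => ENNReal.ofReal ((1 + n * ‖y‖) ^ (-r)))
    (by fun_prop) fun y s hs => ENNReal.ofReal_le_ofReal ?_).trans ?_
  · refine Real.rpow_le_rpow_of_nonpos (by positivity) ?_ (by linarith)
    have : s * ‖y‖ ≤ 1 * ‖y‖ := by
      gcongr
      exact hs.2
    rw [norm_smul, Real.norm_of_nonneg hs.1.le]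
    gcongr
    linarith
  · rw [lintegral_one_add_mul_norm_rpow (m + 1) hn0 r, mul_assoc,
      ENNReal.ofReal_mul (by positivity), ENNReal.ofReal_pow (by norm_num), ENNReal.ofReal_ofNat,
      mul_comm (I.toReal + 1), ENNReal.ofReal_mul (by positivity)]
    gcongr
    exact (ENNReal.ofReal_toReal hfin).symm.le.trans (ENNReal.ofReal_le_ofReal (by linarith))

end SphereIntegral

section ReverseHolder

lemma exists_eLpNorm_le_of_isHomogeneous {d : ℕ} (hd : 1 ≤ d) {p q : ℝ≥0∞} (hp : p ≠ 0)
    (hpq : p < q) :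
    ∃ C : ℝ, 0 < C ∧ ∀ (n : ℕ) (P : MvPolynomial (Fin d) ℝ), 1 ≤ n → P.IsHomogeneous n →
      eLpNorm (fun ω : Sph d => MvPolynomial.eval
          (fun i => (ω : EuclideanSpace ℝ (Fin d)) i) P) q (sphMeasure d) ≤
        ENNReal.ofReal (C * (n : ℝ) ^ (((d : ℝ) - 1) * (1 / p.toReal - 1 / q.toReal))) *
          eLpNorm (fun ω : Sph d => MvPolynomial.eval
            (fun i => (ω : EuclideanSpace ℝ (Fin d)) i) P) p (sphMeasure d) := by
  obtain ⟨K, hK, h⟩ := exists_ofReal_max_le_eLpNorm hd hp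
  refine ⟨K ^ (1 - p.toReal / q.toReal), by positivity, fun n P hn hP => ?_⟩
  obtain ⟨x₀, hx₀, hmax⟩ := exists_isMax_abs_eval hd P
  have hn0 : (0 : ℝ) < n := by exact_mod_cast hn
  have hD : 0 < K * (n : ℝ) ^ (((d : ℝ) - 1) / p.toReal) := by positivity
  have h1 := h n P x₀ hn hP hx₀ hmax
  have h2 := eLpNorm_le_of_max_le (μ := sphMeasure d) (Y := fun ω : Sph d => MvPolynomial.eval
    (fun i => (ω : EuclideanSpace ℝ (Fin d)) i) P) hD hp hpq fun ω => by
      refine le_trans ?_ h1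
      rw [Real.enorm_eq_ofReal_abs]
      exact ENNReal.ofReal_le_ofReal (hmax _ (by simp))
  have hp0 : p.toReal ≠ 0 := (ENNReal.toReal_pos hp (ne_top_of_lt hpq)).ne'
  rw [Real.mul_rpow hK.le (by positivity), ← Real.rpow_mul hn0.le] at h2
  have h3 : ((d : ℝ) - 1) / p.toReal * (1 - p.toReal / q.toReal) =
      ((d : ℝ) - 1) * (1 / p.toReal - 1 / q.toReal) := by
    rw [mul_sub, mul_one, div_mul_div_cancel₀ hp0]
    ring
  rwa [h3] at h2

lemma exists_eLpNorm_zonal_le (m : ℕ) {p : ℝ≥0∞} (hp : p ≠ 0) (hp' : p ≠ ∞)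
    (hmp : (m : ℝ) + 1 < m * p.toReal / 2) :
    ∃ C : ℝ, 0 < C ∧ ∀ (n : ℕ) (M : ℝ), 1 ≤ n →
      (∀ x : EuclideanSpace ℝ (Fin (m + 2)), ‖x‖ = 1 →
        |MvPolynomial.eval (fun i => x i) (zonal m n)| ≤ M) →
      eLpNorm (fun ω : Sph (m + 2) => MvPolynomial.eval
          (fun i => (ω : EuclideanSpace ℝ (Fin (m + 2))) i) (zonal m n)) p (sphMeasure (m + 2)) ≤
        ENNReal.ofReal (C * (n : ℝ) ^ (-((m : ℝ) + 1) / p.toReal) * M) := by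
  obtain ⟨A, hA, h⟩ := sq_eval_zonal_mul_le m
  obtain ⟨C, hC, hint⟩ := exists_lintegral_sphere_rpow_le m hmp
  have hs : 0 < p.toReal := ENNReal.toReal_pos hp hp'
  set s := p.toReal with hs_def
  refine ⟨(A ^ (s / 2) * C) ^ (1 / s), by positivity, fun n M hn hM => ?_⟩
  have hn0 : (0 : ℝ) < n := by exact_mod_cast hn
  have hM0 : 0 ≤ M := by
    obtain ⟨x, hx, -⟩ := exists_eval_zonal_eq_zonalAngle m n 0
    exact (abs_nonneg _).trans (hM x hx)
  rw [eLpNorm_eq_lintegral_rpow_enorm_toReal hp hp', ← hs_def]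
  have hpt : ∀ ω : Sph (m + 2), ‖MvPolynomial.eval
      (fun i => (ω : EuclideanSpace ℝ (Fin (m + 2))) i) (zonal m n)‖ₑ ^ s ≤
      ENNReal.ofReal (A ^ (s / 2) * M ^ s) * ENNReal.ofReal ((1 + n *
        ‖fun j : Fin (m + 1) => (ω : EuclideanSpace ℝ (Fin (m + 2))) j.succ‖) ^
          (-(m * s / 2))) := by
    intro ω
    have h1 := h n M hn hM ω (by simp)
    set B := 1 + n * ‖fun j : Fin (m + 1) => (ω : EuclideanSpace ℝ (Fin (m + 2))) j.succ‖
    have hB : 0 < B := by positivity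
    set Z := MvPolynomial.eval (fun i => (ω : EuclideanSpace ℝ (Fin (m + 2))) i) (zonal m n)
    rw [Real.enorm_eq_ofReal_abs, ENNReal.ofReal_rpow_of_nonneg (abs_nonneg _) hs.le,
      ← ENNReal.ofReal_mul (by positivity)]
    refine ENNReal.ofReal_le_ofReal ?_
    have h2 : ∀ y : ℝ, 0 ≤ y → y ^ s = (y ^ 2) ^ (s / 2) := fun y hy => by
      rw [← Real.rpow_natCast, ← Real.rpow_mul hy]
      congr 1
      push_cast
      ring
    have h3 : B ^ (-(m * s / 2)) = ((B ^ m)⁻¹) ^ (s / 2) := by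
      rw [← Real.rpow_natCast, ← Real.rpow_neg hB.le, ← Real.rpow_mul hB.le]
      congr 1
      ring
    rw [h2 _ (abs_nonneg _), h2 M hM0, h3, ← Real.mul_rpow hA.le (by positivity),
      ← Real.mul_rpow (by positivity) (by positivity), sq_abs]
    refine Real.rpow_le_rpow (sq_nonneg _) ?_ (by positivity)
    rwa [← div_eq_mul_inv, le_div_iff₀ (by positivity)]
  calc _ ≤ (ENNReal.ofReal (A ^ (s / 2) * M ^ s) *
        ENNReal.ofReal (C * ((n : ℝ) ^ (m + 1))⁻¹)) ^ (1 / s) := by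
        refine ENNReal.rpow_le_rpow ?_ (by positivity)
        refine (lintegral_mono hpt).trans ?_
        rw [lintegral_const_mul' _ _ ENNReal.ofReal_ne_top]
        exact mul_le_mul' le_rfl (hint n hn)
    _ = _ := by
      rw [← ENNReal.ofReal_mul (by positivity),
        ENNReal.ofReal_rpow_of_nonneg (by positivity) (by positivity)]
      congr 1
      have h1 : ((n : ℝ) ^ (m + 1))⁻¹ ^ (1 / s) = (n : ℝ) ^ (-((m : ℝ) + 1) / s) := by
        rw [← Real.rpow_natCast, ← Real.rpow_neg hn0.le, ← Real.rpow_mul hn0.le]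
        congr 1
        push_cast
        ring
      have h2 : (M ^ s) ^ (1 / s) = M := by
        rw [← Real.rpow_mul hM0, mul_one_div_cancel hs.ne', Real.rpow_one]
      rw [show A ^ (s / 2) * M ^ s * (C * ((n : ℝ) ^ (m + 1))⁻¹) =
        A ^ (s / 2) * C * ((n : ℝ) ^ (m + 1))⁻¹ * M ^ s by ring,
        Real.mul_rpow (by positivity) (by positivity),
        Real.mul_rpow (by positivity) (by positivity), h1, h2]

/-- Zonal harmonics saturate the reverse Hölder inequality above the critical exponent. -/
lemma exists_le_eLpNorm_zonal (m : ℕ) {p q : ℝ≥0∞} (hp : p ≠ 0) (hpq : p < q)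
    (hmp : (m : ℝ) + 1 < m * p.toReal / 2) :
    ∃ c : ℝ, 0 < c ∧ ∀ n : ℕ, 1 ≤ n →
      ENNReal.ofReal (c * (n : ℝ) ^ (((m : ℝ) + 1) * (1 / p.toReal - 1 / q.toReal))) *
        eLpNorm (fun ω : Sph (m + 2) => MvPolynomial.eval
          (fun i => (ω : EuclideanSpace ℝ (Fin (m + 2))) i) (zonal m n)) p (sphMeasure (m + 2)) ≤
      eLpNorm (fun ω : Sph (m + 2) => MvPolynomial.eval
          (fun i => (ω : EuclideanSpace ℝ (Fin (m + 2))) i) (zonal m n)) q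
            (sphMeasure (m + 2)) := by
  obtain ⟨C, hC, hup⟩ := exists_eLpNorm_zonal_le m hp (ne_top_of_lt hpq) hmp
  obtain ⟨K, hK, hlow⟩ := exists_ofReal_max_le_eLpNorm (d := m + 2) (by omega)
    (bot_lt_of_lt hpq).ne'
  refine ⟨(C * K)⁻¹, by positivity, fun n hn => ?_⟩
  have hn0 : (0 : ℝ) < n := by exact_mod_cast hn
  obtain ⟨x₀, hx₀, hmax⟩ := exists_isMax_abs_eval (d := m + 2) (by omega) (zonal m n)
  have h1 := hlow n (zonal m n) x₀ hn (isHomogeneous_zonal m n) hx₀ hmax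
  have h2 := hup n _ hn hmax
  set M := |MvPolynomial.eval (fun i => x₀ i) (zonal m n)|
  set a := ((m : ℝ) + 1) / p.toReal
  set b := (((m + 2 : ℕ) : ℝ) - 1) / q.toReal
  have hab : ((m : ℝ) + 1) * (1 / p.toReal - 1 / q.toReal) = a - b := by
    simp only [a, b]
    push_cast
    ring
  have hneg : -((m : ℝ) + 1) / p.toReal = -a := neg_div _ _
  rw [hneg] at h2
  rw [hab]
  calc _ ≤ ENNReal.ofReal ((C * K)⁻¹ * (n : ℝ) ^ (a - b)) *
        ENNReal.ofReal (C * (n : ℝ) ^ (-a) * M) := mul_le_mul' le_rfl h2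
    _ = ENNReal.ofReal ((K * (n : ℝ) ^ b)⁻¹) * ENNReal.ofReal M := by
      rw [← ENNReal.ofReal_mul (by positivity), ← ENNReal.ofReal_mul (by positivity)]
      congr 1
      have : (n : ℝ) ^ (a - b) * (n : ℝ) ^ (-a) = ((n : ℝ) ^ b)⁻¹ := by
        rw [← Real.rpow_add hn0, ← Real.rpow_neg hn0.le]
        congr 1
        ring
      rw [mul_inv, mul_inv, ← this]
      field_simp
    _ ≤ ENNReal.ofReal ((K * (n : ℝ) ^ b)⁻¹) * (ENNReal.ofReal (K * (n : ℝ) ^ b) * _) :=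
      mul_le_mul' le_rfl h1
    _ = _ := by
      rw [← mul_assoc, ← ENNReal.ofReal_mul (by positivity), inv_mul_cancel₀ (by positivity),
        ENNReal.ofReal_one, one_mul]

end ReverseHolder

/-- Theorem 1.1(iii): if `2 + 1/λ < p < q ≤ ∞`, then
`‖Y_n‖_q ∼ n^{(2λ+1)(1/p - 1/q)} ‖Y_n‖_p` (sharp) for spherical harmonics of degree `n`,
where `λ = (d-2)/2`. -/
theorem reverse_holder_range_iii
    (d : ℕ) (hd : 3 ≤ d) (p q : ℝ≥0∞)
    (hp : 2 + 1 / (((d : ℝ≥0∞) - 2) / 2) < p) (hpq : p < q) (hq : q ≤ ∞) :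
    ∃ c C : ℝ, 0 < c ∧ 0 < C ∧ ∀ n : ℕ, 1 ≤ n →
      ((∀ Y : Sph d → ℝ, IsSphericalHarmonic d n Y →
          eLpNorm Y q (sphMeasure d) ≤
            ENNReal.ofReal
                (C * (n : ℝ) ^
                  ((2 * (((d : ℝ) - 2) / 2) + 1) * (1 / p.toReal - 1 / q.toReal))) *
              eLpNorm Y p (sphMeasure d)) ∧
        (∃ Y : Sph d → ℝ, IsSphericalHarmonic d n Y ∧ Y ≠ 0 ∧
          ENNReal.ofReal
              (c * (n : ℝ) ^
                ((2 * (((d : ℝ) - 2) / 2) + 1) * (1 / p.toReal - 1 / q.toReal))) *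
            eLpNorm Y p (sphMeasure d) ≤ eLpNorm Y q (sphMeasure d))) := by
  obtain ⟨m, rfl⟩ := Nat.exists_eq_add_of_le' (show 2 ≤ d by omega)
  have hm : (0 : ℝ) < m := by exact_mod_cast (by omega : 0 < m)
  have hp_top : p ≠ ∞ := ne_top_of_lt hpq
  have hp0 : p ≠ 0 := (bot_lt_of_lt hp).ne'
  have hmp : (m : ℝ) + 1 < m * p.toReal / 2 := by
    rw [show ((m + 2 : ℕ) : ℝ≥0∞) - 2 = m by push_cast; simp] at hp
    have h1 := ENNReal.toReal_strict_mono hp_top hp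
    have hm' : (m : ℝ≥0∞) / 2 ≠ 0 := by
      simpa using hm.ne'
    rw [ENNReal.toReal_add (by simp) (by simpa using hm'), ENNReal.toReal_div,
      ENNReal.toReal_div, ENNReal.toReal_natCast, ENNReal.toReal_ofNat, ENNReal.toReal_one] at h1
    have h2 := mul_lt_mul_of_pos_left h1 hm
    have h3 : (m : ℝ) * (2 + 1 / (m / 2)) = 2 * m + 2 := by field_simp
    linarith
  obtain ⟨c, hc, hlow⟩ := exists_le_eLpNorm_zonal m hp0 hpq hmp
  obtain ⟨C, hC, hup⟩ := exists_eLpNorm_le_of_isHomogeneous (d := m + 2) (by omega) hp0 hpq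
  refine ⟨c, C, hc, hC, fun n hn => ⟨?_, ?_⟩⟩
  · rintro Y ⟨P, hP, -, hY⟩
    obtain rfl : Y = _ := funext hY
    convert hup n P hn hP using 5
    push_cast
    ring
  · refine ⟨_, ⟨zonal m n, isHomogeneous_zonal m n, laplacian_zonal m n, fun _ => rfl⟩, ?_, ?_⟩
    · intro h0
      obtain ⟨x, hx, hx'⟩ := exists_eval_zonal_eq_zonalAngle m n 0
      have := congrFun h0 ⟨x, by simpa using hx⟩
      rw [zonalAngle_zero] at hx'
      simp only [Pi.zero_apply] at this
      exact one_ne_zero (hx'.symm.trans this)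
    · convert hlow n hn using 5
      push_cast
      ring
end
end
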